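/- For every ε > 0 there is a constant C_ε > 0 such that the following holds. Let q be a prime power, let 0 < k < d be integers, let a, s be real numbers with 0 < s < (a + 2k − d)/2, and let E ⊆ F_q^d with |E| = q^a. Then |T_s^{k,d}(E)| ≤ C_ε · q^ε · q^{max(k(d−k)+2(s−a), (k−1)(d−k))}. -/

import Mathlib

open scoped BigOperators

/-- The orthogonal complement of a subspace of `Fin d → F` with respect to the
dot product `x · y = ∑ i, x i * y i`. -/
noncomputable def perp {F : Type*} [Field F] {d : ℕ} (V : Submodule F (Fin d → F)) :
    Submodule F (Fin d → F) where
  carrier := {y | ∀ x ∈ V, ∑ i, x i * y i = 0}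
  zero_mem' := by
    intro x hx
    simp
  add_mem' := by
    intro a b ha hb x hx
    have h : ∑ i, x i * (a + b) i = (∑ i, x i * a i) + (∑ i, x i * b i) := by
      simp [mul_add, Finset.sum_add_distrib]
    simp only [Set.mem_setOf_eq] at ha hb ⊢
    rw [h, ha x hx, hb x hx, add_zero]
  smul_mem' := by
    intro c y hy x hx
    have h : ∑ i, x i * (c • y) i = c * ∑ i, x i * y i := by
      rw [Finset.mul_sum]
      refine Finset.sum_congr rfl fun i _ => ?_
      simp [mul_left_comm]
    simp only [Set.mem_setOf_eq] at hy ⊢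
    rw [h, hy x hx, mul_zero]

/-- `projCount V E` is the size `|π_V(E)|` of the orthogonal projection of `E` onto `V`,
i.e. the number of cosets of `V^⊥` meeting `E`, i.e. the cardinality of the image of `E`
under the quotient map `F^d → F^d / V^⊥`. -/
noncomputable def projCount {F : Type*} [Field F] {d : ℕ}
    (V : Submodule F (Fin d → F)) (E : Set (Fin d → F)) : ℕ :=
  ((perp V).mkQ '' E).ncard

/-- `Tset F k d s E` is `T_s^{k,d}(E)`, the set of `k`-dimensional subspaces `V`
with `|π_V(E)| < q^s`. -/
noncomputable def Tset (F : Type*) [Field F] [Fintype F] (k d : ℕ) (s : ℝ)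
    (E : Set (Fin d → F)) : Set (Submodule F (Fin d → F)) :=
  {V | Module.finrank F ↥V = k ∧ (projCount V E : ℝ) < (Fintype.card F : ℝ) ^ s}

set_option linter.unusedSectionVars false

section Fibers

variable {V : Type*} [AddCommGroup V] [Fintype V]

open Classical in
/-- The elements of `X` lying in the coset `x + U`. -/
noncomputable def cosetPart (X : Finset V) (U : AddSubgroup V) (x : V) : Finset V :=
  X.filter (fun y => y - x ∈ U)

open Classical in
/-- The sumset `X + U`. -/
noncomputable def thicken (X : Finset V) (U : AddSubgroup V) : Finset V :=
  Finset.univ.filter (fun z => ∃ x ∈ X, z - x ∈ U)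

open Classical in
/-- Pairs of elements of `X` in a common coset of `U`. -/
noncomputable def cosetPairs (X : Finset V) (U : AddSubgroup V) : Finset (V × V) :=
  (X ×ˢ X).filter (fun p => p.1 - p.2 ∈ U)

theorem mem_cosetPart {X : Finset V} {U : AddSubgroup V} {x y : V} :
    y ∈ cosetPart X U x ↔ y ∈ X ∧ y - x ∈ U := by
  simp [cosetPart]

theorem mem_thicken {X : Finset V} {U : AddSubgroup V} {z : V} :
    z ∈ thicken X U ↔ ∃ x ∈ X, z - x ∈ U := by
  simp [thicken]

theorem mem_cosetPairs {X : Finset V} {U : AddSubgroup V} {p : V × V} :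
    p ∈ cosetPairs X U ↔ (p.1 ∈ X ∧ p.2 ∈ X) ∧ p.1 - p.2 ∈ U := by
  simp [cosetPairs]

theorem subset_thicken (X : Finset V) (U : AddSubgroup V) : X ⊆ thicken X U := fun x hx =>
  mem_thicken.2 ⟨x, hx, by simp [U.zero_mem]⟩

theorem thicken_invariant {X : Finset V} {U : AddSubgroup V} {x y : V}
    (hx : x ∈ thicken X U) (h : y - x ∈ U) : y ∈ thicken X U := by
  obtain ⟨w, hw, hwx⟩ := mem_thicken.1 hx
  exact mem_thicken.2 ⟨w, hw, by simpa using U.add_mem h hwx⟩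

theorem cosetPart_congr (X : Finset V) {U : AddSubgroup V} {x y : V} (h : x - y ∈ U) :
    cosetPart X U x = cosetPart X U y := by
  ext z
  simp only [mem_cosetPart, and_congr_right_iff]
  intro _
  constructor
  · intro hz
    simpa using U.add_mem hz h
  · intro hz
    simpa using U.sub_mem hz h

theorem card_cosetPart_univ (U : AddSubgroup V) (z : V) :
    (cosetPart Finset.univ U z).card = Nat.card U := by
  classical
  rw [← Fintype.card_coe, ← Nat.card_eq_fintype_card]
  refine Nat.card_congr ⟨fun y => ⟨y.1 - z, (mem_cosetPart.1 y.2).2⟩,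
    fun u => ⟨u.1 + z, mem_cosetPart.2 ⟨Finset.mem_univ _, by simp⟩⟩, fun y => by simp,
    fun u => by simp⟩

theorem card_cosetPart_univ_of_invariant {S : Finset V} {U : AddSubgroup V}
    (hS : ∀ x ∈ S, ∀ y, y - x ∈ U → y ∈ S) {z : V} (hz : z ∈ S) :
    (cosetPart S U z).card = Nat.card U := by
  rw [← card_cosetPart_univ U z]
  congr 1
  ext y
  simp only [mem_cosetPart, Finset.mem_univ, true_and, and_iff_right_iff_imp]
  exact hS z hz y

open Classical in
theorem sum_card_cosetPart_mul (X Y : Finset V) (U : AddSubgroup V) :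
    ∑ z, (cosetPart X U z).card * (cosetPart Y U z).card =
      Nat.card U * ((X ×ˢ Y).filter (fun p => p.1 - p.2 ∈ U)).card := by
  have key : ∀ z, (cosetPart X U z).card * (cosetPart Y U z).card =
      ∑ p ∈ X ×ˢ Y, if p.1 - z ∈ U ∧ p.2 - z ∈ U then 1 else 0 := by
    intro z
    rw [← Finset.card_product, ← Finset.card_filter]
    congr 1
    ext p
    simp only [Finset.mem_product, mem_cosetPart, Finset.mem_filter]
    tauto
  simp_rw [key]
  rw [Finset.sum_comm, Finset.card_filter, Finset.mul_sum]
  refine Finset.sum_congr rfl fun p _ => ?_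
  rw [← Finset.card_filter]
  split_ifs with h
  · rw [mul_one, ← card_cosetPart_univ U p.1]
    congr 1
    ext z
    simp only [Finset.mem_filter, Finset.mem_univ, true_and, mem_cosetPart]
    constructor
    · rintro ⟨h1, -⟩
      simpa using U.neg_mem h1
    · intro h1
      refine ⟨by simpa using U.neg_mem h1, ?_⟩
      have := U.neg_mem (U.add_mem h h1)
      rwa [show -(p.1 - p.2 + (z - p.1)) = p.2 - z by abel] at this
  · rw [mul_zero, Finset.card_eq_zero, Finset.filter_eq_empty_iff]
    rintro z - ⟨h1, h2⟩
    exact h (by simpa using U.sub_mem h1 h2)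

theorem sum_card_cosetPart_sq (X : Finset V) (U : AddSubgroup V) :
    ∑ z, (cosetPart X U z).card ^ 2 = Nat.card U * (cosetPairs X U).card := by
  simp_rw [sq]
  exact sum_card_cosetPart_mul X X U

theorem sum_card_cosetPart (X : Finset V) (U : AddSubgroup V) :
    ∑ z, (cosetPart X U z).card = Nat.card U * X.card := by
  classical
  simp_rw [cosetPart, Finset.card_filter]
  rw [Finset.sum_comm, mul_comm, ← smul_eq_mul, ← Finset.sum_const]
  refine Finset.sum_congr rfl fun x _ => ?_
  rw [← Finset.card_filter, ← card_cosetPart_univ U x]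
  congr 1
  ext z
  simp only [Finset.mem_filter, Finset.mem_univ, true_and, mem_cosetPart]
  rw [← U.neg_mem_iff, neg_sub]

theorem card_cosetPairs (X : Finset V) (U : AddSubgroup V) :
    (cosetPairs X U).card = ∑ x ∈ X, (cosetPart X U x).card := by
  classical
  simp_rw [cosetPairs, cosetPart, Finset.card_filter]
  rw [Finset.sum_product_right]

/-- Cauchy--Schwarz over the cosets of `U` inside a `U`-invariant set. -/
theorem card_sq_mul_le_card_mul_cosetPairs {X S : Finset V} {U : AddSubgroup V}
    (hS : ∀ x ∈ S, ∀ y, y - x ∈ U → y ∈ S) (hX : X ⊆ S) :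
    Nat.card U * X.card ^ 2 ≤ S.card * (cosetPairs X U).card := by
  have hz : ∀ z ∉ S, (cosetPart X U z).card = 0 := by
    intro z hz
    rw [Finset.card_eq_zero, Finset.eq_empty_iff_forall_notMem]
    intro y hy
    obtain ⟨hy1, hy2⟩ := mem_cosetPart.1 hy
    exact hz (hS y (hX hy1) z (by simpa using U.neg_mem hy2))
  have h1 : ∑ z ∈ S, (cosetPart X U z).card = Nat.card U * X.card := by
    rw [← sum_card_cosetPart]
    exact Finset.sum_subset (Finset.subset_univ _) fun z _ h => hz z h
  have h2 : ∑ z ∈ S, (cosetPart X U z).card ^ 2 = Nat.card U * (cosetPairs X U).card := by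
    rw [← sum_card_cosetPart_sq]
    exact Finset.sum_subset (Finset.subset_univ _) fun z _ h => by simp [hz z h]
  have h3 := sq_sum_le_card_mul_sum_sq (s := S) (f := fun z => (cosetPart X U z).card)
  simp only [Nat.cast_id] at h3
  rw [h1, h2] at h3
  have hU : 0 < Nat.card U := Nat.card_pos
  refine Nat.le_of_mul_le_mul_left ?_ hU
  calc _ = (Nat.card U * X.card) ^ 2 := by ring
    _ ≤ _ := h3
    _ = _ := by ring

/-- For `U ⊕ U' = H`, the sets invariant under `U` and `U'` are independent in each coset of `H`. -/
theorem card_cosetPart_inter {U U' H : AddSubgroup V} (hd : U ⊓ U' = ⊥) (hs : U ⊔ U' = H)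
    {S S' : Finset V} (hS : ∀ x ∈ S, ∀ y, y - x ∈ U → y ∈ S)
    (hS' : ∀ x ∈ S', ∀ y, y - x ∈ U' → y ∈ S') [DecidableEq V] (z : V) :
    (cosetPart (S ∩ S') H z).card * (Nat.card U * Nat.card U') =
      (cosetPart S H z).card * (cosetPart S' H z).card := by
  classical
  have hU : U ≤ H := hs ▸ le_sup_left
  have hU' : U' ≤ H := hs ▸ le_sup_right
  rw [Nat.card_eq_fintype_card, Nat.card_eq_fintype_card, ← Finset.card_univ,
    ← Finset.card_univ, ← Finset.card_product, ← Finset.card_product, ← Finset.card_product]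
  refine Finset.card_bij (fun p _ => (p.1 + p.2.1.1, p.1 + p.2.2.1)) ?_ ?_ ?_
  · rintro ⟨p, u, u'⟩ hp
    simp only [Finset.mem_product, mem_cosetPart, Finset.mem_inter, Finset.mem_univ, and_true]
      at hp ⊢
    obtain ⟨⟨h1, h2⟩, h3⟩ := hp
    refine ⟨⟨hS _ h1 _ (by simp), ?_⟩, hS' _ h2 _ (by simp), ?_⟩
    · rw [add_sub_right_comm]
      exact H.add_mem h3 (hU u.2)
    · rw [add_sub_right_comm]
      exact H.add_mem h3 (hU' u'.2)
  · rintro ⟨p, u, u'⟩ _ ⟨r, w, w'⟩ _ h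
    simp only [Prod.mk.injEq] at h
    obtain ⟨h1, h2⟩ := h
    have h3 : p - r = w.1 - u.1 := by
      rw [sub_eq_sub_iff_add_eq_add, h1, add_comm]
    have h4 : p - r = w'.1 - u'.1 := by
      rw [sub_eq_sub_iff_add_eq_add, h2, add_comm]
    have h5 : p - r ∈ U ⊓ U' :=
      ⟨h3 ▸ U.sub_mem w.2 u.2, h4 ▸ U'.sub_mem w'.2 u'.2⟩
    rw [hd, AddSubgroup.mem_bot, sub_eq_zero] at h5
    subst h5
    rw [Subtype.ext (add_left_cancel h1), Subtype.ext (add_left_cancel h2)]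
  · rintro ⟨x, y⟩ hxy
    simp only [Finset.mem_product, mem_cosetPart] at hxy
    obtain ⟨⟨hx, hxz⟩, hy, hyz⟩ := hxy
    have hxy : x - y ∈ U ⊔ U' := hs ▸ by simpa using H.sub_mem hxz hyz
    obtain ⟨a, ha, b, hb, hab⟩ := AddSubgroup.mem_sup.1 hxy
    refine ⟨(x - a, ⟨a, ha⟩, ⟨-b, U'.neg_mem hb⟩), ?_, ?_⟩
    · simp only [Finset.mem_product, mem_cosetPart, Finset.mem_inter, Finset.mem_univ, and_true]
      refine ⟨⟨hS x hx _ (by simpa using U.neg_mem ha), hS' y hy _ ?_⟩, ?_⟩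
      · rw [show x - a - y = b by rw [sub_right_comm, ← hab]; abel]
        exact hb
      · rw [sub_right_comm]
        exact H.sub_mem hxz (hU ha)
    · simp only [Prod.mk.injEq]
      refine ⟨by abel, ?_⟩
      rw [show x - a + -b = x - (a + b) by abel, hab]
      abel

theorem card_mul_card_cosetPart_le {U U' H : AddSubgroup V} (hd : U ⊓ U' = ⊥)
    (hU : U ≤ H) (hU' : U' ≤ H) (X : Finset V) (z : V) :
    Nat.card U' * (cosetPart X U z).card ≤ (cosetPart (thicken X U') H z).card := by
  classical
  rw [mul_comm, Nat.card_eq_fintype_card, ← Finset.card_univ, ← Finset.card_product]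
  refine Finset.card_le_card_of_injOn (fun p => p.1 + p.2.1) ?_ ?_
  · rintro ⟨x, u⟩ h
    simp only [Finset.coe_product, Set.mem_prod, Finset.mem_coe, mem_cosetPart,
      Finset.mem_univ, and_true] at h ⊢
    refine ⟨mem_thicken.2 ⟨x, h.1, by simp⟩, ?_⟩
    rw [add_sub_right_comm]
    exact H.add_mem (hU h.2) (hU' u.2)
  · rintro ⟨x, u⟩ hx ⟨y, w⟩ hy h
    simp only [Finset.coe_product, Set.mem_prod, Finset.mem_coe, mem_cosetPart,
      Finset.mem_univ, and_true] at hx hy h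
    have h3 : x - y = w.1 - u.1 := by
      rw [sub_eq_sub_iff_add_eq_add, h, add_comm]
    have h5 : x - y ∈ U ⊓ U' :=
      ⟨by simpa using U.sub_mem hx.2 hy.2, h3 ▸ U'.sub_mem w.2 u.2⟩
    rw [hd, AddSubgroup.mem_bot, sub_eq_zero] at h5
    subst h5
    rw [Subtype.ext (add_left_cancel h)]

end Fibers

section System

open scoped Classical

/-- A family of partial spreads `(U φ l)_l`, indexed by `φ : Ω`, which is equidistributed among
a collection `G` of subgroups of `V`. -/
structure SpreadSystem (V Ω ι : Type*) [AddCommGroup V] [Fintype V] [Fintype Ω] [Fintype ι] where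
  U : Ω → ι → AddSubgroup V
  H : Ω → AddSubgroup V
  G : Finset (AddSubgroup V)
  M : ℕ
  Q : ℕ
  c : ℕ
  two_le_M : 2 ≤ M
  Q_pos : 0 < Q
  c_pos : 0 < c
  card_index : Fintype.card ι = M
  mem_G : ∀ φ l, U φ l ∈ G
  card_mem : ∀ A ∈ G, Nat.card A = M
  card_V : Fintype.card V = Q * M ^ 2
  inf_eq : ∀ φ l l', l ≠ l' → U φ l ⊓ U φ l' = ⊥
  sup_eq : ∀ φ l l', l ≠ l' → U φ l ⊔ U φ l' = H φ
  unif : ∀ l, ∀ A ∈ G, (Finset.univ.filter (fun φ => U φ l = A)).card = c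
  hit : ∀ l, ∀ A ∈ G, ∀ v, v ∉ A →
    Q * (Finset.univ.filter (fun φ => U φ l = A ∧ v ∈ H φ)).card ≤ c
  point : ∀ v, v ≠ 0 → Q * M * (G.filter (fun A => v ∈ A)).card ≤ G.card

variable {V Ω ι : Type*} [AddCommGroup V] [Fintype V] [Fintype Ω] [Fintype ι]

theorem card_sup_of_disjoint {A B : AddSubgroup V} (h : A ⊓ B = ⊥) :
    Nat.card ↥(A ⊔ B) = Nat.card A * Nat.card B := by
  rw [← Nat.card_prod]
  symm
  refine Nat.card_congr (Equiv.ofBijective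
    (fun p : A × B => (⟨p.1.1 + p.2.1, AddSubgroup.add_mem_sup p.1.2 p.2.2⟩ : ↥(A ⊔ B))) ⟨?_, ?_⟩)
  · rintro ⟨a, b⟩ ⟨a', b'⟩ hab
    simp only [Subtype.mk.injEq] at hab
    have h1 : a.1 - a'.1 = b'.1 - b.1 := by
      rw [sub_eq_sub_iff_add_eq_add, hab, add_comm]
    have h2 : a.1 - a'.1 ∈ A ⊓ B := ⟨A.sub_mem a.2 a'.2, h1 ▸ B.sub_mem b'.2 b.2⟩
    rw [h, AddSubgroup.mem_bot] at h2
    rw [h2, eq_comm, sub_eq_zero] at h1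
    rw [sub_eq_zero] at h2
    rw [Subtype.ext h2, Subtype.ext h1]
  · rintro ⟨x, hx⟩
    obtain ⟨a, ha, b, hb, hab⟩ := AddSubgroup.mem_sup.1 hx
    exact ⟨(⟨a, ha⟩, ⟨b, hb⟩), Subtype.ext hab⟩

namespace SpreadSystem

variable (S : SpreadSystem V Ω ι)

theorem M_pos : 0 < S.M := by have := S.two_le_M; omega

theorem card_U (φ : Ω) (l : ι) : Nat.card (S.U φ l) = S.M := S.card_mem _ (S.mem_G φ l)

theorem exists_ne (S : SpreadSystem V Ω ι) (l : ι) : ∃ l', l' ≠ l := by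
  have : 1 < Fintype.card ι := by rw [S.card_index]; exact S.two_le_M
  have : Nontrivial ι := Fintype.one_lt_card_iff_nontrivial.1 this
  exact _root_.exists_ne l

theorem index_nonempty (S : SpreadSystem V Ω ι) : Nonempty ι := by
  refine Fintype.card_pos_iff.1 ?_
  rw [S.card_index]; exact S.M_pos

theorem U_le_H (φ : Ω) (l : ι) : S.U φ l ≤ S.H φ := by
  obtain ⟨l', h⟩ := S.exists_ne l
  rw [← S.sup_eq φ l l' h.symm]
  exact le_sup_left

theorem card_H (φ : Ω) : Nat.card (S.H φ) = S.M ^ 2 := by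
  obtain ⟨l⟩ := S.index_nonempty
  obtain ⟨l', h⟩ := S.exists_ne l
  rw [← S.sup_eq φ l l' h.symm, card_sup_of_disjoint (S.inf_eq φ l l' h.symm), S.card_U, S.card_U,
    sq]

theorem card_Omega : Fintype.card Ω = S.c * S.G.card := by
  obtain ⟨l⟩ := S.index_nonempty
  rw [← Finset.card_univ, Finset.card_eq_sum_card_fiberwise (f := fun φ => S.U φ l) (t := S.G)
    (fun φ _ => S.mem_G φ l), Finset.sum_congr rfl (fun A hA => S.unif l A hA), Finset.sum_const,
    smul_eq_mul, mul_comm]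

/-- The incidences of the system with a subcollection `T`. -/
noncomputable def inc (T : Finset (AddSubgroup V)) : Finset (Ω × ι) :=
  Finset.univ.filter (fun p => S.U p.1 p.2 ∈ T)

/-- The parameters at which the system takes the value `A`. -/
noncomputable def fib (A : AddSubgroup V) (l : ι) : Finset Ω :=
  Finset.univ.filter (fun φ => S.U φ l = A)

theorem mem_inc {T : Finset (AddSubgroup V)} {p : Ω × ι} : p ∈ S.inc T ↔ S.U p.1 p.2 ∈ T := by
  simp [inc]

theorem mem_fib {A : AddSubgroup V} {l : ι} {φ : Ω} : φ ∈ S.fib A l ↔ S.U φ l = A := by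
  simp [fib]

theorem sum_inc (T : Finset (AddSubgroup V)) (f : Ω × ι → ℝ) :
    ∑ p ∈ S.inc T, f p = ∑ A ∈ T, ∑ l, ∑ φ ∈ S.fib A l, f (φ, l) := by
  have h1 : ∑ p ∈ S.inc T, f p = ∑ A ∈ T, ∑ p ∈ (S.inc T).filter (fun p => S.U p.1 p.2 = A), f p :=
    (Finset.sum_fiberwise_of_maps_to (fun p hp => S.mem_inc.1 hp) f).symm
  rw [h1]
  refine Finset.sum_congr rfl fun A hA => ?_
  have h2 : (S.inc T).filter (fun p => S.U p.1 p.2 = A) =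
      Finset.univ.filter (fun p : Ω × ι => S.U p.1 p.2 = A) := by
    ext p
    simp only [Finset.mem_filter, S.mem_inc, Finset.mem_univ, true_and, and_iff_right_iff_imp]
    rintro rfl
    exact hA
  rw [h2, Finset.sum_filter, Fintype.sum_prod_type_right]
  refine Finset.sum_congr rfl fun l _ => ?_
  rw [fib, Finset.sum_filter]

theorem sum_inc_eq_sum_Omega (T : Finset (AddSubgroup V)) (f : Ω × ι → ℝ) :
    ∑ p ∈ S.inc T, f p = ∑ φ, ∑ l with S.U φ l ∈ T, f (φ, l) := by
  rw [inc, Finset.sum_filter, Fintype.sum_prod_type]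
  refine Finset.sum_congr rfl fun φ _ => ?_
  rw [Finset.sum_filter]

theorem card_fib {A : AddSubgroup V} (hA : A ∈ S.G) (l : ι) : (S.fib A l).card = S.c :=
  S.unif l A hA

theorem card_inc {T : Finset (AddSubgroup V)} (hT : T ⊆ S.G) :
    ((S.inc T).card : ℝ) = S.M * S.c * T.card := by
  have h := S.sum_inc T (fun _ => 1)
  rw [Finset.sum_const, nsmul_eq_mul, mul_one] at h
  rw [h]
  have : ∀ A ∈ T, ∑ l : ι, ∑ φ ∈ S.fib A l, (1 : ℝ) = S.M * S.c := by
    intro A hA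
    have : ∀ l ∈ (Finset.univ : Finset ι), ∑ φ ∈ S.fib A l, (1 : ℝ) = S.c := by
      intro l _
      rw [Finset.sum_const, S.card_fib (hT hA), nsmul_eq_mul, mul_one]
    rw [Finset.sum_congr rfl this, Finset.sum_const, Finset.card_univ, S.card_index, nsmul_eq_mul]
  rw [Finset.sum_congr rfl this, Finset.sum_const, nsmul_eq_mul]
  ring

/-- Average number of hits of a multiset of vectors outside `A` by the spread spaces through `A`. -/
theorem sum_hit_le {α : Type*} {A : AddSubgroup V} (hA : A ∈ S.G) (l : ι) (P : Finset α)
    (f : α → V) (hP : ∀ p ∈ P, f p ∉ A) :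
    (S.Q : ℝ) * ∑ φ ∈ S.fib A l, ((P.filter (fun p => f p ∈ S.H φ)).card : ℝ) ≤ S.c * P.card := by
  have h1 : ∑ φ ∈ S.fib A l, ((P.filter (fun p => f p ∈ S.H φ)).card : ℝ) =
      ∑ p ∈ P, (((Finset.univ.filter (fun φ => S.U φ l = A ∧ f p ∈ S.H φ)).card : ℕ) : ℝ) := by
    simp_rw [Finset.card_filter, Nat.cast_sum]
    rw [Finset.sum_comm]
    refine Finset.sum_congr rfl fun p _ => ?_
    rw [fib, Finset.sum_filter]
    refine Finset.sum_congr rfl fun φ _ => ?_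
    split_ifs <;> simp_all
  rw [h1, Finset.mul_sum]
  calc _ ≤ ∑ p ∈ P, (S.c : ℝ) := Finset.sum_le_sum fun p hp => by
        exact_mod_cast S.hit l A hA (f p) (hP p hp)
    _ = _ := by rw [Finset.sum_const, nsmul_eq_mul, mul_comm]

theorem sum_hit_le' {α : Type*} {A : AddSubgroup V} (hA : A ∈ S.G) (l : ι) (P : Finset α)
    (f : α → V) :
    (S.Q : ℝ) * ∑ φ ∈ S.fib A l, ((P.filter (fun p => f p ∈ S.H φ)).card : ℝ) ≤
      S.c * (S.Q * (P.filter (fun p => f p ∈ A)).card + P.card) := by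
  have h1 := S.sum_hit_le hA l (P.filter (fun p => f p ∉ A)) f (by simp)
  have h2 : ∀ φ ∈ S.fib A l, ((P.filter (fun p => f p ∈ S.H φ)).card : ℝ) ≤
      (P.filter (fun p => f p ∈ A)).card +
        (((P.filter (fun p => f p ∉ A)).filter (fun p => f p ∈ S.H φ)).card : ℝ) := by
    intro φ _
    norm_cast
    refine (Finset.card_le_card ?_).trans (Finset.card_union_le _ _)
    intro p
    simp only [Finset.mem_filter, Finset.mem_union]
    tauto
  have h3 := Finset.sum_le_sum h2
  rw [Finset.sum_add_distrib, Finset.sum_const, S.card_fib hA, nsmul_eq_mul] at h3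
  have h4 : ((P.filter (fun p => f p ∉ A)).card : ℝ) ≤ P.card := by
    exact_mod_cast Finset.card_filter_le _ _
  have h5 := mul_le_mul_of_nonneg_left h3 (Nat.cast_nonneg (α := ℝ) S.Q)
  have h6 := mul_le_mul_of_nonneg_left h4 (Nat.cast_nonneg (α := ℝ) S.c)
  linarith

/-- Over all incidences, a nonzero vector is hit with the expected frequency. -/
theorem card_inc_hit_le {T : Finset (AddSubgroup V)} (hT : T ⊆ S.G) {C : ℝ} (hC : 0 < C)
    (hTC : C * S.G.card ≤ S.M * T.card) {v : V} (hv : v ≠ 0) :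
    (S.Q : ℝ) * ((S.inc T).filter (fun p => v ∈ S.H p.1)).card ≤
      (1 + 1 / C) * (S.inc T).card := by
  have e1 : (((S.inc T).filter (fun p => v ∈ S.H p.1)).card : ℝ) =
      ∑ A ∈ T, ∑ l, ∑ φ ∈ S.fib A l, if v ∈ S.H φ then (1 : ℝ) else 0 := by
    rw [← S.sum_inc T (fun p => if v ∈ S.H p.1 then (1 : ℝ) else 0), Finset.card_filter]
    push_cast
    rfl
  have e2 : ∀ A ∈ T, (S.Q : ℝ) * ∑ l, ∑ φ ∈ S.fib A l, (if v ∈ S.H φ then (1 : ℝ) else 0) ≤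
      S.M * S.c * ((if v ∈ A then (S.Q : ℝ) else 0) + 1) := by
    intro A hA
    rw [Finset.mul_sum]
    have : ∀ l ∈ (Finset.univ : Finset ι),
        (S.Q : ℝ) * ∑ φ ∈ S.fib A l, (if v ∈ S.H φ then (1 : ℝ) else 0) ≤
          S.c * ((if v ∈ A then (S.Q : ℝ) else 0) + 1) := by
      intro l _
      have := S.sum_hit_le' (hT hA) l ({()} : Finset Unit) (fun _ => v)
      refine (le_trans (le_of_eq ?_) this).trans (le_of_eq ?_)
      · congr 1
        refine Finset.sum_congr rfl fun φ _ => ?_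
        rw [Finset.filter_singleton]
        split_ifs <;> simp
      · rw [Finset.filter_singleton]
        split_ifs <;> simp
    refine (Finset.sum_le_sum this).trans (le_of_eq ?_)
    rw [Finset.sum_const, Finset.card_univ, S.card_index, nsmul_eq_mul, mul_assoc]
  have e3 := Finset.sum_le_sum e2
  rw [← Finset.mul_sum, ← e1, ← Finset.mul_sum, Finset.sum_add_distrib, Finset.sum_const,
    ← Finset.sum_filter, Finset.sum_const, nsmul_eq_mul, nsmul_eq_mul, mul_one] at e3
  refine e3.trans ?_
  rw [S.card_inc hT]
  have e4 : ((T.filter (fun A => v ∈ A)).card : ℝ) * S.Q * S.M ≤ S.G.card := by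
    have h1 : (T.filter (fun A => v ∈ A)).card ≤ (S.G.filter (fun A => v ∈ A)).card :=
      Finset.card_le_card (Finset.filter_subset_filter _ hT)
    have h2 := S.point v hv
    have h3 : (T.filter (fun A => v ∈ A)).card * S.Q * S.M ≤ S.G.card := by
      refine le_trans ?_ h2
      rw [mul_assoc, mul_comm]
      exact Nat.mul_le_mul_left _ h1
    exact_mod_cast h3
  have e5 : (S.G.card : ℝ) ≤ S.M * T.card / C := by
    rw [le_div_iff₀ hC]; linarith
  have e6 : S.M * S.c * (((T.filter (fun A => v ∈ A)).card : ℝ) * S.Q) ≤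
      S.c * (S.M * T.card / C) := by
    have := mul_le_mul_of_nonneg_left (e4.trans e5) (Nat.cast_nonneg (α := ℝ) S.c)
    linarith
  calc _ = S.M * S.c * (((T.filter (fun A => v ∈ A)).card : ℝ) * S.Q) +
        S.M * S.c * T.card := by ring
    _ ≤ S.c * (S.M * T.card / C) + S.M * S.c * T.card := by linarith
    _ = _ := by ring

theorem sum_card_inc_hit_le {T : Finset (AddSubgroup V)} (hT : T ⊆ S.G) {C : ℝ} (hC : 0 < C)
    (hTC : C * S.G.card ≤ S.M * T.card) {α : Type*} (P : Finset α) (f : α → V) :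
    (S.Q : ℝ) * ∑ p ∈ S.inc T, ((P.filter (fun x => f x ∈ S.H p.1)).card : ℝ) ≤
      (S.inc T).card * (S.Q * (P.filter (fun x => f x = 0)).card + (1 + 1 / C) * P.card) := by
  have h1 : ∑ p ∈ S.inc T, ((P.filter (fun x => f x ∈ S.H p.1)).card : ℝ) =
      ∑ x ∈ P, (((S.inc T).filter (fun p => f x ∈ S.H p.1)).card : ℝ) := by
    simp_rw [Finset.card_filter, Nat.cast_sum]
    rw [Finset.sum_comm]
  rw [h1, Finset.mul_sum]
  have h2 : ∀ x ∈ P, (S.Q : ℝ) * (((S.inc T).filter (fun p => f x ∈ S.H p.1)).card : ℝ) ≤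
      (S.inc T).card * ((if f x = 0 then (S.Q : ℝ) else 0) + (1 + 1 / C)) := by
    intro x _
    split_ifs with h
    · have : (((S.inc T).filter (fun p => f x ∈ S.H p.1)).card : ℝ) ≤ (S.inc T).card := by
        exact_mod_cast Finset.card_filter_le _ _
      have h3 : (0 : ℝ) ≤ (S.inc T).card * (1 + 1 / C) := by positivity
      have := mul_le_mul_of_nonneg_left this (Nat.cast_nonneg (α := ℝ) S.Q)
      linarith
    · have := S.card_inc_hit_le hT hC hTC h
      rw [zero_add]
      linarith
  refine (Finset.sum_le_sum h2).trans (le_of_eq ?_)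
  rw [← Finset.mul_sum, Finset.sum_add_distrib, ← Finset.sum_filter, Finset.sum_const,
    Finset.sum_const, nsmul_eq_mul, nsmul_eq_mul]
  ring

end SpreadSystem

end System

section Local

open scoped Classical

variable {V : Type*} [AddCommGroup V] [Fintype V]

theorem thicken_closed (X : Finset V) (U : AddSubgroup V) :
    ∀ x ∈ thicken X U, ∀ y, y - x ∈ U → y ∈ thicken X U := fun _ hx _ h => thicken_invariant hx h

theorem sum_thicken_mul {U U' H : AddSubgroup V} (hd : U ⊓ U' = ⊥) (hs : U ⊔ U' = H)
    {M : ℕ} (hU : Nat.card U = M) (hU' : Nat.card U' = M) (E : Finset V) :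
    ∑ z, ((cosetPart (thicken E U) H z).card : ℝ) * (cosetPart (thicken E U') H z).card =
      (M : ℝ) ^ 4 * (thicken E U ∩ thicken E U').card := by
  have h1 : ∀ z, (cosetPart (thicken E U) H z).card * (cosetPart (thicken E U') H z).card =
      (cosetPart (thicken E U ∩ thicken E U') H z).card * (M * M) := by
    intro z
    have := card_cosetPart_inter hd hs (thicken_closed E U) (thicken_closed E U') z
    rw [hU, hU'] at this
    exact this.symm
  have h2 : Nat.card H = M * M := by rw [← hs, card_sup_of_disjoint hd, hU, hU']
  have h3 : ∑ z, (cosetPart (thicken E U) H z).card * (cosetPart (thicken E U') H z).card =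
      M ^ 4 * (thicken E U ∩ thicken E U').card := by
    rw [Finset.sum_congr rfl (fun z _ => h1 z), ← Finset.sum_mul, sum_card_cosetPart, h2]
    ring
  exact_mod_cast h3

theorem sum_thicken_sq_le {U H : AddSubgroup V} {M Q : ℕ} (hH : Nat.card H = M ^ 2) (hQ : 0 < Q)
    (E : Finset V) {η : ℝ}
    (hok : (Q : ℝ) * (cosetPairs (thicken E U) H).card ≤
      ((thicken E U).card : ℝ) ^ 2 + η * (Q * M ^ 2 * E.card))
    (hsmall : ((thicken E U).card : ℝ) ^ 2 ≤ Q * M ^ 2 * E.card) :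
    ∑ z, ((cosetPart (thicken E U) H z).card : ℝ) ^ 2 ≤ (1 + η) * (M ^ 4 * E.card) ∧
    (Q : ℝ) * ∑ z, ((cosetPart (thicken E U) H z).card : ℝ) ^ 2 ≤
      M ^ 2 * (thicken E U).card ^ 2 + η * (Q * M ^ 4 * E.card) := by
  have h1 : ∑ z, ((cosetPart (thicken E U) H z).card : ℝ) ^ 2 =
      M ^ 2 * (cosetPairs (thicken E U) H).card := by
    have := sum_card_cosetPart_sq (thicken E U) H
    rw [hH] at this
    exact_mod_cast this
  have hQ' : (0 : ℝ) < Q := by exact_mod_cast hQ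
  have h2 : (Q : ℝ) * ∑ z, ((cosetPart (thicken E U) H z).card : ℝ) ^ 2 ≤
      M ^ 2 * (thicken E U).card ^ 2 + η * (Q * M ^ 4 * E.card) := by
    rw [h1]
    have := mul_le_mul_of_nonneg_left hok (by positivity : (0 : ℝ) ≤ (M : ℝ) ^ 2)
    linarith
  refine ⟨?_, h2⟩
  refine le_of_mul_le_mul_left ?_ hQ'
  have := mul_le_mul_of_nonneg_left hsmall (by positivity : (0 : ℝ) ≤ (M : ℝ) ^ 2)
  linarith

/-- Second moment information on two transversal thickenings of a set. -/
theorem thicken_regular {U U' H : AddSubgroup V} (hd : U ⊓ U' = ⊥) (hs : U ⊔ U' = H)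
    {M Q : ℕ} (hM : 0 < M) (hU : Nat.card U = M) (hU' : Nat.card U' = M) (hQ : 0 < Q)
    (hV : Fintype.card V = Q * M ^ 2)
    (E : Finset V) {η ν : ℝ} (hν : 0 < ν) (hη : 0 ≤ η) (hη1 : η ≤ 1 / 4)
    (hνE : Q * ν ^ 2 = E.card)
    (hok : (Q : ℝ) * (cosetPairs (thicken E U) H).card ≤
      ((thicken E U).card : ℝ) ^ 2 + η * (Q * M ^ 2 * E.card))
    (hsmall : ((thicken E U).card : ℝ) ^ 2 ≤ Q * M ^ 2 * E.card)
    (hok' : (Q : ℝ) * (cosetPairs (thicken E U') H).card ≤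
      ((thicken E U').card : ℝ) ^ 2 + η * (Q * M ^ 2 * E.card))
    (hsmall' : ((thicken E U').card : ℝ) ^ 2 ≤ Q * M ^ 2 * E.card) :
    ((thicken E U ∩ thicken E U').card : ℝ) ≤ (1 + η) * E.card ∧
    (1 - 2 * η) * (Q * M * ν) ≤ (thicken E U).card ∧
    ∀ δ : ℝ, 0 < δ → ((Finset.univ.filter (fun z =>
      δ * (M * ν) < |((cosetPart (thicken E U) H z).card : ℝ) - M * ν|)).card : ℝ) * δ ^ 2 ≤
        5 * η * (Q * M ^ 2) := by
  have hQ' : (0 : ℝ) < Q := by exact_mod_cast hQ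
  have hM' : (0 : ℝ) < M := by exact_mod_cast hM
  have hH : Nat.card H = M ^ 2 := by rw [← hs, card_sup_of_disjoint hd, hU, hU', sq]
  obtain ⟨a1, a2⟩ := sum_thicken_sq_le hH hQ E hok hsmall
  obtain ⟨b1, b2⟩ := sum_thicken_sq_le hH hQ E hok' hsmall'
  have hmul := sum_thicken_mul hd hs hU hU' E
  have hsub : (E.card : ℝ) ≤ (thicken E U ∩ thicken E U').card := by
    exact_mod_cast Finset.card_le_card
      (Finset.subset_inter (subset_thicken E U) (subset_thicken E U'))
  have hsumf : ∑ z, ((cosetPart (thicken E U) H z).card : ℝ) = M ^ 2 * (thicken E U).card := by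
    have := sum_card_cosetPart (thicken E U) H
    rw [hH] at this
    exact_mod_cast this
  have hVr : ((Finset.univ : Finset V).card : ℝ) = Q * M ^ 2 := by
    rw [Finset.card_univ, hV]; push_cast; ring
  set f : V → ℝ := fun z => ((cosetPart (thicken E U) H z).card : ℝ) with hf
  set g : V → ℝ := fun z => ((cosetPart (thicken E U') H z).card : ℝ) with hg
  have hfg : 2 * ∑ z, f z * g z ≤ ∑ z, f z ^ 2 + ∑ z, g z ^ 2 := by
    rw [Finset.mul_sum, ← Finset.sum_add_distrib]
    exact Finset.sum_le_sum fun z _ => by nlinarith [sq_nonneg (f z - g z)]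
  have hM4 : (0 : ℝ) < (M : ℝ) ^ 4 := by positivity
  have hI : ((thicken E U ∩ thicken E U').card : ℝ) ≤ (1 + η) * E.card := by
    refine le_of_mul_le_mul_left ?_ hM4
    linarith
  have hL : (1 - η) * (M ^ 4 * E.card) ≤ ∑ z, f z ^ 2 := by
    have := mul_le_mul_of_nonneg_left hsub hM4.le
    linarith
  have hT : (1 - 2 * η) * (Q * M ^ 2 * E.card) ≤ ((thicken E U).card : ℝ) ^ 2 := by
    refine le_of_mul_le_mul_left ?_ (by positivity : (0 : ℝ) < (M : ℝ) ^ 2)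
    have := mul_le_mul_of_nonneg_left hL hQ'.le
    linarith
  have hT2 : (1 - 2 * η) * (Q * M * ν) ≤ (thicken E U).card := by
    refine abs_le_of_sq_le_sq' ?_ (Nat.cast_nonneg _) |>.2
    refine le_trans ?_ hT
    rw [← hνE]
    have h0 : (0 : ℝ) ≤ (Q * M * ν) ^ 2 := by positivity
    nlinarith
  refine ⟨hI, hT2, fun δ hδ => ?_⟩
  have hvar : ∑ z, (f z - M * ν) ^ 2 ≤ 5 * η * (M ^ 4 * E.card) := by
    have h1 : ∑ z, (f z - M * ν) ^ 2 =
        ∑ z, f z ^ 2 - 2 * (M * ν) * ∑ z, f z + (Q * M ^ 2) * (M * ν) ^ 2 := by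
      have h2 : ((Finset.univ : Finset V).card : ℝ) * (M * ν) ^ 2 = ∑ z : V, (M * ν) ^ 2 := by
        rw [Finset.sum_const, nsmul_eq_mul]
      rw [← hVr, h2, Finset.mul_sum, ← Finset.sum_sub_distrib, ← Finset.sum_add_distrib]
      exact Finset.sum_congr rfl fun z _ => by ring
    rw [h1, hsumf]
    have h2 := mul_le_mul_of_nonneg_left hT2 (by positivity : (0 : ℝ) ≤ 2 * (M * ν) * M ^ 2)
    rw [← hνE] at a1 ⊢
    nlinarith
  refine le_of_mul_le_mul_right ?_ (by positivity : (0 : ℝ) < (M * ν) ^ 2)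
  calc _ = ∑ z with δ * (M * ν) < |f z - M * ν|, (δ * (M * ν)) ^ 2 := by
        rw [Finset.sum_const, nsmul_eq_mul]; ring
    _ ≤ ∑ z with δ * (M * ν) < |f z - M * ν|, (f z - M * ν) ^ 2 := by
        refine Finset.sum_le_sum fun z hz => ?_
        rw [← sq_abs (f z - M * ν)]
        have := (Finset.mem_filter.1 hz).2
        gcongr
    _ ≤ ∑ z, (f z - M * ν) ^ 2 :=
        Finset.sum_le_sum_of_subset_of_nonneg (Finset.filter_subset _ _)
          fun z _ _ => sq_nonneg _
    _ ≤ _ := hvar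
    _ = _ := by rw [← hνE]; ring

/-- The points at which a thickening has about the expected density. -/
noncomputable def regularSet (E : Finset V) (U H : AddSubgroup V) (μ δ : ℝ) : Finset V :=
  Finset.univ.filter (fun z => |((cosetPart (thicken E U) H z).card : ℝ) - μ| ≤ δ * μ)

theorem mem_regularSet {E : Finset V} {U H : AddSubgroup V} {μ δ : ℝ} {z : V} :
    z ∈ regularSet E U H μ δ ↔ |((cosetPart (thicken E U) H z).card : ℝ) - μ| ≤ δ * μ := by
  simp [regularSet]

theorem regularSet_closed {E : Finset V} {U H : AddSubgroup V} {μ δ : ℝ} {x y : V}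
    (hx : x ∈ regularSet E U H μ δ) (h : y - x ∈ H) : y ∈ regularSet E U H μ δ := by
  rw [mem_regularSet, cosetPart_congr _ h]
  exact mem_regularSet.1 hx

theorem card_le_mul_of_fiber {α β : Type*} (P : Finset α) (S : Finset β) (f : α → β)
    (hf : ∀ p ∈ P, f p ∈ S) {B : ℝ} (hB : ∀ s ∈ S, ((P.filter (fun p => f p = s)).card : ℝ) ≤ B) :
    (P.card : ℝ) ≤ S.card * B := by
  rw [Finset.card_eq_sum_card_fiberwise hf]
  push_cast
  refine (Finset.sum_le_sum hB).trans (le_of_eq ?_)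
  rw [Finset.sum_const, nsmul_eq_mul]

/-- Counting tuples `(s, a, b, c)` in which each entry but the first lies in a set of size at
most `B` determined by the previous ones. -/
theorem card_le_of_chain {α β : Type*} (P : Finset α) (S : Finset β) (f g h k : α → β)
    (hinj : ∀ p ∈ P, ∀ r ∈ P, f p = f r → g p = g r → h p = h r → k p = k r → p = r)
    (hf : ∀ p ∈ P, f p ∈ S) {B : ℝ} (hB : 0 ≤ B)
    (hg : ∀ p ∈ P, ∃ A : Finset β, (A.card : ℝ) ≤ B ∧ ∀ r ∈ P, f r = f p → g r ∈ A)
    (hh : ∀ p ∈ P, ∃ A : Finset β, (A.card : ℝ) ≤ B ∧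
      ∀ r ∈ P, f r = f p → g r = g p → h r ∈ A)
    (hk : ∀ p ∈ P, ∃ A : Finset β, (A.card : ℝ) ≤ B ∧
      ∀ r ∈ P, f r = f p → g r = g p → h r = h p → k r ∈ A) :
    (P.card : ℝ) ≤ S.card * B ^ 3 := by
  refine card_le_mul_of_fiber P S f hf fun s hs => ?_
  set P1 := P.filter (fun p => f p = s) with hP1
  rcases P1.eq_empty_or_nonempty with h0 | ⟨p, hp⟩
  · rw [h0]; simp; positivity
  obtain ⟨A1, hA1, hm1⟩ := hg p (Finset.mem_filter.1 hp).1
  have e1 : f p = s := (Finset.mem_filter.1 hp).2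
  have h1 : (P1.card : ℝ) ≤ A1.card * B ^ 2 := by
    refine card_le_mul_of_fiber P1 A1 g (fun r hr => ?_) fun a ha => ?_
    · rw [hP1, Finset.mem_filter] at hr
      exact hm1 r hr.1 (hr.2.trans e1.symm)
    set P2 := P1.filter (fun p => g p = a) with hP2
    rcases P2.eq_empty_or_nonempty with h0 | ⟨p2, hp2⟩
    · rw [h0]; simp; positivity
    simp only [hP2, hP1, Finset.mem_filter] at hp2
    obtain ⟨A2, hA2, hm2⟩ := hh p2 hp2.1.1
    have h2 : (P2.card : ℝ) ≤ A2.card * B := by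
      refine card_le_mul_of_fiber P2 A2 h (fun r hr => ?_) fun b hb => ?_
      · simp only [hP2, hP1, Finset.mem_filter] at hr
        exact hm2 r hr.1.1 (hr.1.2.trans hp2.1.2.symm) (hr.2.trans hp2.2.symm)
      set P3 := P2.filter (fun p => h p = b) with hP3
      rcases P3.eq_empty_or_nonempty with h0 | ⟨p3, hp3⟩
      · rw [h0]; simp; positivity
      simp only [hP3, hP2, hP1, Finset.mem_filter] at hp3
      obtain ⟨A3, hA3, hm3⟩ := hk p3 hp3.1.1.1
      refine le_trans ?_ hA3
      norm_cast
      refine Finset.card_le_card_of_injOn k (fun r hr => ?_) ?_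
      · simp only [hP3, hP2, hP1, Finset.mem_coe, Finset.mem_filter] at hr
        exact hm3 r hr.1.1.1 (hr.1.1.2.trans hp3.1.1.2.symm) (hr.1.2.trans hp3.1.2.symm)
          (hr.2.trans hp3.2.symm)
      · intro r hr r' hr' hrr
        simp only [hP3, hP2, hP1, Finset.mem_coe, Finset.mem_filter] at hr hr'
        exact hinj r hr.1.1.1 r' hr'.1.1.1 (hr.1.1.2.trans hr'.1.1.2.symm)
          (hr.1.2.trans hr'.1.2.symm) (hr.2.trans hr'.2.symm) hrr
    refine h2.trans ?_
    rw [sq]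
    gcongr
  refine h1.trans ?_
  calc (A1.card : ℝ) * B ^ 2 ≤ B * B ^ 2 := by gcongr
    _ = B ^ 3 := by ring

end Local

section Local

open scoped Classical

variable {V : Type*} [AddCommGroup V] [Fintype V]

/-- Triples `(x, x', y)` in `E` with `x' - x ∈ U`, `x - y ∈ H` and `x ∈ R`. -/
noncomputable def triples (E R : Finset V) (U H : AddSubgroup V) : Finset (V × V × V) :=
  (E ×ˢ E ×ˢ E).filter (fun p => p.1 ∈ R ∧ p.2.1 - p.1 ∈ U ∧ p.1 - p.2.2 ∈ H)

theorem mem_triples {E R : Finset V} {U H : AddSubgroup V} {p : V × V × V} :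
    p ∈ triples E R U H ↔ (p.1 ∈ E ∧ p.2.1 ∈ E ∧ p.2.2 ∈ E) ∧
      (p.1 ∈ R ∧ p.2.1 - p.1 ∈ U ∧ p.1 - p.2.2 ∈ H) := by
  simp [triples]

/-- Most parallelograms close up when the pairwise intersections of three transversal
thickenings of `E` exceed `E` by little. -/
theorem card_open_triples_le {U₁ U₂ U₃ H : AddSubgroup V} (h₁ : U₁ ≤ H) (hs : U₂ ⊔ U₃ = H)
    (E R : Finset V) {B μ : ℝ} (hB : 0 ≤ B)
    (hR : ∀ x ∈ R, ∀ y, y - x ∈ H → y ∈ R)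
    (b₁ : ∀ x ∈ R, ((cosetPart E U₁ x).card : ℝ) ≤ B)
    (b₂ : ∀ x ∈ R, ((cosetPart E U₂ x).card : ℝ) ≤ B)
    (b₃ : ∀ x ∈ R, ((cosetPart E U₃ x).card : ℝ) ≤ B)
    (m₁₂ : (((thicken E U₁ ∩ thicken E U₂) \ E).card : ℝ) ≤ μ)
    (m₁₃ : (((thicken E U₁ ∩ thicken E U₃) \ E).card : ℝ) ≤ μ)
    (m₂₃ : (((thicken E U₂ ∩ thicken E U₃) \ E).card : ℝ) ≤ μ) :
    ((((triples E R U₁ H).filter (fun p => p.2.2 + p.2.1 - p.1 ∉ E)).card : ℕ) : ℝ) ≤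
      3 * (μ * B ^ 3) := by
  have h₂ : U₂ ≤ H := hs ▸ le_sup_left
  have h₃ : U₃ ≤ H := hs ▸ le_sup_right
  set P := (triples E R U₁ H).filter (fun p => p.2.2 + p.2.1 - p.1 ∉ E) with hP
  have hPm : ∀ p ∈ P, (p.1 ∈ E ∧ p.2.1 ∈ E ∧ p.2.2 ∈ E) ∧
      (p.1 ∈ R ∧ p.2.1 - p.1 ∈ U₁ ∧ p.1 - p.2.2 ∈ H) ∧ p.2.2 + p.2.1 - p.1 ∉ E := by
    intro p hp
    rw [hP, Finset.mem_filter, mem_triples] at hp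
    tauto
  have ht : ∀ p : V × V × V, ∃ t, p ∈ P → t - p.1 ∈ U₃ ∧ p.2.2 - t ∈ U₂ := by
    intro p
    by_cases hp : p ∈ P
    · have h1 : p.2.2 - p.1 ∈ U₂ ⊔ U₃ := by
        rw [hs, ← H.neg_mem_iff, neg_sub]; exact (hPm p hp).2.1.2.2
      obtain ⟨a, ha, b, hb, hab⟩ := AddSubgroup.mem_sup.1 h1
      refine ⟨p.1 + b, fun _ => ⟨by simpa using hb, ?_⟩⟩
      rw [show p.2.2 - (p.1 + b) = p.2.2 - p.1 - b by abel, ← hab]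
      simpa using ha
    · exact ⟨0, fun h => absurd h hp⟩
  choose t ht using ht
  have htR : ∀ p ∈ P, t p ∈ R := fun p hp => hR p.1 (hPm p hp).2.1.1 _ (h₃ (ht p hp).1)
  have hb₁ : ∀ x ∈ R, ∀ y, y - x ∈ H → ((cosetPart E U₁ y).card : ℝ) ≤ B :=
    fun x hx y h => b₁ y (hR x hx y h)
  set P1 := P.filter (fun p => t p ∉ E) with hP1
  set P2 := P.filter (fun p => t p ∈ E ∧ t p + (p.2.1 - p.1) ∉ E) with hP2
  set P3 := P.filter (fun p => t p + (p.2.1 - p.1) ∈ E) with hP3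
  have hcov : (P.card : ℝ) ≤ P1.card + P2.card + P3.card := by
    have h1 : P ⊆ P1 ∪ P2 ∪ P3 := by
      intro p hp
      simp only [hP1, hP2, hP3, Finset.mem_union, Finset.mem_filter]
      tauto
    have h2 := (Finset.card_le_card h1).trans ((Finset.card_union_le _ _).trans
      (Nat.add_le_add_right (Finset.card_union_le _ _) _))
    exact_mod_cast h2
  have hB3 : 0 ≤ B ^ 3 := by positivity
  have c1 : (P1.card : ℝ) ≤ μ * B ^ 3 := by
    refine le_trans (card_le_of_chain P1 ((thicken E U₂ ∩ thicken E U₃) \ E) t (fun p => p.1)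
      (fun p => p.2.2) (fun p => p.2.1) ?_ ?_ hB ?_ ?_ ?_) (by gcongr)
    · rintro ⟨x, x', y⟩ _ ⟨z, z', w⟩ _ - h1 h2 h3
      simp_all
    · intro p hp
      rw [hP1, Finset.mem_filter] at hp
      obtain ⟨hp, hpE⟩ := hp
      obtain ⟨⟨hx, hx', hy⟩, -⟩ := hPm p hp
      simp only [Finset.mem_sdiff, Finset.mem_inter, mem_thicken]
      refine ⟨⟨⟨_, hy, ?_⟩, _, hx, (ht p hp).1⟩, hpE⟩
      rw [← U₂.neg_mem_iff, neg_sub]; exact (ht p hp).2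
    · intro p hp
      have hpP := (Finset.mem_filter.1 hp).1
      refine ⟨cosetPart E U₃ (t p), b₃ _ (htR p hpP), fun r hr h => ?_⟩
      have hrP := (Finset.mem_filter.1 hr).1
      rw [mem_cosetPart, ← h, ← U₃.neg_mem_iff, neg_sub]
      exact ⟨(hPm r hrP).1.1, (ht r hrP).1⟩
    · intro p hp
      have hpP := (Finset.mem_filter.1 hp).1
      refine ⟨cosetPart E U₂ (t p), b₂ _ (htR p hpP), fun r hr h _ => ?_⟩
      have hrP := (Finset.mem_filter.1 hr).1
      rw [mem_cosetPart, ← h]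
      exact ⟨(hPm r hrP).1.2.2, (ht r hrP).2⟩
    · intro p hp
      have hpP := (Finset.mem_filter.1 hp).1
      refine ⟨cosetPart E U₁ p.1, b₁ _ (hPm p hpP).2.1.1, fun r hr _ h _ => ?_⟩
      have hrP := (Finset.mem_filter.1 hr).1
      rw [mem_cosetPart, ← h]
      exact ⟨(hPm r hrP).1.2.1, (hPm r hrP).2.1.2.1⟩
  have c2 : (P2.card : ℝ) ≤ μ * B ^ 3 := by
    refine le_trans (card_le_of_chain P2 ((thicken E U₁ ∩ thicken E U₃) \ E)
      (fun p => t p + (p.2.1 - p.1)) (fun p => p.2.1)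
      (fun p => p.1) (fun p => p.2.2) ?_ ?_ hB ?_ ?_ ?_) (by gcongr)
    · rintro ⟨x, x', y⟩ _ ⟨z, z', w⟩ _ - h1 h2 h3
      simp_all
    · intro p hp
      rw [hP2, Finset.mem_filter] at hp
      obtain ⟨hp, hpE, hpE'⟩ := hp
      obtain ⟨⟨hx, hx', hy⟩, ⟨-, hv, -⟩, -⟩ := hPm p hp
      simp only [Finset.mem_sdiff, Finset.mem_inter, mem_thicken]
      refine ⟨⟨⟨_, hpE, ?_⟩, _, hx', ?_⟩, hpE'⟩
      · rwa [add_sub_cancel_left]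
      · rw [show t p + (p.2.1 - p.1) - p.2.1 = t p - p.1 by abel]
        exact (ht p hp).1
    · intro p hp
      have hpP := (Finset.mem_filter.1 hp).1
      refine ⟨cosetPart E U₃ (t p + (p.2.1 - p.1)), b₃ _ (hR _ (htR p hpP) _ ?_),
        fun r hr h => ?_⟩
      · rw [add_sub_cancel_left]; exact h₁ (hPm p hpP).2.1.2.1
      have hrP := (Finset.mem_filter.1 hr).1
      rw [mem_cosetPart, ← h, ← U₃.neg_mem_iff]
      refine ⟨(hPm r hrP).1.2.1, ?_⟩
      rw [show -(r.2.1 - (t r + (r.2.1 - r.1))) = t r - r.1 by abel]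
      exact (ht r hrP).1
    · intro p hp
      have hpP := (Finset.mem_filter.1 hp).1
      refine ⟨cosetPart E U₁ p.2.1, b₁ _ (hR _ (hPm p hpP).2.1.1 _ (h₁ (hPm p hpP).2.1.2.1)),
        fun r hr _ h => ?_⟩
      have hrP := (Finset.mem_filter.1 hr).1
      rw [mem_cosetPart, ← h, ← U₁.neg_mem_iff, neg_sub]
      exact ⟨(hPm r hrP).1.1, (hPm r hrP).2.1.2.1⟩
    · intro p hp
      have hpP := (Finset.mem_filter.1 hp).1
      refine ⟨cosetPart E U₂ (t p), b₂ _ (htR p hpP), fun r hr h1 h2 h3 => ?_⟩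
      have hrP := (Finset.mem_filter.1 hr).1
      rw [h2, h3] at h1
      rw [mem_cosetPart, ← add_right_cancel h1]
      exact ⟨(hPm r hrP).1.2.2, (ht r hrP).2⟩
  have c3 : (P3.card : ℝ) ≤ μ * B ^ 3 := by
    refine le_trans (card_le_of_chain P3 ((thicken E U₁ ∩ thicken E U₂) \ E)
      (fun p => p.2.2 + p.2.1 - p.1) (fun p => p.2.2)
      (fun p => t p + (p.2.1 - p.1)) (fun p => p.2.1) ?_ ?_ hB ?_ ?_ ?_) (by gcongr)
    · rintro ⟨x, x', y⟩ _ ⟨z, z', w⟩ _ h0 h1 h2 h3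
      simp_all
    · intro p hp
      rw [hP3, Finset.mem_filter] at hp
      obtain ⟨hp, hpE⟩ := hp
      obtain ⟨⟨hx, hx', hy⟩, ⟨-, hv, -⟩, hpE'⟩ := hPm p hp
      simp only [Finset.mem_sdiff, Finset.mem_inter, mem_thicken]
      refine ⟨⟨⟨_, hy, ?_⟩, _, hpE, ?_⟩, hpE'⟩
      · rw [show p.2.2 + p.2.1 - p.1 - p.2.2 = p.2.1 - p.1 by abel]
        exact hv
      · rw [show p.2.2 + p.2.1 - p.1 - (t p + (p.2.1 - p.1)) = p.2.2 - t p by abel]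
        exact (ht p hp).2
    · intro p hp
      have hpP := (Finset.mem_filter.1 hp).1
      refine ⟨cosetPart E U₁ p.2.2, b₁ _ (hR _ (hPm p hpP).2.1.1 _ ?_),
        fun r hr h => ?_⟩
      · rw [← H.neg_mem_iff, neg_sub]; exact (hPm p hpP).2.1.2.2
      have hrP := (Finset.mem_filter.1 hr).1
      refine mem_cosetPart.2 ⟨(hPm r hrP).1.2.2, ?_⟩
      have e : r.2.2 - p.2.2 = (p.2.1 - p.1) - (r.2.1 - r.1) := by
        rw [sub_eq_sub_iff_add_eq_add]
        calc _ = r.2.2 + r.2.1 - r.1 := by abel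
          _ = p.2.2 + p.2.1 - p.1 := h
          _ = _ := by abel
      rw [e]
      exact U₁.sub_mem (hPm p hpP).2.1.2.1 (hPm r hrP).2.1.2.1
    · intro p hp
      have hpP := (Finset.mem_filter.1 hp).1
      refine ⟨cosetPart E U₂ (t p + (p.2.1 - p.1)), b₂ _ (hR _ (htR p hpP) _ ?_),
        fun r hr h h' => ?_⟩
      · rw [add_sub_cancel_left]; exact h₁ (hPm p hpP).2.1.2.1
      have hrP := (Finset.mem_filter.1 hr).1
      refine mem_cosetPart.2 ⟨(Finset.mem_filter.1 hr).2, ?_⟩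
      have e : t r + (r.2.1 - r.1) - (t p + (p.2.1 - p.1)) =
          (p.2.2 - t p) - (r.2.2 - t r) := by
        have : r.2.2 + (r.2.1 - r.1) = p.2.2 + (p.2.1 - p.1) := by
          rw [← add_sub_assoc, ← add_sub_assoc]; exact h
        rw [sub_eq_sub_iff_add_eq_add]
        calc _ = r.2.2 + (r.2.1 - r.1) := by abel
          _ = p.2.2 + (p.2.1 - p.1) := this
          _ = _ := by abel
      rw [e]
      exact U₂.sub_mem (ht p hpP).2 (ht r hrP).2
    · intro p hp
      have hpP := (Finset.mem_filter.1 hp).1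
      refine ⟨cosetPart E U₃ (t p + (p.2.1 - p.1)), b₃ _ (hR _ (htR p hpP) _ ?_),
        fun r hr _ _ h => ?_⟩
      · rw [add_sub_cancel_left]; exact h₁ (hPm p hpP).2.1.2.1
      have hrP := (Finset.mem_filter.1 hr).1
      rw [mem_cosetPart, ← h, ← U₃.neg_mem_iff]
      refine ⟨(hPm r hrP).1.2.1, ?_⟩
      rw [show -(r.2.1 - (t r + (r.2.1 - r.1))) = t r - r.1 by abel]
      exact (ht r hrP).1
  linarith

theorem card_triples_ge {U H : AddSubgroup V} (hUH : U ≤ H) {M : ℕ} (hM : 0 < M)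
    (hU : Nat.card U = M) (hH : Nat.card H = M ^ 2) (E R : Finset V)
    (hR : ∀ x ∈ R, ∀ y, y - x ∈ H → y ∈ R) {b : ℝ} (hb : 0 < b)
    (hT : ∀ z ∈ R, ((cosetPart (thicken E U) H z).card : ℝ) ≤ M * b) :
    ∑ z ∈ R, ((cosetPart E H z).card : ℝ) ^ 3 ≤ b * (M ^ 2 * (triples E R U H).card) := by
  have hM' : (0 : ℝ) < M := by exact_mod_cast hM
  have key : ∀ z ∈ R, ((cosetPart E H z).card : ℝ) ^ 3 ≤
      b * ((triples E R U H).filter (fun p => p.1 - z ∈ H)).card := by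
    intro z hz
    have h1 : cosetPart E H z ⊆ cosetPart (thicken E U) H z := by
      intro x hx
      rw [mem_cosetPart] at hx ⊢
      exact ⟨subset_thicken E U hx.1, hx.2⟩
    have h2 : ∀ x ∈ cosetPart (thicken E U) H z, ∀ y, y - x ∈ U →
        y ∈ cosetPart (thicken E U) H z := by
      intro x hx y hy
      rw [mem_cosetPart] at hx ⊢
      exact ⟨thicken_invariant hx.1 hy, by simpa using H.add_mem (hUH hy) hx.2⟩
    have h3 := card_sq_mul_le_card_mul_cosetPairs h2 h1
    rw [hU] at h3
    have h4 : (cosetPairs (cosetPart E H z) U).card * (cosetPart E H z).card ≤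
        ((triples E R U H).filter (fun p => p.1 - z ∈ H)).card := by
      rw [← Finset.card_product]
      refine Finset.card_le_card_of_injOn (fun p => (p.1.2, p.1.1, p.2)) ?_ ?_
      · rintro ⟨⟨x', x⟩, y⟩ h
        simp only [Finset.coe_product, Set.mem_prod, Finset.mem_coe, mem_cosetPairs,
          mem_cosetPart, Finset.mem_filter, mem_triples] at h ⊢
        obtain ⟨⟨⟨⟨a1, a2⟩, a3, a4⟩, a5⟩, a6, a7⟩ := h
        exact ⟨⟨⟨a3, a1, a6⟩, hR z hz x a4, a5, by simpa using H.sub_mem a4 a7⟩, a4⟩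
      · rintro ⟨⟨x', x⟩, y⟩ _ ⟨⟨z', z⟩, w⟩ _ h
        simp only [Prod.mk.injEq] at h ⊢
        tauto
    have h3' : (M : ℝ) * ((cosetPart E H z).card : ℝ) ^ 2 ≤
      (cosetPart (thicken E U) H z).card * (cosetPairs (cosetPart E H z) U).card := by
      exact_mod_cast h3
    have h5 : ((cosetPart E H z).card : ℝ) ^ 2 ≤ b * (cosetPairs (cosetPart E H z) U).card := by
      refine le_of_mul_le_mul_left ?_ hM'
      refine h3'.trans ?_
      rw [← mul_assoc]
      exact mul_le_mul_of_nonneg_right (hT z hz) (Nat.cast_nonneg _)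
    have h4' : ((cosetPairs (cosetPart E H z) U).card : ℝ) * (cosetPart E H z).card ≤
        ((triples E R U H).filter (fun p => p.1 - z ∈ H)).card := by
      exact_mod_cast h4
    calc _ = ((cosetPart E H z).card : ℝ) ^ 2 * (cosetPart E H z).card := by ring
      _ ≤ b * (cosetPairs (cosetPart E H z) U).card * (cosetPart E H z).card := by gcongr
      _ ≤ _ := by rw [mul_assoc]; gcongr
  refine (Finset.sum_le_sum key).trans ?_
  rw [← Finset.mul_sum]
  refine mul_le_mul_of_nonneg_left ?_ hb.le
  have h6 : ∑ z ∈ R, (((triples E R U H).filter (fun p => p.1 - z ∈ H)).card : ℝ) ≤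
      ∑ z, (((triples E R U H).filter (fun p => p.1 - z ∈ H)).card : ℝ) :=
    Finset.sum_le_sum_of_subset_of_nonneg (Finset.subset_univ _) fun _ _ _ => Nat.cast_nonneg _
  refine h6.trans (le_of_eq ?_)
  simp_rw [Finset.card_filter, Nat.cast_sum]
  rw [Finset.sum_comm]
  have h7 : ∀ p ∈ triples E R U H, ∑ z : V, (((if p.1 - z ∈ H then 1 else 0 : ℕ)) : ℝ) =
      M ^ 2 := by
    intro p _
    rw [← Nat.cast_sum, ← Finset.card_filter]
    have : (Finset.univ.filter (fun z => p.1 - z ∈ H)) = cosetPart Finset.univ H p.1 := by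
      ext z
      simp only [Finset.mem_filter, Finset.mem_univ, true_and, mem_cosetPart]
      rw [← H.neg_mem_iff, neg_sub]
    rw [this, card_cosetPart_univ, hH]
    push_cast; rfl
  rw [Finset.sum_congr rfl h7, Finset.sum_const, nsmul_eq_mul, mul_comm]

end Local

section Local

open scoped Classical

variable {V : Type*} [AddCommGroup V] [Fintype V]

/-- Parallelograms in `E` with one side in `U`, the other side outside `U`, and with based fibers
of size at most `b`. -/
noncomputable def parTriples (E : Finset V) (U : AddSubgroup V) (b : ℝ) : Finset (V × V × V) :=
  (E ×ˢ E ×ˢ E).filter (fun p => p.2.2 + p.2.1 - p.1 ∈ E ∧ p.2.1 - p.1 ∈ U ∧ p.1 - p.2.2 ∉ U ∧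
    ((cosetPart E U p.1).card : ℝ) ≤ b ∧ ((cosetPart E U p.2.2).card : ℝ) ≤ b)

theorem mem_parTriples {E : Finset V} {U : AddSubgroup V} {b : ℝ} {p : V × V × V} :
    p ∈ parTriples E U b ↔ (p.1 ∈ E ∧ p.2.1 ∈ E ∧ p.2.2 ∈ E) ∧
      p.2.2 + p.2.1 - p.1 ∈ E ∧ p.2.1 - p.1 ∈ U ∧ p.1 - p.2.2 ∉ U ∧
    ((cosetPart E U p.1).card : ℝ) ≤ b ∧ ((cosetPart E U p.2.2).card : ℝ) ≤ b := by
  simp [parTriples]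

theorem card_regularSet_compl_le {E : Finset V} {U H : AddSubgroup V} {μ δ N : ℝ} (hδ : 0 < δ)
    (h : ((Finset.univ.filter (fun z =>
      δ * μ < |((cosetPart (thicken E U) H z).card : ℝ) - μ|)).card : ℝ) * δ ^ 2 ≤
        δ ^ 2 * N) :
    (((regularSet E U H μ δ)ᶜ).card : ℝ) ≤ N := by
  have h1 : (regularSet E U H μ δ)ᶜ = Finset.univ.filter (fun z =>
      δ * μ < |((cosetPart (thicken E U) H z).card : ℝ) - μ|) := by
    ext z
    simp [mem_regularSet]
  rw [h1]
  refine le_of_mul_le_mul_right ?_ (by positivity : 0 < δ ^ 2)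
  linarith

theorem card_same_fiber_triples_le (E R : Finset V) {U : AddSubgroup V} (H : AddSubgroup V) {B : ℝ}
    (hB : 0 ≤ B) (b : ∀ x ∈ R, ((cosetPart E U x).card : ℝ) ≤ B) :
    ((((triples E R U H).filter (fun p => p.1 - p.2.2 ∈ U)).card : ℕ) : ℝ) ≤ E.card * B ^ 2 := by
  refine card_le_mul_of_fiber _ E (fun p => p.1) (fun p hp => ?_) fun s hs => ?_
  · rw [Finset.mem_filter, mem_triples] at hp
    exact hp.1.1.1
  set P := ((triples E R U H).filter (fun p => p.1 - p.2.2 ∈ U)).filter (fun p => p.1 = s)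
    with hP
  rcases P.eq_empty_or_nonempty with h0 | ⟨p, hp⟩
  · rw [h0]; simp; positivity
  have hsR : s ∈ R := by
    rw [hP, Finset.mem_filter, Finset.mem_filter, mem_triples] at hp
    exact hp.2 ▸ hp.1.1.2.1
  have h1 : P.card ≤ (cosetPart E U s ×ˢ cosetPart E U s).card := by
    refine Finset.card_le_card_of_injOn (fun p => p.2) ?_ ?_
    · rintro ⟨x, x', y⟩ h
      simp only [hP, Finset.mem_coe, Finset.mem_filter, mem_triples] at h
      obtain ⟨⟨⟨⟨a1, a2, a3⟩, a4, a5, a6⟩, a7⟩, rfl⟩ := h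
      simp only [Finset.coe_product, Set.mem_prod, Finset.mem_coe, mem_cosetPart]
      exact ⟨⟨a2, a5⟩, a3, by rw [← U.neg_mem_iff, neg_sub]; exact a7⟩
    · rintro ⟨x, x', y⟩ h ⟨z, z', w⟩ h' hh
      simp only [hP, Finset.mem_coe, Finset.mem_filter] at h h'
      simp only at hh
      rw [Prod.mk.injEq]
      exact ⟨h.2.trans h'.2.symm, hh⟩
  rw [Finset.card_product] at h1
  have h2 : (P.card : ℝ) ≤ (cosetPart E U s).card * (cosetPart E U s).card := by exact_mod_cast h1
  refine h2.trans ?_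
  rw [sq]
  have := b s hsR
  gcongr

theorem cube_ge_tangent {g v : ℝ} (hg : 0 ≤ g) (hv : 0 ≤ v) :
    3 * v ^ 2 * g - 2 * v ^ 3 ≤ g ^ 3 := by
  have : 0 ≤ (g - v) ^ 2 * (g + 2 * v) := by positivity
  linarith

set_option maxHeartbeats 1000000 in
theorem exists_parallelograms {U₁ U₂ U₃ H : AddSubgroup V} (d₁₂ : U₁ ⊓ U₂ = ⊥)
    (d₁₃ : U₁ ⊓ U₃ = ⊥) (d₂₃ : U₂ ⊓ U₃ = ⊥) (s₁₂ : U₁ ⊔ U₂ = H) (s₁₃ : U₁ ⊔ U₃ = H)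
    (s₂₃ : U₂ ⊔ U₃ = H) {M Q : ℕ} (hM : 0 < M) (hU₁ : Nat.card U₁ = M) (hU₂ : Nat.card U₂ = M)
    (hU₃ : Nat.card U₃ = M) (hQ : 0 < Q) (hV : Fintype.card V = Q * M ^ 2)
    (E : Finset V) {η δ ν n : ℝ} (hν : 0 < ν) (hη : 0 ≤ η) (hδ : 0 < δ) (hδ1 : δ ≤ 1 / 100)
    (hηδ : 15 * η ≤ δ ^ 3) (hn : 4 ≤ δ * n) (hνE : Q * ν ^ 2 = E.card)
    (ok₁ : (Q : ℝ) * (cosetPairs (thicken E U₁) H).card ≤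
      ((thicken E U₁).card : ℝ) ^ 2 + η * (Q * M ^ 2 * E.card))
    (sm₁ : ((thicken E U₁).card : ℝ) ^ 2 ≤ Q * M ^ 2 * E.card)
    (ok₂ : (Q : ℝ) * (cosetPairs (thicken E U₂) H).card ≤
      ((thicken E U₂).card : ℝ) ^ 2 + η * (Q * M ^ 2 * E.card))
    (sm₂ : ((thicken E U₂).card : ℝ) ^ 2 ≤ Q * M ^ 2 * E.card)
    (ok₃ : (Q : ℝ) * (cosetPairs (thicken E U₃) H).card ≤
      ((thicken E U₃).card : ℝ) ^ 2 + η * (Q * M ^ 2 * E.card))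
    (sm₃ : ((thicken E U₃).card : ℝ) ^ 2 ≤ Q * M ^ 2 * E.card)
    (hnE : n * (thicken E U₁).card ≤ M * E.card) :
    n ≤ 2 * ν ∧ (1 - 13 * δ) * (E.card * ν ^ 3) ≤
      ((parTriples E U₁ ((1 + δ) * ν)).filter (fun p => p.1 - p.2.2 ∈ H)).card := by
  have hQ' : (0 : ℝ) < Q := by exact_mod_cast hQ
  have hM' : (0 : ℝ) < M := by exact_mod_cast hM
  have hδ3 : δ ^ 3 ≤ δ / 10000 := by
    calc δ ^ 3 = δ * δ ^ 2 := by ring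
      _ ≤ δ * (1 / 100) ^ 2 := by gcongr
      _ = _ := by ring
  have hη1 : η ≤ δ / 100000 := by linarith
  have hη2 : η ≤ 1 / 4 := by linarith
  have swap : ∀ {A B C : AddSubgroup V}, A ⊔ B = C → B ⊔ A = C := fun h => by rw [sup_comm, h]
  have swap' : ∀ {A B C : AddSubgroup V}, A ⊓ B = C → B ⊓ A = C := fun h => by rw [inf_comm, h]
  obtain ⟨i12, t1, r1⟩ := thicken_regular d₁₂ s₁₂ hM hU₁ hU₂ hQ hV E hν hη hη2 hνE ok₁ sm₁ ok₂ sm₂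
  obtain ⟨i23, -, r2⟩ := thicken_regular d₂₃ s₂₃ hM hU₂ hU₃ hQ hV E hν hη hη2 hνE ok₂ sm₂ ok₃ sm₃
  obtain ⟨i31, -, r3⟩ := thicken_regular (swap' d₁₃) (swap s₁₃) hM hU₃ hU₁ hQ hV E hν hη hη2 hνE
    ok₃ sm₃ ok₁ sm₁
  have hH : Nat.card H = M ^ 2 := by rw [← s₁₂, card_sup_of_disjoint d₁₂, hU₁, hU₂, sq]
  have le₁ : U₁ ≤ H := s₁₂ ▸ le_sup_left
  have le₂ : U₂ ≤ H := s₁₂ ▸ le_sup_right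
  have le₃ : U₃ ≤ H := s₁₃ ▸ le_sup_right
  have hn0 : 0 < n := by
    by_contra h
    have : δ * n ≤ 0 := mul_nonpos_of_nonneg_of_nonpos hδ.le (not_lt.1 h)
    linarith
  have hnν : n ≤ 2 * ν := by
    have h1 : n * ((1 - 2 * η) * (Q * M * ν)) ≤ M * (Q * ν ^ 2) := by
      rw [hνE]
      exact le_trans (mul_le_mul_of_nonneg_left t1 hn0.le) hnE
    have h2 : n * (1 - 2 * η) ≤ ν := by
      refine le_of_mul_le_mul_right ?_ (by positivity : (0 : ℝ) < Q * M * ν)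
      linarith
    have := mul_le_mul_of_nonneg_left hη2 hn0.le
    linarith
  refine ⟨hnν, ?_⟩
  have hδν : 2 ≤ δ * ν := by
    have := mul_le_mul_of_nonneg_left hnν hδ.le
    linarith
  have hVr : ((Finset.univ : Finset V).card : ℝ) = Q * M ^ 2 := by
    rw [Finset.card_univ, hV]; push_cast; ring
  have hN : 0 ≤ (Q : ℝ) * M ^ 2 := by positivity
  have hir : 5 * η * (Q * M ^ 2) ≤ δ ^ 2 * (δ / 3 * (Q * M ^ 2)) := by
    have := mul_le_mul_of_nonneg_right hηδ hN
    linarith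
  have k1 := card_regularSet_compl_le hδ ((r1 δ hδ).trans hir)
  have k2 := card_regularSet_compl_le hδ ((r2 δ hδ).trans hir)
  have k3 := card_regularSet_compl_le hδ ((r3 δ hδ).trans hir)
  set R := regularSet E U₁ H (M * ν) δ ∩ regularSet E U₂ H (M * ν) δ ∩
    regularSet E U₃ H (M * ν) δ with hR
  have hRm : ∀ z, z ∈ R ↔ z ∈ regularSet E U₁ H (M * ν) δ ∧ z ∈ regularSet E U₂ H (M * ν) δ ∧
      z ∈ regularSet E U₃ H (M * ν) δ := by
    intro z; simp only [hR, Finset.mem_inter]; tauto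
  have hRc : ∀ x ∈ R, ∀ y, y - x ∈ H → y ∈ R := by
    intro x hx y h
    rw [hRm] at hx ⊢
    exact ⟨regularSet_closed hx.1 h, regularSet_closed hx.2.1 h, regularSet_closed hx.2.2 h⟩
  have hRcard : (1 - δ) * (Q * M ^ 2) ≤ R.card := by
    have h1 : Rᶜ.card ≤ (regularSet E U₁ H (M * ν) δ)ᶜ.card +
        (regularSet E U₂ H (M * ν) δ)ᶜ.card + (regularSet E U₃ H (M * ν) δ)ᶜ.card := by
      rw [hR, Finset.compl_inter, Finset.compl_inter]
      exact (Finset.card_union_le _ _).trans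
        (Nat.add_le_add_right (Finset.card_union_le _ _) _)
    have h2 : (Rᶜ.card : ℝ) ≤ (regularSet E U₁ H (M * ν) δ)ᶜ.card +
        (regularSet E U₂ H (M * ν) δ)ᶜ.card + (regularSet E U₃ H (M * ν) δ)ᶜ.card := by
      exact_mod_cast h1
    have h3 : (R.card : ℝ) + Rᶜ.card = Q * M ^ 2 := by
      rw [← hVr, Finset.card_univ, ← Finset.card_add_card_compl R]
      push_cast; rfl
    linarith
  have hRle : (R.card : ℝ) ≤ Q * M ^ 2 := by
    rw [← hVr]; exact_mod_cast Finset.card_le_card (Finset.subset_univ _)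
  have f1 : ∀ z ∈ R, (1 - δ) * (M * ν) ≤ (cosetPart (thicken E U₁) H z).card ∧
      ((cosetPart (thicken E U₁) H z).card : ℝ) ≤ M * ((1 + δ) * ν) := by
    intro z hz
    have := abs_le.1 (mem_regularSet.1 ((hRm z).1 hz).1)
    constructor <;> linarith
  have f2 : ∀ z ∈ R, (1 - δ) * (M * ν) ≤ (cosetPart (thicken E U₂) H z).card ∧
      ((cosetPart (thicken E U₂) H z).card : ℝ) ≤ M * ((1 + δ) * ν) := by
    intro z hz
    have := abs_le.1 (mem_regularSet.1 ((hRm z).1 hz).2.1)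
    constructor <;> linarith
  have hB : 0 ≤ (1 + δ) * ν := by positivity
  have fib : ∀ {A A' : AddSubgroup V}, A ⊓ A' = ⊥ → A ≤ H → A' ≤ H → Nat.card A' = M →
      (∀ z ∈ R, ((cosetPart (thicken E A') H z).card : ℝ) ≤ M * ((1 + δ) * ν)) →
      ∀ z ∈ R, ((cosetPart E A z).card : ℝ) ≤ (1 + δ) * ν := by
    intro A A' hd hA hA' hc hf z hz
    have h1 := card_mul_card_cosetPart_le hd hA hA' E z
    rw [hc] at h1
    refine le_of_mul_le_mul_left (le_trans ?_ (hf z hz)) hM'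
    exact_mod_cast h1
  have b₁ := fib d₁₂ le₁ le₂ hU₂ fun z hz => (f2 z hz).2
  have b₂ := fib (swap' d₁₂) le₂ le₁ hU₁ fun z hz => (f1 z hz).2
  have b₃ := fib (swap' d₁₃) le₃ le₁ hU₁ fun z hz => (f1 z hz).2
  have miss : ∀ {A A' : AddSubgroup V},
      ((thicken E A ∩ thicken E A').card : ℝ) ≤ (1 + η) * E.card →
      (((thicken E A ∩ thicken E A') \ E).card : ℝ) ≤ η * E.card := by
    intro A A' h
    have h1 := Finset.card_sdiff_add_card_eq_card
      (Finset.subset_inter (subset_thicken E A) (subset_thicken E A'))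
    have h2 : (((thicken E A ∩ thicken E A') \ E).card : ℝ) + E.card =
      (thicken E A ∩ thicken E A').card := by exact_mod_cast h1
    linarith
  have m12 := miss i12
  have m23 := miss i23
  have m13 : (((thicken E U₁ ∩ thicken E U₃) \ E).card : ℝ) ≤ η * E.card := by
    rw [Finset.inter_comm]; exact miss i31
  have hopen := card_open_triples_le le₁ s₂₃ E R hB hRc b₁ b₂ b₃ m12 m13 m23
  have hsame := card_same_fiber_triples_le E R H hB b₁
  have hge := card_triples_ge le₁ hM hU₁ hH E R hRc (b := (1 + δ) * ν) (by positivity)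
    (fun z hz => (f1 z hz).2)
  have hsumg : ((1 - δ) ^ 3 - η) * (M ^ 2 * E.card) ≤
      ∑ z ∈ R, ((cosetPart E H z).card : ℝ) := by
    have h1 : ∀ z ∈ R, (1 - δ) ^ 2 * ν ^ 2 ≤ ((cosetPart E H z).card : ℝ) +
        (cosetPart ((thicken E U₁ ∩ thicken E U₂) \ E) H z).card := by
      intro z hz
      have h2 := card_cosetPart_inter d₁₂ s₁₂ (thicken_closed E U₁) (thicken_closed E U₂) z
      rw [hU₁, hU₂] at h2
      have h3 : ((cosetPart (thicken E U₁ ∩ thicken E U₂) H z).card : ℝ) * (M * M) =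
        (cosetPart (thicken E U₁) H z).card * (cosetPart (thicken E U₂) H z).card := by
        exact_mod_cast h2
      have h4 : (cosetPart (thicken E U₁ ∩ thicken E U₂) H z).card ≤ (cosetPart E H z).card +
          (cosetPart ((thicken E U₁ ∩ thicken E U₂) \ E) H z).card := by
        refine (Finset.card_le_card ?_).trans (Finset.card_union_le _ _)
        intro x
        simp only [mem_cosetPart, Finset.mem_union, Finset.mem_inter, Finset.mem_sdiff]
        tauto
      have h4' : ((cosetPart (thicken E U₁ ∩ thicken E U₂) H z).card : ℝ) ≤
          (cosetPart E H z).card + (cosetPart ((thicken E U₁ ∩ thicken E U₂) \ E) H z).card := by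
        exact_mod_cast h4
      refine le_trans ?_ h4'
      refine le_of_mul_le_mul_right ?_ (by positivity : (0 : ℝ) < M * M)
      rw [h3]
      have h5 : 0 ≤ (1 - δ) * (M * ν) := mul_nonneg (by linarith) (by positivity)
      calc _ = ((1 - δ) * (M * ν)) * ((1 - δ) * (M * ν)) := by ring
        _ ≤ _ := mul_le_mul (f1 z hz).1 (f2 z hz).1 h5 (Nat.cast_nonneg _)
    have h6 := Finset.sum_le_sum h1
    rw [Finset.sum_const, nsmul_eq_mul, Finset.sum_add_distrib] at h6
    have h7 : ∑ z ∈ R, ((cosetPart ((thicken E U₁ ∩ thicken E U₂) \ E) H z).card : ℝ) ≤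
        M ^ 2 * (η * E.card) := by
      refine (Finset.sum_le_sum_of_subset_of_nonneg (Finset.subset_univ _)
        fun _ _ _ => Nat.cast_nonneg _).trans ?_
      have := sum_card_cosetPart ((thicken E U₁ ∩ thicken E U₂) \ E) H
      rw [hH] at this
      have h8 : ∑ z, ((cosetPart ((thicken E U₁ ∩ thicken E U₂) \ E) H z).card : ℝ) =
        M ^ 2 * ((thicken E U₁ ∩ thicken E U₂) \ E).card := by exact_mod_cast this
      rw [h8]
      gcongr
    have h9 : (1 - δ) * (Q * M ^ 2) * ((1 - δ) ^ 2 * ν ^ 2) ≤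
        R.card * ((1 - δ) ^ 2 * ν ^ 2) := by gcongr
    have h10 : (1 - δ) * (Q * M ^ 2) * ((1 - δ) ^ 2 * ν ^ 2) = (1 - δ) ^ 3 * (M ^ 2 * E.card) := by
      rw [← hνE]; ring
    linarith
  have hcube : M ^ 2 * (E.card * ν ^ 4) * (3 * (1 - δ) ^ 3 - 3 * η - 2) ≤
      ∑ z ∈ R, ((cosetPart E H z).card : ℝ) ^ 3 := by
    have h1 : ∀ z ∈ R, 3 * ν ^ 4 * ((cosetPart E H z).card : ℝ) - 2 * ν ^ 6 ≤
        ((cosetPart E H z).card : ℝ) ^ 3 := by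
      intro z _
      have := cube_ge_tangent (Nat.cast_nonneg (cosetPart E H z).card) (sq_nonneg ν)
      linarith
    have h2 := Finset.sum_le_sum h1
    rw [Finset.sum_sub_distrib, ← Finset.mul_sum, Finset.sum_const, nsmul_eq_mul] at h2
    have h3 := mul_le_mul_of_nonneg_left hsumg (by positivity : 0 ≤ 3 * ν ^ 4)
    have h4 := mul_le_mul_of_nonneg_right hRle (by positivity : 0 ≤ 2 * ν ^ 6)
    have h5 : (Q * M ^ 2 : ℝ) * (2 * ν ^ 6) = M ^ 2 * (E.card * ν ^ 4) * 2 := by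
      rw [← hνE]; ring
    linarith
  have htrip : (1 - 11 * δ) * (E.card * ν ^ 3) ≤ (triples E R U₁ H).card := by
    have h1 := hcube.trans hge
    have h2 : (E.card * ν ^ 3) * (3 * (1 - δ) ^ 3 - 3 * η - 2) ≤
        (1 + δ) * (triples E R U₁ H).card := by
      refine le_of_mul_le_mul_left ?_ (by positivity : (0 : ℝ) < M ^ 2 * ν)
      linarith
    have h3 : (1 + δ) * (1 - 11 * δ) ≤ 3 * (1 - δ) ^ 3 - 3 * η - 2 := by
      have : (1 - δ) ^ 3 = 1 - 3 * δ + 3 * δ ^ 2 - δ ^ 3 := by ring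
      have h5 : (0 : ℝ) ≤ δ ^ 2 := by positivity
      linarith
    have h4 : (0 : ℝ) ≤ E.card * ν ^ 3 := mul_nonneg (Nat.cast_nonneg _) (pow_nonneg hν.le 3)
    refine le_of_mul_le_mul_left ?_ (by positivity : 0 < 1 + δ)
    have := mul_le_mul_of_nonneg_left h3 h4
    linarith
  have hsub : (triples E R U₁ H).card ≤
      ((triples E R U₁ H).filter (fun p => p.2.2 + p.2.1 - p.1 ∉ E)).card +
      ((triples E R U₁ H).filter (fun p => p.1 - p.2.2 ∈ U₁)).card +
      ((parTriples E U₁ ((1 + δ) * ν)).filter (fun p => p.1 - p.2.2 ∈ H)).card := by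
    refine (Finset.card_le_card ?_).trans ((Finset.card_union_le _ _).trans
      (Nat.add_le_add_right (Finset.card_union_le _ _) _))
    intro p hp
    have hp' := mem_triples.1 hp
    have e1 := b₁ _ hp'.2.1
    have e2 := b₁ p.2.2 (hRc _ hp'.2.1 _ (by rw [← H.neg_mem_iff, neg_sub]; exact hp'.2.2.2))
    simp only [Finset.mem_union, Finset.mem_filter, mem_parTriples]
    tauto
  have hsub' : ((triples E R U₁ H).card : ℝ) ≤
      ((triples E R U₁ H).filter (fun p => p.2.2 + p.2.1 - p.1 ∉ E)).card +
      ((triples E R U₁ H).filter (fun p => p.1 - p.2.2 ∈ U₁)).card +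
      ((parTriples E U₁ ((1 + δ) * ν)).filter (fun p => p.1 - p.2.2 ∈ H)).card := by
    exact_mod_cast hsub
  have g1 : 3 * (η * E.card * ((1 + δ) * ν) ^ 3) ≤ δ * (E.card * ν ^ 3) := by
    have h1 : (1 + δ) ^ 3 ≤ 2 := by
      calc (1 + δ) ^ 3 ≤ (1 + 1 / 100) ^ 3 := by gcongr
        _ ≤ 2 := by norm_num
    have h4 : (0 : ℝ) ≤ E.card * ν ^ 3 := mul_nonneg (Nat.cast_nonneg _) (pow_nonneg hν.le 3)
    have h5 : 3 * η * (1 + δ) ^ 3 ≤ δ := by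
      have := mul_le_mul_of_nonneg_left h1 hη
      linarith
    have := mul_le_mul_of_nonneg_right h5 h4
    linarith
  have g2 : E.card * ((1 + δ) * ν) ^ 2 ≤ δ * (E.card * ν ^ 3) := by
    have h1 : (1 + δ) ^ 2 ≤ 2 := by
      calc (1 + δ) ^ 2 ≤ (1 + 1 / 100) ^ 2 := by gcongr
        _ ≤ 2 := by norm_num
    have h4 : (0 : ℝ) ≤ E.card * ν ^ 2 := mul_nonneg (Nat.cast_nonneg _) (pow_nonneg hν.le 2)
    have := mul_le_mul_of_nonneg_right (h1.trans hδν) h4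
    linarith
  linarith

end Local

section Periods

open scoped Classical

variable {V : Type*} [AddCommGroup V] [Fintype V]

/-- The `τ`-approximate periods of `E`. -/
noncomputable def perSet (E : Finset V) (τ : ℝ) : Finset V :=
  Finset.univ.filter (fun v => ((E.filter (fun x => x + v ∉ E)).card : ℝ) ≤ τ * E.card)

theorem mem_perSet {E : Finset V} {τ : ℝ} {v : V} :
    v ∈ perSet E τ ↔ ((E.filter (fun x => x + v ∉ E)).card : ℝ) ≤ τ * E.card := by
  simp [perSet]

theorem card_filter_add_mem (E : Finset V) (v : V) :
    ((E.filter (fun x => x + v ∈ E)).card : ℝ) + (E.filter (fun x => x + v ∉ E)).card =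
      E.card := by
  exact_mod_cast Finset.card_filter_add_card_filter_not (s := E) (fun x => x + v ∈ E)

/-- If `E` has many parallelograms along `A`, then many elements of `A` are almost periods. -/
theorem card_perSet_ge_of_parTriples (E : Finset V) (A : AddSubgroup V) {δ t ν : ℝ} (hν : 0 < ν)
    (hE : 0 < E.card) (hδ : 0 ≤ δ) (ht : 0 < t) (hδt : 16 * δ ≤ t ^ 2) (ht1 : t ≤ 1)
    (h : (1 - 15 * δ) * (E.card ^ 2 * ν) ≤ (parTriples E A ((1 + δ) * ν)).card) :
    (1 - t) * ν ≤ ((perSet E t).filter (fun v => v ∈ A)).card := by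
  have he : (0 : ℝ) < E.card := by exact_mod_cast hE
  set D : V → Finset V := fun v => E.filter (fun x => x + v ∈ E ∧
    ((cosetPart E A x).card : ℝ) ≤ (1 + δ) * ν) with hD
  set Af : Finset V := Finset.univ.filter (fun v => v ∈ A) with hAf
  have h1 : (parTriples E A ((1 + δ) * ν)).card ≤ ∑ v ∈ Af, (D v).card ^ 2 := by
    have h0 : ∀ p ∈ parTriples E A ((1 + δ) * ν), p.2.1 - p.1 ∈ Af := by
      intro p hp
      rw [hAf, Finset.mem_filter]
      exact ⟨Finset.mem_univ _, (mem_parTriples.1 hp).2.2.1⟩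
    rw [Finset.card_eq_sum_card_fiberwise h0]
    refine Finset.sum_le_sum fun v _ => ?_
    rw [sq, ← Finset.card_product]
    refine Finset.card_le_card_of_injOn (fun p => (p.1, p.2.2)) ?_ ?_
    · rintro ⟨x, x', y⟩ hp
      rw [Finset.mem_coe, Finset.mem_filter, mem_parTriples] at hp
      obtain ⟨⟨⟨a1, a2, a3⟩, a4, a5, a6, a7, a8⟩, rfl⟩ := hp
      simp only [hD, Finset.coe_product, Set.mem_prod, Finset.mem_coe, Finset.mem_filter]
      exact ⟨⟨a1, by simpa using a2, a7⟩, a3, by rwa [← add_sub_assoc], a8⟩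
    · rintro ⟨x, x', y⟩ hp ⟨z, z', w⟩ hp' hh
      rw [Finset.mem_coe, Finset.mem_filter] at hp hp'
      simp only [Prod.mk.injEq] at hh ⊢
      have := hp.2.trans hp'.2.symm
      simp only [hh.1] at this
      exact ⟨hh.1, sub_left_injective this, hh.2⟩
  have h1' : ((parTriples E A ((1 + δ) * ν)).card : ℝ) ≤ ∑ v ∈ Af, ((D v).card : ℝ) ^ 2 := by
    exact_mod_cast h1
  have h2 : ∑ v ∈ Af, ((D v).card : ℝ) ≤ (1 + δ) * ν * E.card := by
    have e1 : ∑ v ∈ Af, ((D v).card : ℝ) =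
        ∑ x ∈ E with ((cosetPart E A x).card : ℝ) ≤ (1 + δ) * ν, ((cosetPart E A x).card : ℝ) := by
      have : ∀ v ∈ Af, ((D v).card : ℝ) = ∑ x ∈ E with
          ((cosetPart E A x).card : ℝ) ≤ (1 + δ) * ν, if x + v ∈ E then (1 : ℝ) else 0 := by
        intro v _
        rw [← Finset.sum_filter, Finset.filter_filter, Finset.sum_const, nsmul_eq_mul, mul_one, hD]
        simp only [and_comm]
      rw [Finset.sum_congr rfl this, Finset.sum_comm]
      refine Finset.sum_congr rfl fun x _ => ?_
      rw [← Finset.sum_filter, Finset.sum_const, nsmul_eq_mul, mul_one]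
      norm_cast
      refine Finset.card_bij (fun v _ => x + v) ?_ ?_ ?_
      · intro v hv
        rw [hAf, Finset.mem_filter, Finset.mem_filter] at hv
        rw [mem_cosetPart]
        exact ⟨hv.2, by simpa using hv.1.2⟩
      · intro v _ w _ hvw
        exact add_left_cancel hvw
      · intro y hy
        rw [mem_cosetPart] at hy
        refine ⟨y - x, ?_, by abel⟩
        rw [hAf, Finset.mem_filter, Finset.mem_filter]
        exact ⟨⟨Finset.mem_univ _, hy.2⟩, by simpa using hy.1⟩
    rw [e1]
    refine (Finset.sum_le_sum (fun x hx => (Finset.mem_filter.1 hx).2)).trans ?_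
    rw [Finset.sum_const, nsmul_eq_mul, mul_comm]
    have : ((E.filter (fun x => ((cosetPart E A x).card : ℝ) ≤ (1 + δ) * ν)).card : ℝ) ≤
        E.card := by exact_mod_cast Finset.card_filter_le _ _
    exact mul_le_mul_of_nonneg_left this (by positivity)
  have hDr : ∀ v, ((D v).card : ℝ) ≤ (E.filter (fun x => x + v ∈ E)).card := by
    intro v
    norm_cast
    refine Finset.card_le_card fun x => ?_
    simp only [hD, Finset.mem_filter]
    tauto
  have hDe : ∀ v, ((D v).card : ℝ) ≤ E.card := by
    intro v
    exact_mod_cast Finset.card_filter_le _ _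
  have h3 : ∀ v ∈ Af, ((D v).card : ℝ) ^ 2 ≤ (1 - t) * E.card * (D v).card +
      if v ∈ perSet E t then t * E.card * (E.card : ℝ) else 0 := by
    intro v _
    have d0 : (0 : ℝ) ≤ (D v).card := Nat.cast_nonneg _
    split_ifs with hv
    · have := hDe v
      have e2 : ((D v).card : ℝ) ^ 2 ≤ E.card * (D v).card := by
        rw [sq]; exact mul_le_mul_of_nonneg_right this d0
      have e3 : t * E.card * (D v).card ≤ t * E.card * (E.card : ℝ) :=
        mul_le_mul_of_nonneg_left this (by positivity)
      linarith
    · rw [mem_perSet, not_le] at hv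
      have e1 := card_filter_add_mem E v
      have e2 : ((D v).card : ℝ) ≤ (1 - t) * E.card := by have := hDr v; linarith
      rw [add_zero, sq]
      exact mul_le_mul_of_nonneg_right e2 d0
  have h4 := h.trans (h1'.trans (Finset.sum_le_sum h3))
  rw [Finset.sum_add_distrib, ← Finset.mul_sum, ← Finset.sum_filter, Finset.sum_const,
    nsmul_eq_mul] at h4
  have h5 : Af.filter (fun v => v ∈ perSet E t) = (perSet E t).filter (fun v => v ∈ A) := by
    ext v
    simp only [hAf, Finset.mem_filter, Finset.mem_univ, true_and]
    tauto
  rw [h5] at h4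
  set N : ℝ := (((perSet E t).filter (fun v => v ∈ A)).card : ℝ)
  have h6 := mul_le_mul_of_nonneg_left h2
    (mul_nonneg (by linarith : 0 ≤ 1 - t) he.le)
  have h7 : (1 - 15 * δ - (1 - t) * (1 + δ)) * ν ≤ N * t := by
    refine le_of_mul_le_mul_left ?_ (by positivity : (0 : ℝ) < (E.card : ℝ) ^ 2)
    linarith
  have h8 : t * (1 - t) ≤ 1 - 15 * δ - (1 - t) * (1 + δ) := by nlinarith
  refine le_of_mul_le_mul_right ?_ ht
  refine le_trans ?_ h7
  have := mul_le_mul_of_nonneg_right h8 hν.le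
  linarith

end Periods

namespace SpreadSystem

open scoped Classical

variable {V Ω ι : Type*} [AddCommGroup V] [Fintype V] [Fintype Ω] [Fintype ι]
variable (S : SpreadSystem V Ω ι)

/-- The thickening of `E` along `U φ l` is nearly equidistributed among the cosets of `H φ`. -/
def Balanced (E : Finset V) (η : ℝ) (p : Ω × ι) : Prop :=
  (S.Q : ℝ) * (cosetPairs (thicken E (S.U p.1 p.2)) (S.H p.1)).card ≤
    ((thicken E (S.U p.1 p.2)).card : ℝ) ^ 2 + η * (S.Q * S.M ^ 2 * E.card)

theorem card_thicken_pairs (E : Finset V) {A : AddSubgroup V} (hA : A ∈ S.G) :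
    (cosetPairs (thicken E A) A).card = S.M * (thicken E A).card := by
  rw [card_cosetPairs, Finset.sum_congr rfl (fun x hx =>
    card_cosetPart_univ_of_invariant (thicken_closed E A) hx), Finset.sum_const, smul_eq_mul,
    S.card_mem A hA, mul_comm]

theorem card_sq_le_pairs (X : Finset V) (φ : Ω) :
    (X.card : ℝ) ^ 2 ≤ S.Q * (cosetPairs X (S.H φ)).card := by
  have h := card_sq_mul_le_card_mul_cosetPairs (S := Finset.univ) (U := S.H φ)
    (fun _ _ _ _ => Finset.mem_univ _) (Finset.subset_univ X)
  rw [S.card_H, Finset.card_univ, S.card_V] at h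
  have hM : (0 : ℝ) < (S.M : ℝ) ^ 2 := by have := S.M_pos; positivity
  have h' : (S.M : ℝ) ^ 2 * (X.card : ℝ) ^ 2 ≤ S.Q * S.M ^ 2 * (cosetPairs X (S.H φ)).card := by
    exact_mod_cast h
  refine le_of_mul_le_mul_left ?_ hM
  linarith

theorem card_unbalanced_fib_le (E : Finset V) (hE : 0 < E.card) {A : AddSubgroup V} (hA : A ∈ S.G)
    (l : ι) {η n : ℝ} (hn : 0 < n)
    (hnE : n * (thicken E A).card ≤ S.M * E.card) :
    η * n * ((S.fib A l).filter (fun φ => ¬ S.Balanced E η (φ, l))).card ≤ S.c := by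
  have hQ : (0 : ℝ) < S.Q := by exact_mod_cast S.Q_pos
  have hM : (0 : ℝ) < S.M := by exact_mod_cast S.M_pos
  have he : (0 : ℝ) < E.card := by exact_mod_cast hE
  set X := thicken E A with hX
  have h1 := S.sum_hit_le' hA l (X ×ˢ X) (fun p => p.1 - p.2)
  have h2 : ((X ×ˢ X).filter (fun p => p.1 - p.2 ∈ A)).card = S.M * X.card :=
    S.card_thicken_pairs E hA
  rw [h2, Finset.card_product] at h1
  push_cast at h1
  have h3 : ∀ φ, ((X ×ˢ X).filter (fun p => p.1 - p.2 ∈ S.H φ)).card =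
    (cosetPairs X (S.H φ)).card := fun φ => rfl
  simp_rw [h3] at h1
  have h4 : ∀ φ ∈ S.fib A l, (X.card : ℝ) ^ 2 +
      (if ¬ S.Balanced E η (φ, l) then η * (S.Q * S.M ^ 2 * E.card) else 0) ≤
      S.Q * (cosetPairs X (S.H φ)).card := by
    intro φ hφ
    rw [S.mem_fib] at hφ
    split_ifs with h
    · rw [add_zero]; exact S.card_sq_le_pairs X φ
    · simp only [Balanced, hφ, not_le, ← hX] at h
      exact h.le
  have h5 := Finset.sum_le_sum h4
  rw [Finset.sum_add_distrib, Finset.sum_const, S.card_fib hA, nsmul_eq_mul, ← Finset.sum_filter,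
    Finset.sum_const, nsmul_eq_mul, ← Finset.mul_sum] at h5
  set N : ℝ := (((S.fib A l).filter (fun φ => ¬ S.Balanced E η (φ, l))).card : ℝ)
  have h6 : N * (η * (S.M * E.card)) ≤ S.c * X.card := by
    refine le_of_mul_le_mul_left ?_ (by positivity : (0 : ℝ) < S.Q * S.M)
    nlinarith
  have h7 := mul_le_mul_of_nonneg_left h6 hn.le
  have h8 := mul_le_mul_of_nonneg_left hnE (Nat.cast_nonneg (α := ℝ) S.c)
  refine le_of_mul_le_mul_right ?_ (by positivity : (0 : ℝ) < S.M * E.card)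
  linarith

theorem card_unbalanced_le (E : Finset V) (hE : 0 < E.card) {T : Finset (AddSubgroup V)}
    (hT : T ⊆ S.G) {η n : ℝ} (hn : 0 < n)
    (hnE : ∀ A ∈ T, n * (thicken E A).card ≤ S.M * E.card) :
    η * n * ((S.inc T).filter (fun p => ¬ S.Balanced E η p)).card ≤ (S.inc T).card := by
  have h1 : (((S.inc T).filter (fun p => ¬ S.Balanced E η p)).card : ℝ) =
      ∑ A ∈ T, ∑ l, (((S.fib A l).filter (fun φ => ¬ S.Balanced E η (φ, l))).card : ℝ) := by
    rw [Finset.card_filter]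
    push_cast
    rw [S.sum_inc T (fun p => if ¬ S.Balanced E η p then (1 : ℝ) else 0)]
    refine Finset.sum_congr rfl fun A _ => Finset.sum_congr rfl fun l _ => ?_
    rw [Finset.card_filter]
    push_cast
    rfl
  rw [h1, S.card_inc hT, Finset.mul_sum]
  have h2 : ∀ A ∈ T, η * n * ∑ l, (((S.fib A l).filter
      (fun φ => ¬ S.Balanced E η (φ, l))).card : ℝ) ≤ S.M * S.c := by
    intro A hA
    rw [Finset.mul_sum]
    refine (Finset.sum_le_sum (fun l _ =>
      S.card_unbalanced_fib_le E hE (hT hA) l hn (hnE A hA))).trans (le_of_eq ?_)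
    rw [Finset.sum_const, Finset.card_univ, S.card_index, nsmul_eq_mul]
  refine (Finset.sum_le_sum h2).trans (le_of_eq ?_)
  rw [Finset.sum_const, nsmul_eq_mul]
  ring

/-- Few incidences lie in a set `P` which has fewer than `K` members over each `φ`. -/
theorem card_sparse_le {T : Finset (AddSubgroup V)} (hT : T ⊆ S.G) {C : ℝ} (hC : 0 < C)
    (hTC : C * S.G.card ≤ S.M * T.card) (P : Finset (Ω × ι)) {K : ℝ} (hK : 0 ≤ K)
    (hP : ∀ φ, ((P.filter (fun p => p.1 = φ)).card : ℝ) ≤ K) :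
    (P.card : ℝ) ≤ K / C * (S.inc T).card := by
  have h1 := card_le_mul_of_fiber P Finset.univ Prod.fst (fun _ _ => Finset.mem_univ _)
    (fun φ _ => hP φ)
  rw [Finset.card_univ, S.card_Omega] at h1
  refine h1.trans ?_
  rw [S.card_inc hT]
  push_cast
  have h2 := mul_le_mul_of_nonneg_left hTC
    (mul_nonneg (Nat.cast_nonneg (α := ℝ) S.c) hK)
  refine le_of_mul_le_mul_left ?_ hC
  have h3 : C * (K / C * (S.M * S.c * T.card)) = K * (S.M * S.c * T.card) := by field_simp
  rw [h3]
  linarith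

end SpreadSystem

theorem Finset.cast_card_filter_add_not {α : Type*} (s : Finset α) (p : α → Prop)
    [DecidablePred p] [DecidablePred fun x => ¬ p x] :
    ((s.filter p).card : ℝ) + ((s.filter (fun x => ¬ p x)).card : ℝ) = s.card := by
  rw [← Nat.cast_add, Finset.card_filter_add_card_filter_not]

namespace SpreadSystem

open scoped Classical

variable {V Ω ι : Type*} [AddCommGroup V] [Fintype V] [Fintype Ω] [Fintype ι]
variable (S : SpreadSystem V Ω ι)

/-- Balanced incidences accompanied by at least two further balanced incidences. -/
noncomputable def great (E : Finset V) (η : ℝ) (T : Finset (AddSubgroup V)) : Finset (Ω × ι) :=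
  ((S.inc T).filter (fun p => S.Balanced E η p)).filter (fun p =>
    ∃ l₂ l₃, p.2 ≠ l₂ ∧ p.2 ≠ l₃ ∧ l₂ ≠ l₃ ∧ (S.U p.1 l₂ ∈ T ∧ S.Balanced E η (p.1, l₂)) ∧
      (S.U p.1 l₃ ∈ T ∧ S.Balanced E η (p.1, l₃)))

theorem card_not_great_le (E : Finset V) (hE : 0 < E.card) {T : Finset (AddSubgroup V)}
    (hT : T ⊆ S.G) {C : ℝ} (hC : 0 < C) (hTC : C * S.G.card ≤ S.M * T.card) {η n ζ : ℝ}
    (hη : 0 < η) (hn : 0 < n) (hnE : ∀ A ∈ T, n * (thicken E A).card ≤ S.M * E.card)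
    (hζ : 1 / (η * n) + 2 / C ≤ ζ) :
    ((S.inc T \ S.great E η T).card : ℝ) ≤ ζ * (S.inc T).card := by
  set B := (S.inc T).filter (fun p => S.Balanced E η p) with hB
  have h1 := S.card_unbalanced_le (η := η) E hE hT hn hnE
  have h2 := S.card_sparse_le hT hC hTC (B \ S.great E η T) (K := 2) (by norm_num) (by
    intro φ
    by_contra! hcon
    have hcon : 2 < ((B \ S.great E η T).filter (fun p => p.1 = φ)).card := by exact_mod_cast hcon
    obtain ⟨x, y, z, hx, hy, hz, hxy, hxz, hyz⟩ := Finset.two_lt_card_iff.1 hcon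
    obtain ⟨x1, x2⟩ := x
    obtain ⟨y1, y2⟩ := y
    obtain ⟨z1, z2⟩ := z
    simp only [Finset.mem_filter, Finset.mem_sdiff] at hx hy hz
    obtain ⟨⟨hx, hx'⟩, rfl⟩ := hx
    obtain ⟨⟨hy, -⟩, rfl⟩ := hy
    obtain ⟨⟨hz, -⟩, rfl⟩ := hz
    refine hx' (Finset.mem_filter.2 ⟨hx, y2, z2, ?_, ?_, ?_, ?_, ?_⟩)
    · rintro rfl; exact hxy rfl
    · rintro rfl; exact hxz rfl
    · rintro rfl; exact hyz rfl
    · rw [hB, Finset.mem_filter, S.mem_inc] at hy; exact hy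
    · rw [hB, Finset.mem_filter, S.mem_inc] at hz; exact hz)
  have h3 : ((S.inc T \ S.great E η T).card : ℝ) ≤
      ((S.inc T).filter (fun p => ¬ S.Balanced E η p)).card + (B \ S.great E η T).card := by
    norm_cast
    refine (Finset.card_le_card ?_).trans (Finset.card_union_le _ _)
    intro p
    simp only [hB, Finset.mem_sdiff, Finset.mem_union, Finset.mem_filter]
    tauto
  have h4 : (((S.inc T).filter (fun p => ¬ S.Balanced E η p)).card : ℝ) ≤
      1 / (η * n) * (S.inc T).card := by
    rw [one_div, ← div_eq_inv_mul, le_div_iff₀ (by positivity)]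
    linarith
  have h5 := mul_le_mul_of_nonneg_right hζ (Nat.cast_nonneg (α := ℝ) (S.inc T).card)
  linarith

/-- Half of the members of `T` are rarely involved in a small set of incidences. -/
theorem card_le_two_mul_of_few {T : Finset (AddSubgroup V)} (hT : T ⊆ S.G) {ζ : ℝ} (hζ : 0 < ζ)
    (P : Finset (Ω × ι)) (hPT : P ⊆ S.inc T) (hP : (P.card : ℝ) ≤ ζ * (S.inc T).card) :
    (T.card : ℝ) ≤ 2 * (T.filter (fun A =>
      ∑ l, (((S.fib A l).filter (fun φ => (φ, l) ∈ P)).card : ℝ) ≤ 2 * ζ * (S.M * S.c))).card := by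
  have hM : (0 : ℝ) < S.M := by exact_mod_cast S.M_pos
  have hc : (0 : ℝ) < S.c := by exact_mod_cast S.c_pos
  set f : AddSubgroup V → ℝ := fun A =>
    ∑ l, (((S.fib A l).filter (fun φ => (φ, l) ∈ P)).card : ℝ) with hf
  have h1 : (P.card : ℝ) = ∑ A ∈ T, f A := by
    have h0 : P = (S.inc T).filter (fun p => p ∈ P) := by
      rw [Finset.filter_mem_eq_inter, Finset.inter_eq_right.2 hPT]
    conv_lhs => rw [h0]
    rw [Finset.card_filter]
    push_cast
    rw [S.sum_inc T (fun p => if p ∈ P then (1 : ℝ) else 0)]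
    refine Finset.sum_congr rfl fun A _ => Finset.sum_congr rfl fun l _ => ?_
    rw [Finset.card_filter]
    push_cast
    rfl
  have h2 : ∑ A ∈ T with ¬ f A ≤ 2 * ζ * (S.M * S.c), 2 * ζ * (S.M * S.c) ≤ P.card := by
    rw [h1]
    calc _ ≤ ∑ A ∈ T with ¬ f A ≤ 2 * ζ * (S.M * S.c), f A :=
          Finset.sum_le_sum fun A hA => (not_le.1 (Finset.mem_filter.1 hA).2).le
      _ ≤ _ := Finset.sum_le_sum_of_subset_of_nonneg (Finset.filter_subset _ _)
          (fun A _ _ => Finset.sum_nonneg fun _ _ => Nat.cast_nonneg _)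
  rw [Finset.sum_const, nsmul_eq_mul] at h2
  have h3 : (((T.filter (fun A => f A ≤ 2 * ζ * (S.M * S.c))).card : ℝ)) +
      ((T.filter (fun A => ¬ f A ≤ 2 * ζ * (S.M * S.c))).card : ℝ) = T.card := by
    exact Finset.cast_card_filter_add_not T _
  rw [S.card_inc hT] at hP
  have h4 : 2 * ((T.filter (fun A => ¬ f A ≤ 2 * ζ * (S.M * S.c))).card : ℝ) ≤ T.card := by
    refine le_of_mul_le_mul_left ?_ (by positivity : (0 : ℝ) < ζ * (S.M * S.c))
    linarith
  linarith

theorem card_parTriples_ge (E : Finset V) {T : Finset (AddSubgroup V)}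
    (hT : T ⊆ S.G) {η δ ν n : ℝ} (hν : 0 < ν) (hη : 0 ≤ η) (hδ : 0 < δ) (hδ1 : δ ≤ 1 / 100)
    (hηδ : 15 * η ≤ δ ^ 3) (hn : 4 ≤ δ * n) (hνE : S.Q * ν ^ 2 = E.card)
    (hsm : ∀ A ∈ T, ((thicken E A).card : ℝ) ^ 2 ≤ S.Q * S.M ^ 2 * E.card)
    (hnE : ∀ A ∈ T, n * (thicken E A).card ≤ S.M * E.card) {A : AddSubgroup V} (hA : A ∈ T)
    (hfew : ∑ l, (((S.fib A l).filter (fun φ => (φ, l) ∈ S.inc T \ S.great E η T)).card : ℝ) ≤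
      δ * (S.M * S.c)) :
    n ≤ 2 * ν ∧ (1 - 15 * δ) * (E.card ^ 2 * ν) ≤ (parTriples E A ((1 + δ) * ν)).card := by
  have hM : (0 : ℝ) < S.M := by exact_mod_cast S.M_pos
  have hc : (0 : ℝ) < S.c := by exact_mod_cast S.c_pos
  have hQ : (0 : ℝ) < S.Q := by exact_mod_cast S.Q_pos
  obtain ⟨N, hN⟩ : ∃ N, N = S.inc T \ S.great E η T := ⟨_, rfl⟩
  rw [← hN] at hfew
  have key : ∀ l, ∀ φ ∈ S.fib A l, (φ, l) ∉ N →
      n ≤ 2 * ν ∧ (1 - 13 * δ) * (E.card * ν ^ 3) ≤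
      ((parTriples E A ((1 + δ) * ν)).filter (fun p => p.1 - p.2.2 ∈ S.H φ)).card := by
    intro l φ hφ hp
    rw [S.mem_fib] at hφ
    have hi : (φ, l) ∈ S.inc T := by rw [S.mem_inc, hφ]; exact hA
    have hg : (φ, l) ∈ S.great E η T := by
      by_contra h; rw [hN] at hp; exact hp (Finset.mem_sdiff.2 ⟨hi, h⟩)
    obtain ⟨hb, l₂, l₃, h12, h13, h23, ⟨u2, b2⟩, ⟨u3, b3⟩⟩ := Finset.mem_filter.1 hg
    have b1 := (Finset.mem_filter.1 hb).2
    subst hφ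
    exact exists_parallelograms (S.inf_eq φ l l₂ h12) (S.inf_eq φ l l₃ h13) (S.inf_eq φ l₂ l₃ h23)
      (S.sup_eq φ l l₂ h12) (S.sup_eq φ l l₃ h13) (S.sup_eq φ l₂ l₃ h23) S.M_pos (S.card_U φ l)
      (S.card_U φ l₂) (S.card_U φ l₃) S.Q_pos S.card_V E hν hη hδ hδ1 hηδ hn hνE b1 (hsm _ hA)
      b2 (hsm _ u2) b3 (hsm _ u3) (hnE _ hA)
  set P := parTriples E A ((1 + δ) * ν) with hP
  have hle : ∀ l ∈ (Finset.univ : Finset ι), (S.Q : ℝ) *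
      ∑ φ ∈ S.fib A l, ((P.filter (fun p => p.1 - p.2.2 ∈ S.H φ)).card : ℝ) ≤ S.c * P.card :=
    fun l _ => S.sum_hit_le (hT hA) l P _ (fun p hp => (mem_parTriples.1 hp).2.2.2.1)
  have h1 := Finset.sum_le_sum hle
  rw [Finset.sum_const, Finset.card_univ, S.card_index, nsmul_eq_mul, ← Finset.mul_sum] at h1
  have h13 : 0 ≤ 1 - 13 * δ := by linarith
  have hlow : ∀ l ∈ (Finset.univ : Finset ι), (1 - 13 * δ) * (E.card * ν ^ 3) *
      (S.c - (((S.fib A l).filter (fun φ => (φ, l) ∈ N)).card : ℝ)) ≤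
      ∑ φ ∈ S.fib A l, ((P.filter (fun p => p.1 - p.2.2 ∈ S.H φ)).card : ℝ) := by
    intro l _
    have e1 : (S.c : ℝ) - (((S.fib A l).filter
        (fun φ => (φ, l) ∈ N)).card : ℝ) =
        ((S.fib A l).filter (fun φ => (φ, l) ∉ N)).card := by
      have := Finset.cast_card_filter_add_not (S.fib A l) (fun φ => (φ, l) ∈ N)
      rw [S.card_fib (hT hA) l] at this
      exact sub_eq_of_eq_add' this.symm
    rw [e1]
    calc _ = ∑ φ ∈ S.fib A l with (φ, l) ∉ N,
          (1 - 13 * δ) * (E.card * ν ^ 3) := by rw [Finset.sum_const, nsmul_eq_mul, mul_comm]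
      _ ≤ ∑ φ ∈ S.fib A l with (φ, l) ∉ N,
          ((P.filter (fun p => p.1 - p.2.2 ∈ S.H φ)).card : ℝ) :=
        Finset.sum_le_sum fun φ hφ =>
          (key l φ (Finset.mem_filter.1 hφ).1 (Finset.mem_filter.1 hφ).2).2
      _ ≤ _ := Finset.sum_le_sum_of_subset_of_nonneg (Finset.filter_subset _ _)
          (fun φ _ _ => Nat.cast_nonneg _)
  have h2 := Finset.sum_le_sum hlow
  rw [← Finset.mul_sum, Finset.sum_sub_distrib, Finset.sum_const, Finset.card_univ, S.card_index,
    nsmul_eq_mul] at h2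
  constructor
  · by_contra hcon
    have hz : ∀ l ∈ (Finset.univ : Finset ι), (((S.fib A l).filter
        (fun φ => (φ, l) ∈ N)).card : ℝ) = S.c := by
      intro l _
      rw [← S.card_fib (hT hA) l]
      congr 2
      refine Finset.filter_true_of_mem fun φ hφ => ?_
      by_contra h
      exact hcon (key l φ hφ h).1
    rw [Finset.sum_congr rfl hz, Finset.sum_const, Finset.card_univ, S.card_index,
      nsmul_eq_mul] at hfew
    have := mul_pos hM hc
    nlinarith
  · have h3 : (1 - 13 * δ) * (E.card * ν ^ 3) * ((1 - δ) * (S.M * S.c)) ≤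
        (1 - 13 * δ) * (E.card * ν ^ 3) * (S.M * S.c - ∑ l, (((S.fib A l).filter
          (fun φ => (φ, l) ∈ N)).card : ℝ)) :=
      mul_le_mul_of_nonneg_left (by linarith)
        (mul_nonneg h13 (mul_nonneg (Nat.cast_nonneg _) (by positivity)))
    have h4 := mul_le_mul_of_nonneg_left (h3.trans h2) hQ.le
    have h5 := h4.trans h1
    have h6 : (1 - 13 * δ) * (1 - δ) * (E.card ^ 2 * ν) ≤ P.card := by
      refine le_of_mul_le_mul_left ?_ (mul_pos hM hc)
      rw [mul_assoc (S.M : ℝ) (S.c : ℝ) (P.card : ℝ)]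
      refine le_trans (le_of_eq ?_) h5
      rw [← hνE]; ring
    refine le_trans ?_ h6
    exact mul_le_mul_of_nonneg_right (by nlinarith)
      (mul_nonneg (by positivity) hν.le)

end SpreadSystem

section Periods

open scoped Classical

variable {V : Type*} [AddCommGroup V] [Fintype V]

theorem zero_mem_perSet (E : Finset V) {τ : ℝ} (hτ : 0 ≤ τ) : 0 ∈ perSet E τ := by
  rw [mem_perSet]
  have : E.filter (fun x => x + 0 ∉ E) = ∅ := by
    refine Finset.filter_false_of_mem fun x hx => ?_
    simpa using hx
  rw [this]
  simpa using mul_nonneg hτ (Nat.cast_nonneg _)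

theorem perSet_mono (E : Finset V) {a b : ℝ} (h : a ≤ b) : perSet E a ⊆ perSet E b := by
  intro v hv
  rw [mem_perSet] at hv ⊢
  exact hv.trans (mul_le_mul_of_nonneg_right h (Nat.cast_nonneg _))

theorem add_mem_perSet {E : Finset V} {a b : ℝ} {v w : V} (hv : v ∈ perSet E a)
    (hw : w ∈ perSet E b) : v + w ∈ perSet E (a + b) := by
  rw [mem_perSet] at hv hw ⊢
  have h1 : (E.filter (fun x => x + (v + w) ∉ E)).card ≤
      (E.filter (fun x => x + v ∉ E)).card + (E.filter (fun x => x + w ∉ E)).card := by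
    have h2 : ((E.filter (fun x => x + v ∈ E ∧ x + v + w ∉ E))).card ≤
        (E.filter (fun x => x + w ∉ E)).card := by
      refine Finset.card_le_card_of_injOn (fun x => x + v) ?_ ?_
      · intro x hx
        simpa [Finset.mem_filter] using (Finset.mem_filter.1 hx).2
      · intro x _ y _ hxy
        exact add_right_cancel hxy
    refine le_trans ?_ (Nat.add_le_add_left h2 _)
    refine (Finset.card_le_card ?_).trans (Finset.card_union_le _ _)
    intro x
    simp only [Finset.mem_filter, Finset.mem_union, ← add_assoc]
    tauto
  have h3 : ((E.filter (fun x => x + (v + w) ∉ E)).card : ℝ) ≤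
      (E.filter (fun x => x + v ∉ E)).card + (E.filter (fun x => x + w ∉ E)).card := by
    exact_mod_cast h1
  linarith

theorem neg_mem_perSet {E : Finset V} {a : ℝ} {v : V} (hv : v ∈ perSet E a) :
    -v ∈ perSet E a := by
  rw [mem_perSet] at hv ⊢
  have h1 : (E.filter (fun x => x + -v ∈ E)).card = (E.filter (fun x => x + v ∈ E)).card := by
    refine Finset.card_bij (fun x _ => x + -v) ?_ ?_ ?_
    · intro x hx
      simp only [Finset.mem_filter] at hx ⊢
      exact ⟨hx.2, by simpa using hx.1⟩
    · intro x _ y _ hxy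
      exact add_right_cancel hxy
    · intro y hy
      simp only [Finset.mem_filter] at hy
      refine ⟨y + v, ?_, by simp⟩
      simp only [Finset.mem_filter]
      exact ⟨hy.2, by simpa using hy.1⟩
  have h2 := card_filter_add_mem E v
  have h3 := card_filter_add_mem E (-v)
  rw [h1] at h3
  linarith

/-- There are not many more than `|E|` almost periods. -/
theorem card_perSet_le (E : Finset V) (hE : 0 < E.card) (τ : ℝ) :
    (1 - τ) * (perSet E τ).card ≤ E.card := by
  have he : (0 : ℝ) < E.card := by exact_mod_cast hE
  have h1 : ∀ v ∈ perSet E τ, (1 - τ) * (E.card : ℝ) ≤ (E.filter (fun x => x + v ∈ E)).card := by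
    intro v hv
    rw [mem_perSet] at hv
    have := card_filter_add_mem E v
    linarith
  have h2 := Finset.sum_le_sum h1
  rw [Finset.sum_const, nsmul_eq_mul] at h2
  have h3 : ∑ v ∈ perSet E τ, ((E.filter (fun x => x + v ∈ E)).card : ℝ) ≤ E.card * E.card := by
    norm_cast
    simp_rw [Finset.card_filter]
    rw [Finset.sum_comm, ← smul_eq_mul, ← Finset.sum_const]
    refine Finset.sum_le_sum fun x _ => ?_
    rw [← Finset.card_filter]
    refine Finset.card_le_card_of_injOn (fun v => x + v) ?_ ?_
    · intro v hv
      exact (Finset.mem_filter.1 hv).2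
    · intro v _ w _ hvw
      exact add_left_cancel hvw
  refine le_of_mul_le_mul_right ?_ he
  linarith

/-- Once there are many almost periods, they form a subgroup. -/
theorem exists_subgroup_of_card_perSet (E : Finset V) (hE : 0 < E.card) {t : ℝ} (ht : 0 < t)
    (ht1 : t ≤ 1 / 100) (h : (1 - 4 * t) * E.card ≤ (perSet E (2 * t)).card) :
    ∃ W : AddSubgroup V, ∀ v, v ∈ W ↔ v ∈ perSet E (4 * t) := by
  have he : (0 : ℝ) < E.card := by exact_mod_cast hE
  have key : ∀ w, w ∈ perSet E (8 * t) → w ∈ perSet E (4 * t) := by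
    intro w hw
    set P := perSet E (2 * t)
    set P' := P.image (fun v => w + v) with hP'
    have hc : P'.card = P.card := Finset.card_image_of_injective _ (add_right_injective w)
    have h1 : P ⊆ perSet E (10 * t) := perSet_mono E (by linarith)
    have h2 : P' ⊆ perSet E (10 * t) := by
      intro x hx
      obtain ⟨v, hv, rfl⟩ := Finset.mem_image.1 hx
      have := add_mem_perSet hw hv
      rwa [show 8 * t + 2 * t = 10 * t by ring] at this
    have h3 := card_perSet_le E hE (10 * t)
    have h4 : ((P ∪ P').card : ℝ) ≤ (perSet E (10 * t)).card := by
      exact_mod_cast Finset.card_le_card (Finset.union_subset h1 h2)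
    have h5 : ((P ∪ P').card : ℝ) + (P ∩ P').card = P.card + P'.card := by
      exact_mod_cast Finset.card_union_add_card_inter P P'
    have h6 : (0 : ℝ) < (P ∩ P').card := by
      rw [hc] at h5
      have h7 := mul_le_mul_of_nonneg_left h4 (by linarith : 0 ≤ 1 - 10 * t)
      have h8 := mul_le_mul_of_nonneg_left h (by linarith : 0 ≤ 1 - 10 * t)
      have h9 : 0 < (2 * ((1 - 10 * t) * (1 - 4 * t)) - 1) * (E.card : ℝ) :=
        mul_pos (by nlinarith) he
      have h10 : 0 < (1 - 10 * t) * ((P ∩ P').card : ℝ) := by nlinarith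
      exact pos_of_mul_pos_right h10 (by linarith)
    obtain ⟨x, hx⟩ := Finset.card_pos.1 (by exact_mod_cast h6)
    rw [Finset.mem_inter] at hx
    obtain ⟨v, hv, hvx⟩ := Finset.mem_image.1 hx.2
    have := add_mem_perSet hx.1 (neg_mem_perSet hv)
    rw [← hvx] at this
    convert this using 2
    · ring
    · abel
  refine ⟨{ carrier := {v | v ∈ perSet E (4 * t)}
            zero_mem' := zero_mem_perSet E (by linarith)
            add_mem' := fun {a b} ha hb => key _ (by
              have := add_mem_perSet (E := E) ha hb
              rwa [show 4 * t + 4 * t = 8 * t by ring] at this)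
            neg_mem' := fun {a} ha => neg_mem_perSet (E := E) ha }, fun v => Iff.rfl⟩

end Periods

namespace SpreadSystem

open scoped Classical

variable {V Ω ι : Type*} [AddCommGroup V] [Fintype V] [Fintype Ω] [Fintype ι]
variable (S : SpreadSystem V Ω ι)

theorem card_perSet_ge (E : Finset V) {T : Finset (AddSubgroup V)} (hT : T ⊆ S.G)
    (hne : T.Nonempty) {C : ℝ} (hC : 0 < C) (hTC : C * S.G.card ≤ S.M * T.card) {t ν : ℝ}
    (ht : 0 < t) (ht1 : t ≤ 1 / 100) (hCt : 1 / C ≤ t) (hν : 1 ≤ t * ν)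
    (hνE : S.Q * ν ^ 2 = E.card)
    (hA : ∀ A ∈ T, (1 - t) * ν ≤ ((perSet E t).filter (fun v => v ∈ A)).card) :
    (1 - 4 * t) * E.card ≤ (perSet E (2 * t)).card := by
  have hM : (0 : ℝ) < S.M := by exact_mod_cast S.M_pos
  have hc : (0 : ℝ) < S.c := by exact_mod_cast S.c_pos
  have hQ : (0 : ℝ) < S.Q := by exact_mod_cast S.Q_pos
  have hν0 : 0 < ν := pos_of_mul_pos_right (lt_of_lt_of_le one_pos hν) ht.le
  set P := perSet E (2 * t) with hP
  set g : Ω × ι → ℝ := fun p =>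
    (((P.filter (fun v => v ∉ S.U p.1 p.2)).filter (fun v => v ∈ S.H p.1)).card : ℝ) with hg
  set N := (S.inc T).filter (fun p => ∃ l, p.2 ≠ l ∧ S.U p.1 l ∈ T) with hN
  have hlow : ∀ p ∈ N, (1 - 3 * t) * ν ^ 2 ≤ g p := by
    rintro ⟨φ, l⟩ hp
    obtain ⟨h1, l', hl, h2⟩ := Finset.mem_filter.1 hp
    rw [S.mem_inc] at h1
    simp only at hl h1 h2
    have b1 := hA _ h1
    have b2 := hA _ h2
    set P1 := (perSet E t).filter (fun v => v ∈ S.U φ l)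
    set P2 := (perSet E t).filter (fun v => v ∈ S.U φ l')
    have hcard : P1.card * (P2.erase 0).card ≤
        ((P.filter (fun v => v ∉ S.U φ l)).filter (fun v => v ∈ S.H φ)).card := by
      rw [← Finset.card_product]
      have hdis : ∀ v, v ∈ S.U φ l → v ∈ S.U φ l' → v = 0 := by
        intro v hv hv'
        have : v ∈ S.U φ l ⊓ S.U φ l' := ⟨hv, hv'⟩
        rwa [S.inf_eq φ l l' hl, AddSubgroup.mem_bot] at this
      refine Finset.card_le_card_of_injOn (fun p => p.1 + p.2) ?_ ?_
      · rintro ⟨u, w⟩ hp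
        rw [Finset.mem_coe, Finset.mem_product, Finset.mem_erase] at hp
        obtain ⟨hu, hw0, hw⟩ := hp
        obtain ⟨hu1, hu2⟩ := Finset.mem_filter.1 hu
        obtain ⟨hw1, hw2⟩ := Finset.mem_filter.1 hw
        simp only [Finset.mem_coe, Finset.mem_filter] at *
        refine ⟨⟨?_, ?_⟩, ?_⟩
        · have := add_mem_perSet hu1 hw1
          rwa [← two_mul] at this
        · intro h
          refine hw0 (hdis w ?_ hw2)
          simpa using (S.U φ l).sub_mem h hu2
        · exact (S.H φ).add_mem (S.U_le_H φ l hu2) (S.U_le_H φ l' hw2)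
      · rintro ⟨u, w⟩ hp ⟨u', w'⟩ hp' h
        rw [Finset.mem_coe, Finset.mem_product, Finset.mem_erase] at hp hp'
        have hu := (Finset.mem_filter.1 hp.1).2
        have hu' := (Finset.mem_filter.1 hp'.1).2
        have hw := (Finset.mem_filter.1 hp.2.2).2
        have hw' := (Finset.mem_filter.1 hp'.2.2).2
        simp only at h hu hu' hw hw'
        have h1 : u - u' = w' - w := by rw [sub_eq_sub_iff_add_eq_add, h, add_comm]
        have h2 := hdis (u - u') ((S.U φ l).sub_mem hu hu')
          (h1 ▸ (S.U φ l').sub_mem hw' hw)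
        rw [h2, eq_comm, sub_eq_zero] at h1
        rw [sub_eq_zero] at h2
        rw [h2, h1]
    have herase : (P2.card : ℝ) - 1 ≤ (P2.erase 0).card := by
      rw [sub_le_iff_le_add]
      have : P2.card ≤ (P2.erase 0).card + 1 := by
        have := Finset.pred_card_le_card_erase (s := P2) (a := 0)
        omega
      exact_mod_cast this
    have b3 : (1 - 2 * t) * ν ≤ (P2.erase 0).card := by linarith
    calc (1 - 3 * t) * ν ^ 2 ≤ ((1 - t) * ν) * ((1 - 2 * t) * ν) := by
          have : 0 ≤ t ^ 2 * ν ^ 2 := by positivity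
          nlinarith
      _ ≤ (P1.card : ℝ) * (P2.erase 0).card :=
          mul_le_mul b1 b3 (mul_nonneg (by linarith) hν0.le) (Nat.cast_nonneg _)
      _ ≤ _ := by rw [hg, ← Nat.cast_mul]; exact Nat.cast_le.2 hcard
  have hup : S.Q * ∑ p ∈ S.inc T, g p ≤ (S.inc T).card * P.card := by
    rw [S.sum_inc T g, Finset.mul_sum, S.card_inc hT]
    have : ∀ A ∈ T, S.Q * ∑ l, ∑ φ ∈ S.fib A l, g (φ, l) ≤ S.M * S.c * P.card := by
      intro A hA'
      rw [Finset.mul_sum]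
      have : ∀ l ∈ (Finset.univ : Finset ι), S.Q * ∑ φ ∈ S.fib A l, g (φ, l) ≤ S.c * P.card := by
        intro l _
        have h1 := S.sum_hit_le (hT hA') l (P.filter (fun v => v ∉ A)) id
          (fun v hv => (Finset.mem_filter.1 hv).2)
        have h2 : ((P.filter (fun v => v ∉ A)).card : ℝ) ≤ P.card := by
          exact_mod_cast Finset.card_filter_le _ _
        refine le_trans (le_of_eq ?_) (h1.trans (mul_le_mul_of_nonneg_left h2 hc.le))
        congr 1
        refine Finset.sum_congr rfl fun φ hφ => ?_
        rw [S.mem_fib] at hφ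
        simp only [hg, hφ, id]
      refine (Finset.sum_le_sum this).trans (le_of_eq ?_)
      rw [Finset.sum_const, Finset.card_univ, S.card_index, nsmul_eq_mul, mul_assoc]
    refine (Finset.sum_le_sum this).trans (le_of_eq ?_)
    rw [Finset.sum_const, nsmul_eq_mul]
    ring
  have hlonely := S.card_sparse_le hT hC hTC
    ((S.inc T).filter (fun p => ¬ ∃ l, p.2 ≠ l ∧ S.U p.1 l ∈ T)) (K := 1) zero_le_one (by
      intro φ
      norm_cast
      rw [Finset.card_le_one]
      rintro ⟨φ₁, l₁⟩ h1 ⟨φ₂, l₂⟩ h2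
      simp only [Finset.mem_filter, S.mem_inc] at h1 h2
      obtain ⟨⟨h1, h1'⟩, rfl⟩ := h1
      obtain ⟨⟨h2, -⟩, rfl⟩ := h2
      by_contra hne
      refine h1' ⟨l₂, ?_, h2⟩
      rintro rfl
      exact hne rfl)
  have hsplit := Finset.cast_card_filter_add_not (S.inc T)
    (fun p => ∃ l, p.2 ≠ l ∧ S.U p.1 l ∈ T)
  have hI : (0 : ℝ) < (S.inc T).card := by
    rw [S.card_inc hT]
    have : (0 : ℝ) < T.card := by exact_mod_cast hne.card_pos
    positivity
  have hNI : (1 - t) * (S.inc T).card ≤ N.card := by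
    have := mul_le_mul_of_nonneg_right hCt hI.le
    linarith
  have h1 : ∑ p ∈ N, g p ≤ ∑ p ∈ S.inc T, g p :=
    Finset.sum_le_sum_of_subset_of_nonneg (Finset.filter_subset _ _)
      (fun p _ _ => Nat.cast_nonneg _)
  have h2 := Finset.sum_le_sum hlow
  rw [Finset.sum_const, nsmul_eq_mul] at h2
  have h3 : (1 - t) * (S.inc T).card * ((1 - 3 * t) * ν ^ 2) ≤ N.card * ((1 - 3 * t) * ν ^ 2) :=
    mul_le_mul_of_nonneg_right hNI (mul_nonneg (by linarith) (sq_nonneg _))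
  have h4 := (mul_le_mul_of_nonneg_left (h3.trans (h2.trans h1)) hQ.le).trans hup
  refine le_of_mul_le_mul_left ?_ hI
  refine le_trans ?_ h4
  rw [← hνE]
  have h5 : (1 - 4 * t) ≤ (1 - t) * (1 - 3 * t) := by nlinarith [sq_nonneg t]
  have h6 := mul_le_mul_of_nonneg_right h5
    (mul_nonneg hI.le (mul_nonneg hQ.le (sq_nonneg ν)))
  linarith

end SpreadSystem

section Periods

open scoped Classical

variable {V : Type*} [AddCommGroup V] [Fintype V]

theorem card_thicken_image_sub (E : Finset V) (U : AddSubgroup V) (a : V) :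
    (thicken (E.image (fun x => x - a)) U).card = (thicken E U).card := by
  symm
  refine Finset.card_bij (fun z _ => z - a) ?_ ?_ ?_
  · intro z hz
    obtain ⟨x, hx, hzx⟩ := mem_thicken.1 hz
    exact mem_thicken.2 ⟨x - a, Finset.mem_image_of_mem _ hx, by simpa using hzx⟩
  · intro z _ w _ h
    exact sub_left_injective h
  · intro z hz
    obtain ⟨x, hx, hzx⟩ := mem_thicken.1 hz
    obtain ⟨y, hy, rfl⟩ := Finset.mem_image.1 hx
    refine ⟨z + a, mem_thicken.2 ⟨y, hy, ?_⟩, by simp⟩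
    rwa [← sub_sub_eq_add_sub]

/-- If all elements of `W` are almost periods of `E`, then a translate of `E` nearly fills `W`. -/
theorem exists_card_filter_mem_ge (E : Finset V) (hE : 0 < E.card) {τ : ℝ} (W : AddSubgroup V)
    (hW : ∀ v ∈ W, v ∈ perSet E τ) : ∃ a, (1 - τ) * Nat.card W ≤
      ((E.image (fun x => x - a)).filter (fun v => v ∈ W)).card := by
  set Wf : Finset V := Finset.univ.filter (fun v => v ∈ W) with hWf
  have hWc : Wf.card = Nat.card W := by
    rw [hWf, ← Fintype.card_subtype, ← Nat.card_eq_fintype_card]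
  have h1 : ∀ v ∈ Wf, (1 - τ) * (E.card : ℝ) ≤ (E.filter (fun x => x + v ∈ E)).card := by
    intro v hv
    have := hW v (Finset.mem_filter.1 hv).2
    rw [mem_perSet] at this
    have := card_filter_add_mem E v
    linarith
  have h2 := Finset.sum_le_sum h1
  have h3 : ∑ v ∈ Wf, ((E.filter (fun x => x + v ∈ E)).card : ℝ) =
      ∑ x ∈ E, ((cosetPart E W x).card : ℝ) := by
    norm_cast
    simp_rw [Finset.card_filter]
    rw [Finset.sum_comm]
    refine Finset.sum_congr rfl fun x _ => ?_
    rw [← Finset.card_filter]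
    refine Finset.card_bij (fun v _ => x + v) ?_ ?_ ?_
    · intro v hv
      rw [hWf, Finset.mem_filter, Finset.mem_filter] at hv
      rw [mem_cosetPart]
      exact ⟨hv.2, by simpa using hv.1.2⟩
    · intro v _ w _ hvw
      exact add_left_cancel hvw
    · intro y hy
      rw [mem_cosetPart] at hy
      refine ⟨y - x, ?_, by abel⟩
      rw [hWf, Finset.mem_filter, Finset.mem_filter]
      exact ⟨⟨Finset.mem_univ _, hy.2⟩, by simpa using hy.1⟩
  rw [h3, Finset.sum_const, nsmul_eq_mul, hWc] at h2
  have h4 : ∑ x ∈ E, (1 - τ) * (Nat.card W : ℝ) ≤ ∑ x ∈ E, ((cosetPart E W x).card : ℝ) := by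
    rw [Finset.sum_const, nsmul_eq_mul]
    linarith
  obtain ⟨a, ha, h5⟩ := Finset.exists_le_of_sum_le (Finset.card_pos.1 hE) h4
  refine ⟨a, h5.trans (le_of_eq ?_)⟩
  norm_cast
  refine Finset.card_bij (fun x _ => x - a) ?_ ?_ ?_
  · intro x hx
    rw [mem_cosetPart] at hx
    exact Finset.mem_filter.2 ⟨Finset.mem_image_of_mem _ hx.1, hx.2⟩
  · intro z _ w _ h
    exact sub_left_injective h
  · intro y hy
    obtain ⟨hy, hyW⟩ := Finset.mem_filter.1 hy
    obtain ⟨x, hx, rfl⟩ := Finset.mem_image.1 hy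
    exact ⟨x, mem_cosetPart.2 ⟨hx, hyW⟩, rfl⟩

end Periods

namespace SpreadSystem

open scoped Classical

variable {V Ω ι : Type*} [AddCommGroup V] [Fintype V] [Fintype Ω] [Fintype ι]
variable (S : SpreadSystem V Ω ι)

/-- A set with many small thickenings is, up to translation, close to a subgroup. -/
theorem exists_subgroup (E : Finset V) (hE : 0 < E.card) {T : Finset (AddSubgroup V)}
    (hT : T ⊆ S.G) (hne : T.Nonempty) (hTC : 10 ^ 20 * (S.G.card : ℝ) ≤ S.M * T.card) {n : ℝ}
    (hn : 10 ^ 70 ≤ n)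
    (hsm : ∀ A ∈ T, ((thicken E A).card : ℝ) ^ 2 ≤ S.Q * S.M ^ 2 * E.card)
    (hnE : ∀ A ∈ T, n * (thicken E A).card ≤ S.M * E.card) :
    ∃ (W : AddSubgroup V) (a : V),
      (1 - 5 / 10 ^ 6) * (E.card : ℝ) ≤
        ((E.image (fun x => x - a)).filter (fun v => v ∈ W)).card ∧
      (1 - 5 / 10 ^ 6) * (E.card : ℝ) ≤ Nat.card W ∧
      (Nat.card W : ℝ) ≤ (1 + 5 / 10 ^ 6) * E.card ∧
      10 ^ 6 * (S.Q : ℝ) ≤ E.card := by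
  have hQ : (0 : ℝ) < S.Q := by exact_mod_cast S.Q_pos
  have he : (0 : ℝ) < E.card := by exact_mod_cast hE
  set ν : ℝ := Real.sqrt (E.card / S.Q) with hν
  have hν0 : 0 < ν := Real.sqrt_pos.2 (div_pos he hQ)
  have hνE : S.Q * ν ^ 2 = E.card := by
    rw [hν, Real.sq_sqrt (div_pos he hQ).le]
    field_simp
  have hn0 : 0 < n := lt_of_lt_of_le (by norm_num) hn
  have hbad := S.card_not_great_le E hE hT (C := 10 ^ 20) (by norm_num) hTC
    (η := 1 / 10 ^ 50) (n := n) (ζ := 3 / 10 ^ 20) (by norm_num) hn0 hnE (by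
      have : 1 / (1 / 10 ^ 50 * n) ≤ 1 / (10 ^ 20 : ℝ) := by
        apply one_div_le_one_div_of_le (by norm_num)
        linarith
      linarith)
  have hhalf := S.card_le_two_mul_of_few hT (ζ := 3 / 10 ^ 20) (by norm_num) _
    Finset.sdiff_subset hbad
  set T₁ := T.filter (fun A => ∑ l, (((S.fib A l).filter
    (fun φ => (φ, l) ∈ S.inc T \ S.great E (1 / 10 ^ 50) T)).card : ℝ) ≤
      2 * (3 / 10 ^ 20) * (S.M * S.c)) with hT₁
  have hTpos : (0 : ℝ) < T.card := by exact_mod_cast hne.card_pos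
  have hne₁ : T₁.Nonempty := by
    rw [← Finset.card_pos]
    have : (0 : ℝ) < T₁.card := by linarith
    exact_mod_cast this
  have hpar : ∀ A ∈ T₁, n ≤ 2 * ν ∧ (1 - 15 * (1 / 10 ^ 16)) * (E.card ^ 2 * ν) ≤
      (parTriples E A ((1 + 1 / 10 ^ 16) * ν)).card := by
    intro A hA
    obtain ⟨hA1, hA2⟩ := Finset.mem_filter.1 hA
    refine S.card_parTriples_ge E hT (η := 1 / 10 ^ 50) (n := n) hν0 (by norm_num) (by norm_num)
      (by norm_num) (by norm_num) (by linarith) hνE hsm hnE hA1 (hA2.trans ?_)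
    refine mul_le_mul_of_nonneg_right (by norm_num) ?_
    exact mul_nonneg (Nat.cast_nonneg _) (Nat.cast_nonneg _)
  have hν1 : 10 ^ 69 ≤ ν := by
    obtain ⟨A, hA⟩ := hne₁
    have := (hpar A hA).1
    linarith
  have hper : ∀ A ∈ T₁, (1 - 1 / 10 ^ 7) * ν ≤
      ((perSet E (1 / 10 ^ 7)).filter (fun v => v ∈ A)).card := fun A hA =>
    card_perSet_ge_of_parTriples E A hν0 hE (by norm_num) (by norm_num) (by norm_num)
      (by norm_num) (hpar A hA).2
  have hTC₁ : 10 ^ 19 * (S.G.card : ℝ) ≤ S.M * T₁.card := by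
    have h1 := mul_le_mul_of_nonneg_left hhalf (Nat.cast_nonneg (α := ℝ) S.M)
    have h2 : (0 : ℝ) ≤ S.G.card := Nat.cast_nonneg _
    linarith
  have hbig := S.card_perSet_ge E ((Finset.filter_subset _ _).trans hT) hne₁ (C := 10 ^ 19)
    (by norm_num) hTC₁ (t := 1 / 10 ^ 7) (by norm_num) (by norm_num) (by norm_num)
    (by linarith) hνE hper
  obtain ⟨W, hW⟩ := exists_subgroup_of_card_perSet E hE (t := 1 / 10 ^ 7) (by norm_num)
    (by norm_num) hbig
  obtain ⟨a, ha⟩ := exists_card_filter_mem_ge E hE W (fun v hv => (hW v).1 hv)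
  have hWc : Nat.card W = (perSet E (4 * (1 / 10 ^ 7))).card := by
    rw [← Fintype.card_coe, ← Nat.card_eq_fintype_card]
    exact Nat.card_congr (Equiv.subtypeEquivRight hW)
  have h1 : ((perSet E (2 * (1 / 10 ^ 7))).card : ℝ) ≤ Nat.card W := by
    rw [hWc]
    exact_mod_cast Finset.card_le_card (perSet_mono E (by norm_num))
  have h2 := card_perSet_le E hE (4 * (1 / 10 ^ 7))
  rw [← hWc] at h2
  refine ⟨W, a, ?_, ?_, ?_, ?_⟩
  · linarith
  · linarith
  · linarith
  · rw [← hνE, mul_comm]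
    refine mul_le_mul_of_nonneg_left ?_ hQ.le
    nlinarith

end SpreadSystem

section Thin

open scoped Classical

variable {V : Type*} [AddCommGroup V] [Fintype V]

/-- The points of `R` lying on a coset of `U` with at least `h` points of `R`. -/
noncomputable def heavy (R : Finset V) (U : AddSubgroup V) (h : ℝ) : Finset V :=
  R.filter (fun x => h ≤ (cosetPart R U x).card)

theorem mem_heavy {R : Finset V} {U : AddSubgroup V} {h : ℝ} {x : V} :
    x ∈ heavy R U h ↔ x ∈ R ∧ h ≤ (cosetPart R U x).card := by
  simp [heavy]

theorem card_heavy_inter_le (R : Finset V) {U U' H : AddSubgroup V} (hd : U ⊓ U' = ⊥)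
    (hU : U ≤ H) (hU' : U' ≤ H) {h κ : ℝ} (hh : 0 < h) (hκ : 0 ≤ κ) :
    (((heavy R U h ∩ heavy R U' h).filter
      (fun x => ((cosetPart R H x).card : ℝ) ≤ κ * h ^ 2)).card : ℝ) ≤ κ * R.card := by
  set B := (heavy R U h ∩ heavy R U' h).filter
    (fun x => ((cosetPart R H x).card : ℝ) ≤ κ * h ^ 2) with hB
  have h1 : (B.card : ℝ) * h ^ 2 ≤
      ∑ x ∈ B, ((cosetPart R U x).card * (cosetPart R U' x).card : ℕ) := by
    rw [← nsmul_eq_mul, ← Finset.sum_const]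
    push_cast
    refine Finset.sum_le_sum fun x hx => ?_
    rw [hB, Finset.mem_filter, Finset.mem_inter, mem_heavy, mem_heavy] at hx
    rw [sq]
    exact mul_le_mul hx.1.1.2 hx.1.2.2 hh.le (Nat.cast_nonneg _)
  have h2 : ∑ x ∈ B, (cosetPart R U x).card * (cosetPart R U' x).card ≤
      ∑ y ∈ R with ((cosetPart R H y).card : ℝ) ≤ κ * h ^ 2, (cosetPart R H y).card := by
    simp_rw [← Finset.card_product]
    rw [← Finset.card_sigma, ← Finset.card_sigma]
    refine Finset.card_le_card_of_injOn (fun p => ⟨p.2.1, p.2.2⟩) ?_ ?_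
    · rintro ⟨x, y, z⟩ hp
      simp only [Finset.mem_coe, Finset.mem_sigma, Finset.mem_product, mem_cosetPart,
        Finset.mem_filter] at hp ⊢
      obtain ⟨hx, ⟨hy, hyx⟩, hz, hzx⟩ := hp
      rw [hB, Finset.mem_filter] at hx
      refine ⟨⟨hy, ?_⟩, hz, ?_⟩
      · rw [cosetPart_congr R (hU hyx)]
        exact hx.2
      · rw [← sub_sub_sub_cancel_right z y x]
        exact H.sub_mem (hU' hzx) (hU hyx)
    · rintro ⟨x, y, z⟩ hp ⟨x', y', z'⟩ hp' heq
      simp only [Finset.mem_coe, Finset.mem_sigma, Finset.mem_product, mem_cosetPart] at hp hp'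
      simp only [Sigma.mk.injEq] at heq
      obtain ⟨rfl, heq⟩ := heq
      obtain rfl := eq_of_heq heq
      have hm : x - x' ∈ U ⊓ U' := by
        constructor
        · rw [← sub_sub_sub_cancel_left x' x y]
          exact U.sub_mem hp'.2.1.2 hp.2.1.2
        · rw [← sub_sub_sub_cancel_left x' x z]
          exact U'.sub_mem hp'.2.2.2 hp.2.2.2
      rw [hd, AddSubgroup.mem_bot, sub_eq_zero] at hm
      rw [hm]
  have h3 : ((∑ y ∈ R with ((cosetPart R H y).card : ℝ) ≤ κ * h ^ 2,
      (cosetPart R H y).card : ℕ) : ℝ) ≤ R.card * (κ * h ^ 2) := by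
    push_cast
    refine (Finset.sum_le_sum (fun y hy => (Finset.mem_filter.1 hy).2)).trans ?_
    rw [Finset.sum_const, nsmul_eq_mul]
    refine mul_le_mul_of_nonneg_right ?_ (by positivity)
    exact_mod_cast Finset.card_filter_le _ _
  have h2' : ((∑ x ∈ B, (cosetPart R U x).card * (cosetPart R U' x).card : ℕ) : ℝ) ≤
      ((∑ y ∈ R with ((cosetPart R H y).card : ℝ) ≤ κ * h ^ 2,
      (cosetPart R H y).card : ℕ) : ℝ) := Nat.cast_le.2 h2
  have h4 := h1.trans (h2'.trans h3)
  refine le_of_mul_le_mul_right ?_ (by positivity : (0 : ℝ) < h ^ 2)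
  linarith

theorem sum_card_sq_le {ι : Type*} (L : Finset ι) (R : Finset V) (B : ι → Finset V)
    (hB : ∀ l ∈ L, B l ⊆ R) {κ : ℝ} (hκ : 0 ≤ κ)
    (hBB : ∀ l ∈ L, ∀ l' ∈ L, l ≠ l' → ((B l ∩ B l').card : ℝ) ≤ κ * R.card) :
    (∑ l ∈ L, ((B l).card : ℝ)) ^ 2 ≤ R.card * (L.card * R.card + L.card ^ 2 * (κ * R.card)) := by
  set f : V → ℝ := fun x => ∑ l ∈ L, if x ∈ B l then 1 else 0
  have h1 : ∀ l ∈ L, ((B l).card : ℝ) = ∑ x ∈ R, if x ∈ B l then 1 else 0 := by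
    intro l hl
    rw [← Finset.sum_filter, Finset.filter_mem_eq_inter, Finset.inter_eq_right.2 (hB l hl)]
    simp
  rw [Finset.sum_congr rfl h1, Finset.sum_comm]
  refine (sq_sum_le_card_mul_sum_sq (s := R) (f := f)).trans ?_
  refine mul_le_mul_of_nonneg_left ?_ (Nat.cast_nonneg _)
  have h2 : ∀ x ∈ R, f x ^ 2 = ∑ l ∈ L, ∑ l' ∈ L, if x ∈ B l ∩ B l' then (1 : ℝ) else 0 := by
    intro x _
    rw [sq, Finset.sum_mul_sum]
    refine Finset.sum_congr rfl fun l _ => Finset.sum_congr rfl fun l' _ => ?_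
    simp only [Finset.mem_inter]
    split_ifs <;> simp_all
  rw [Finset.sum_congr rfl h2, Finset.sum_comm]
  have h3 : ∀ l ∈ L, ∑ x ∈ R, ∑ l' ∈ L, (if x ∈ B l ∩ B l' then (1 : ℝ) else 0) ≤
      R.card + L.card * (κ * R.card) := by
    intro l hl
    rw [Finset.sum_comm]
    have h4 : ∀ l' ∈ L, ∑ x ∈ R, (if x ∈ B l ∩ B l' then (1 : ℝ) else 0) ≤
        (if l = l' then (R.card : ℝ) else 0) + κ * R.card := by
      intro l' hl'
      rw [← Finset.sum_filter, Finset.filter_mem_eq_inter, Finset.sum_const, nsmul_eq_mul, mul_one]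
      split_ifs with h
      · have h5 : ((R ∩ (B l ∩ B l')).card : ℝ) ≤ R.card := by
          exact_mod_cast Finset.card_le_card Finset.inter_subset_left
        have : 0 ≤ κ * (R.card : ℝ) := mul_nonneg hκ (Nat.cast_nonneg _)
        linarith
      · rw [zero_add]
        refine le_trans ?_ (hBB l hl l' hl' h)
        exact_mod_cast Finset.card_le_card Finset.inter_subset_right
    refine (Finset.sum_le_sum h4).trans ?_
    rw [Finset.sum_add_distrib, Finset.sum_ite_eq, if_pos hl, Finset.sum_const, nsmul_eq_mul]
  refine (Finset.sum_le_sum h3).trans (le_of_eq ?_)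
  rw [Finset.sum_const, nsmul_eq_mul]
  ring

/-- For most members of a partial spread, few points in thin cosets are heavy. -/
theorem sum_card_heavy_thin_le {ι : Type*} (L : Finset ι) (R : Finset V) (U : ι → AddSubgroup V)
    (H : AddSubgroup V) (hd : ∀ l l', l ≠ l' → U l ⊓ U l' = ⊥) (hU : ∀ l, U l ≤ H) {h : ℝ}
    (hh : 0 < h) (hL : 400 ≤ (L.card : ℝ)) :
    ∑ l ∈ L, (((heavy R (U l) h).filter
      (fun x => ((cosetPart R H x).card : ℝ) ≤ 1 / 400 * h ^ 2)).card : ℝ) ≤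
      1 / 10 * (L.card * R.card) := by
  have h1 := sum_card_sq_le L R (fun l => (heavy R (U l) h).filter
      (fun x => ((cosetPart R H x).card : ℝ) ≤ 1 / 400 * h ^ 2))
    (fun l _ => (Finset.filter_subset _ _).trans (Finset.filter_subset _ _)) (κ := 1 / 400)
    (by norm_num) (fun l _ l' _ hl => by
      rw [← Finset.filter_inter_distrib]
      exact card_heavy_inter_le R (hd l l' hl) (hU l) (hU l') hh (by norm_num))
  refine abs_le_of_sq_le_sq' (h1.trans ?_)
    (mul_nonneg (by norm_num) (mul_nonneg (Nat.cast_nonneg _) (Nat.cast_nonneg _))) |>.2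
  have h2 := mul_le_mul_of_nonneg_left hL
    (mul_nonneg (Nat.cast_nonneg (α := ℝ) L.card) (sq_nonneg (R.card : ℝ)))
  nlinarith

end Thin

section Fibers

open scoped Classical

variable {V : Type*} [AddCommGroup V] [Fintype V]

theorem card_mul_card_le_of_fiber {E Y : Finset V} {U : AddSubgroup V} (hY : Y ⊆ thicken E U)
    {h : ℝ} (hh0 : 0 ≤ h) (hh : ∀ y ∈ Y, ((cosetPart Y U y).card : ℝ) ≤ h) :
    (Nat.card U : ℝ) * Y.card ≤ h * (thicken E U).card := by
  have h1 := card_sq_mul_le_card_mul_cosetPairs (thicken_closed E U) hY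
  rcases Y.eq_empty_or_nonempty with rfl | ⟨y, hy⟩
  · simpa using mul_nonneg hh0 (Nat.cast_nonneg (α := ℝ) (thicken E U).card)
  have hY0 : (0 : ℝ) < Y.card := by exact_mod_cast Finset.card_pos.2 ⟨y, hy⟩
  have h1' : (Nat.card U : ℝ) * Y.card ^ 2 ≤ (thicken E U).card * (cosetPairs Y U).card := by
    exact_mod_cast h1
  have h2 : ((cosetPairs Y U).card : ℝ) ≤ Y.card * h := by
    rw [card_cosetPairs]
    push_cast
    refine (Finset.sum_le_sum hh).trans ?_
    rw [Finset.sum_const, nsmul_eq_mul]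
  have h3 := mul_le_mul_of_nonneg_left h2 (Nat.cast_nonneg (α := ℝ) (thicken E U).card)
  refine le_of_mul_le_mul_right ?_ hY0
  linarith

/-- The elements of a subgroup, as a finset. -/
noncomputable def AddSubgroup.elems (W : AddSubgroup V) : Finset V :=
  Finset.univ.filter (fun v => v ∈ W)

theorem AddSubgroup.mem_elems {W : AddSubgroup V} {v : V} : v ∈ W.elems ↔ v ∈ W := by
  simp [AddSubgroup.elems]

theorem AddSubgroup.card_elems (W : AddSubgroup V) : W.elems.card = Nat.card W := by
  rw [← Fintype.card_coe, ← Nat.card_eq_fintype_card]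
  exact Nat.card_congr (Equiv.subtypeEquivRight fun v => AddSubgroup.mem_elems)

theorem cosetPart_elems {W U : AddSubgroup V} {y : V} (hy : y ∈ W) :
    (cosetPart W.elems U y).card = Nat.card ↥(W ⊓ U) := by
  rw [← card_cosetPart_univ (W ⊓ U) y]
  congr 1
  ext z
  simp only [mem_cosetPart, AddSubgroup.mem_elems, Finset.mem_univ, true_and,
    AddSubgroup.mem_inf]
  constructor
  · rintro ⟨h1, h2⟩
    exact ⟨W.sub_mem h1 hy, h2⟩
  · rintro ⟨h1, h2⟩
    exact ⟨by simpa using W.add_mem h1 hy, h2⟩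

theorem exists_mul_card_inf (W H : AddSubgroup V) {Q : ℕ}
    (hQ : Nat.card V = Q * Nat.card H) : ∃ k, Q * Nat.card ↥(W ⊓ H) = k * Nat.card W := by
  have hH : 0 < Nat.card H := Nat.card_pos
  have h1 : H.index = Q := by
    have := H.card_mul_index
    rw [hQ, mul_comm] at this
    exact Nat.eq_of_mul_eq_mul_right hH this
  have h2 : H.relIndex W ∣ Q := h1 ▸ AddSubgroup.relIndex_dvd_index_of_normal H W
  obtain ⟨k, hk⟩ := h2
  refine ⟨k, ?_⟩
  have h3 : Nat.card ↥(W ⊓ H) * H.relIndex W = Nat.card W := by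
    have := AddSubgroup.relIndex_mul_relIndex ⊥ (W ⊓ H) W bot_le inf_le_left
    rwa [AddSubgroup.inf_relIndex_left, AddSubgroup.relIndex_bot_left,
      AddSubgroup.relIndex_bot_left] at this
  rw [hk, ← h3]
  ring

/-- The intersection with a nearly extremal pair of summands splits. -/
theorem inf_sup_of_card {W U U' H : AddSubgroup V} (hd : U ⊓ U' = ⊥) (hU : U ≤ H) (hU' : U' ≤ H)
    {Q : ℕ} (hQ : 0 < Q) (honto : Q * Nat.card ↥(W ⊓ H) = Nat.card W)
    (h1 : (Nat.card W : ℝ) < 2 * (Q * (Nat.card ↥(W ⊓ U) : ℝ) ^ 2))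
    (h2 : (Nat.card W : ℝ) < 2 * (Q * (Nat.card ↥(W ⊓ U') : ℝ) ^ 2)) :
    (W ⊓ U) ⊔ (W ⊓ U') = W ⊓ H ∧
      Q * (Nat.card ↥(W ⊓ U) * Nat.card ↥(W ⊓ U')) = Nat.card W := by
  have hle : (W ⊓ U) ⊔ (W ⊓ U') ≤ W ⊓ H :=
    sup_le (inf_le_inf_left W hU) (inf_le_inf_left W hU')
  have hdis : (W ⊓ U) ⊓ (W ⊓ U') = ⊥ := by
    rw [eq_bot_iff, ← hd]
    exact inf_le_inf inf_le_right inf_le_right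
  have hc := card_sup_of_disjoint hdis
  obtain ⟨k, hk⟩ := AddSubgroup.card_dvd_of_le hle
  rw [hc] at hk
  set a := Nat.card ↥(W ⊓ U)
  set b := Nat.card ↥(W ⊓ U')
  have hW : 0 < Nat.card W := Nat.card_pos
  have hW' : (0 : ℝ) < Nat.card W := by exact_mod_cast hW
  have hk2 : k < 2 := by
    by_contra! hk2
    have h3 : 2 * (Q * (a * b)) ≤ Nat.card W := by
      rw [← honto, hk]
      nlinarith [Nat.mul_le_mul_left (Q * (a * b)) hk2]
    have h3' : 2 * (Q * ((a : ℝ) * b)) ≤ Nat.card W := by exact_mod_cast h3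
    have h4 : (Nat.card W : ℝ) * Nat.card W < (2 * (Q * (a : ℝ) ^ 2)) * (2 * (Q * (b : ℝ) ^ 2)) :=
      mul_lt_mul'' h1 h2 hW'.le hW'.le
    have h5 : (2 * (Q * ((a : ℝ) * b))) * (2 * (Q * ((a : ℝ) * b))) ≤
        (Nat.card W : ℝ) * Nat.card W :=
      mul_le_mul h3' h3' (by positivity) hW'.le
    linarith
  have hk0 : k ≠ 0 := by
    rintro rfl
    rw [mul_zero] at hk
    have : 0 < Nat.card ↥(W ⊓ H) := Nat.card_pos
    omega
  have hk1 : k = 1 := by omega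
  rw [hk1, mul_one] at hk
  refine ⟨?_, by rw [← hk, honto]⟩
  refine AddSubgroup.eq_of_le_of_card_ge hle ?_
  rw [hc, hk]

end Fibers

namespace SpreadSystem

open scoped Classical

variable {V Ω ι : Type*} [AddCommGroup V] [Fintype V] [Fintype Ω] [Fintype ι]
variable (S : SpreadSystem V Ω ι)

/-- The incidences over those `φ` for which `H φ` is transversal to `W` and `T` has many
members. -/
noncomputable def core (T : Finset (AddSubgroup V)) (W : AddSubgroup V) : Finset (Ω × ι) :=
  (S.inc T).filter (fun p => S.Q * Nat.card ↥(W ⊓ S.H p.1) = Nat.card W ∧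
    400 ≤ (Finset.univ.filter (fun l => S.U p.1 l ∈ T)).card)

theorem card_not_onto_le {T : Finset (AddSubgroup V)} (hT : T ⊆ S.G) {C : ℝ} (hC : 0 < C)
    (hTC : C * S.G.card ≤ S.M * T.card) (W : AddSubgroup V) :
    (Nat.card W : ℝ) *
      ((S.inc T).filter (fun p => ¬ S.Q * Nat.card ↥(W ⊓ S.H p.1) = Nat.card W)).card ≤
      (S.inc T).card * (S.Q + 1 / C * Nat.card W) := by
  have h1 := S.sum_card_inc_hit_le hT hC hTC W.elems id
  have h2 : ∀ p : Ω × ι, (W.elems.filter (fun x => id x ∈ S.H p.1)).card =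
      Nat.card ↥(W ⊓ S.H p.1) := by
    intro p
    rw [← AddSubgroup.card_elems]
    congr 1
    ext v
    simp [AddSubgroup.mem_elems]
  have h3 : ((W.elems.filter (fun x => id x = 0)).card : ℝ) ≤ 1 := by
    norm_cast
    rw [Finset.card_le_one]
    intro a ha b hb
    rw [Finset.mem_filter] at ha hb
    exact ha.2.trans hb.2.symm
  simp_rw [h2] at h1
  rw [AddSubgroup.card_elems] at h1
  have h4 : ∀ p ∈ S.inc T, (Nat.card W : ℝ) +
      (if ¬ S.Q * Nat.card ↥(W ⊓ S.H p.1) = Nat.card W then (Nat.card W : ℝ) else 0) ≤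
      S.Q * (Nat.card ↥(W ⊓ S.H p.1) : ℝ) := by
    intro p _
    obtain ⟨k, hk⟩ := exists_mul_card_inf W (S.H p.1) (Q := S.Q) (by
      rw [Nat.card_eq_fintype_card, S.card_V, S.card_H])
    have hk0 : k ≠ 0 := by
      rintro rfl
      have h5 : 0 < Nat.card ↥(W ⊓ S.H p.1) := Nat.card_pos
      have := Nat.mul_pos S.Q_pos h5
      omega
    have hw : (0 : ℝ) ≤ Nat.card W := Nat.cast_nonneg _
    have hk' : (S.Q * (Nat.card ↥(W ⊓ S.H p.1) : ℝ)) = k * Nat.card W := by exact_mod_cast hk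
    rw [hk']
    split_ifs with h
    · have hk2' : (1 : ℝ) ≤ k := by exact_mod_cast Nat.pos_of_ne_zero hk0
      have := mul_le_mul_of_nonneg_right hk2' hw
      linarith
    · have hk2 : 2 ≤ k := by
        by_contra hk2
        have : k = 1 := by omega
        rw [this, one_mul] at hk
        exact h hk
      have hk2' : (2 : ℝ) ≤ k := by exact_mod_cast hk2
      have := mul_le_mul_of_nonneg_right hk2' hw
      linarith
  have h5 := Finset.sum_le_sum h4
  rw [Finset.sum_add_distrib, ← Finset.sum_filter, Finset.sum_const, Finset.sum_const,
    nsmul_eq_mul, nsmul_eq_mul, ← Finset.mul_sum] at h5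
  have h6 := mul_le_mul_of_nonneg_left h3 (Nat.cast_nonneg (α := ℝ) S.Q)
  have h7 := mul_le_mul_of_nonneg_left h6 (Nat.cast_nonneg (α := ℝ) (S.inc T).card)
  linarith

theorem card_inc_le_two_mul_core {T : Finset (AddSubgroup V)} (hT : T ⊆ S.G)
    (hTC : 10 ^ 20 * (S.G.card : ℝ) ≤ S.M * T.card) (W : AddSubgroup V)
    (hWQ : 10 ^ 5 * (S.Q : ℝ) ≤ Nat.card W) :
    ((S.inc T).card : ℝ) ≤ 2 * (S.core T W).card := by
  have h1 := S.card_not_onto_le hT (C := 10 ^ 20) (by norm_num) hTC W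
  have hw : (0 : ℝ) < Nat.card W := by exact_mod_cast Nat.card_pos
  have h2 := S.card_sparse_le hT (C := 10 ^ 20) (by norm_num) hTC
    ((S.inc T).filter (fun p => ¬ 400 ≤ (Finset.univ.filter (fun l => S.U p.1 l ∈ T)).card))
    (K := 400) (by norm_num) (by
      intro φ
      have : (((S.inc T).filter (fun p => ¬ 400 ≤
          (Finset.univ.filter (fun l => S.U p.1 l ∈ T)).card)).filter (fun p => p.1 = φ)).card ≤
          400 := by
        by_contra! hcon
        obtain ⟨p, hp⟩ := Finset.card_pos.1 (lt_trans (by norm_num) hcon)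
        rw [Finset.mem_filter, Finset.mem_filter] at hp
        obtain ⟨⟨-, hp⟩, rfl⟩ := hp
        refine absurd (hcon.le.trans ?_) (not_le.2 hp)
        refine Finset.card_le_card_of_injOn Prod.snd ?_ ?_
        · intro x hx
          rw [Finset.mem_coe, Finset.mem_filter, Finset.mem_filter, S.mem_inc] at hx
          refine Finset.mem_coe.2 (Finset.mem_filter.2 ⟨Finset.mem_univ _, ?_⟩)
          rw [← hx.2]
          exact hx.1.1
        · intro x hx y hy hxy
          rw [Finset.mem_coe, Finset.mem_filter] at hx hy
          exact Prod.ext (hx.2.trans hy.2.symm) hxy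
      exact_mod_cast this)
  set N₁ := (S.inc T).filter (fun p => ¬ S.Q * Nat.card ↥(W ⊓ S.H p.1) = Nat.card W)
  set N₂ := (S.inc T).filter
    (fun p => ¬ 400 ≤ (Finset.univ.filter (fun l => S.U p.1 l ∈ T)).card)
  have h3 : (S.inc T).card ≤ (S.core T W).card + (N₁.card + N₂.card) := by
    have : S.inc T ⊆ S.core T W ∪ (N₁ ∪ N₂) := by
      intro p hp
      by_cases h1 : S.Q * Nat.card ↥(W ⊓ S.H p.1) = Nat.card W
      · by_cases h2 : 400 ≤ (Finset.univ.filter (fun l => S.U p.1 l ∈ T)).card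
        · exact Finset.mem_union_left _ (Finset.mem_filter.2 ⟨hp, h1, h2⟩)
        · exact Finset.mem_union_right _ (Finset.mem_union_right _ (Finset.mem_filter.2 ⟨hp, h2⟩))
      · exact Finset.mem_union_right _ (Finset.mem_union_left _ (Finset.mem_filter.2 ⟨hp, h1⟩))
    refine (Finset.card_le_card this).trans ((Finset.card_union_le _ _).trans ?_)
    exact Nat.add_le_add_left (Finset.card_union_le _ _) _
  have h3' : ((S.inc T).card : ℝ) ≤ (S.core T W).card + (N₁.card + N₂.card) := by
    exact_mod_cast h3
  have hI : (0 : ℝ) ≤ (S.inc T).card := Nat.cast_nonneg _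
  have h4 : (N₁.card : ℝ) ≤ 1 / 4 * (S.inc T).card := by
    refine le_of_mul_le_mul_left (h1.trans ?_) hw
    have : (S.Q : ℝ) + 1 / 10 ^ 20 * Nat.card W ≤ 1 / 4 * Nat.card W := by linarith
    have := mul_le_mul_of_nonneg_left this hI
    linarith
  linarith

theorem sum_core (T : Finset (AddSubgroup V)) (W : AddSubgroup V) (f : Ω × ι → ℝ) :
    ∑ p ∈ S.core T W, f p =
      ∑ φ with S.Q * Nat.card ↥(W ⊓ S.H φ) = Nat.card W ∧
          400 ≤ (Finset.univ.filter (fun l => S.U φ l ∈ T)).card,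
        ∑ l with S.U φ l ∈ T, f (φ, l) := by
  rw [core, Finset.sum_filter, S.sum_inc_eq_sum_Omega, Finset.sum_filter]
  refine Finset.sum_congr rfl fun φ _ => ?_
  split_ifs with h
  · simp
  · refine Finset.sum_eq_zero fun l _ => ?_
    simp

/-- Over the core, all intersections with `W` have the same size. -/
theorem core_card_inf {T : Finset (AddSubgroup V)} {W : AddSubgroup V}
    (hlow : ∀ A ∈ T, (Nat.card W : ℝ) < 2 * (S.Q * (Nat.card ↥(W ⊓ A) : ℝ) ^ 2)) {p : Ω × ι}
    (hp : p ∈ S.core T W) : S.Q * Nat.card ↥(W ⊓ S.U p.1 p.2) ^ 2 = Nat.card W := by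
  obtain ⟨φ, l⟩ := p
  obtain ⟨hi, ho, hN⟩ := Finset.mem_filter.1 hp
  rw [S.mem_inc] at hi
  simp only at hi ho hN ⊢
  have h3 : 2 < (Finset.univ.filter (fun l => S.U φ l ∈ T)).card := by omega
  have h4 : 1 < ((Finset.univ.filter (fun l => S.U φ l ∈ T)).erase l).card := by
    have := Finset.pred_card_le_card_erase
      (s := Finset.univ.filter (fun l => S.U φ l ∈ T)) (a := l)
    omega
  obtain ⟨b, hb, c, hc, hbc⟩ := Finset.one_lt_card.1 h4
  simp only [Finset.mem_erase, Finset.mem_filter, Finset.mem_univ, true_and] at hb hc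
  have key : ∀ x y, S.U φ x ∈ T → S.U φ y ∈ T → x ≠ y →
      S.Q * (Nat.card ↥(W ⊓ S.U φ x) * Nat.card ↥(W ⊓ S.U φ y)) = Nat.card W :=
    fun x y hx hy hxy => (inf_sup_of_card (S.inf_eq φ x y hxy) (S.U_le_H φ x) (S.U_le_H φ y)
      S.Q_pos ho (hlow _ hx) (hlow _ hy)).2
  have k1 := key l b hi hb.2 hb.1.symm
  have k2 := key l c hi hc.2 hc.1.symm
  have k3 := key b c hb.2 hc.2 hbc
  have hl0 : 0 < Nat.card ↥(W ⊓ S.U φ l) := Nat.card_pos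
  have hc0 : 0 < Nat.card ↥(W ⊓ S.U φ c) := Nat.card_pos
  have e2 : Nat.card ↥(W ⊓ S.U φ l) = Nat.card ↥(W ⊓ S.U φ b) := by
    have h5 := k2.trans k3.symm
    exact Nat.eq_of_mul_eq_mul_right hc0 (Nat.eq_of_mul_eq_mul_left S.Q_pos h5)
  rw [sq]
  conv_lhs => enter [2, 2]; rw [e2]
  exact k1

theorem sum_card_cosetPairs_le {T : Finset (AddSubgroup V)} (hT : T ⊆ S.G)
    (hTC : 10 ^ 20 * (S.G.card : ℝ) ≤ S.M * T.card) (R : Finset V) :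
    (S.Q : ℝ) * ∑ p ∈ S.inc T, ((cosetPairs R (S.H p.1)).card : ℝ) ≤
      (S.inc T).card * (R.card * (S.Q + 2 * R.card)) := by
  have h1 := S.sum_card_inc_hit_le hT (C := 10 ^ 20) (by norm_num) hTC (R ×ˢ R)
    (fun p => p.1 - p.2)
  refine h1.trans (mul_le_mul_of_nonneg_left ?_ (Nat.cast_nonneg _))
  have h2 : (((R ×ˢ R).filter (fun p => p.1 - p.2 = 0)).card : ℝ) ≤ R.card := by
    norm_cast
    refine Finset.card_le_card_of_injOn Prod.fst ?_ ?_
    · intro p hp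
      exact (Finset.mem_product.1 (Finset.mem_filter.1 hp).1).1
    · intro p hp p' hp' h
      have e1 := sub_eq_zero.1 (Finset.mem_filter.1 hp).2
      have e2 := sub_eq_zero.1 (Finset.mem_filter.1 hp').2
      exact Prod.ext h (e1.symm.trans (h.trans e2))
  rw [Finset.card_product]
  push_cast
  have h3 := mul_le_mul_of_nonneg_left h2 (Nat.cast_nonneg (α := ℝ) S.Q)
  have h4 : (0 : ℝ) ≤ R.card * R.card := mul_nonneg (Nat.cast_nonneg _) (Nat.cast_nonneg _)
  linarith

theorem sum_core_heavy_le {T : Finset (AddSubgroup V)} (hT : T ⊆ S.G)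
    (hTC : 10 ^ 20 * (S.G.card : ℝ) ≤ S.M * T.card) {W : AddSubgroup V}
    (hWQ : 10 ^ 5 * (S.Q : ℝ) ≤ Nat.card W)
    (hlow : ∀ A ∈ T, (Nat.card W : ℝ) < 2 * (S.Q * (Nat.card ↥(W ⊓ A) : ℝ) ^ 2))
    (R : Finset V) (hR : 4 * 10 ^ 4 * (R.card : ℝ) ≤ Nat.card W) :
    ∑ p ∈ S.core T W, ((heavy R (S.U p.1 p.2) (Nat.card ↥(W ⊓ S.U p.1 p.2))).card : ℝ) ≤
      1 / 5 * ((S.core T W).card * R.card) := by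
  have hw : (0 : ℝ) < Nat.card W := by exact_mod_cast Nat.card_pos
  have hQ : (0 : ℝ) < S.Q := by exact_mod_cast S.Q_pos
  set h : ℝ := Real.sqrt (Nat.card W / S.Q) with hh
  have hh0 : 0 < h := Real.sqrt_pos.2 (div_pos hw hQ)
  have hhW : S.Q * h ^ 2 = Nat.card W := by
    rw [hh, Real.sq_sqrt (div_pos hw hQ).le]
    field_simp
  have hcard : ∀ p ∈ S.core T W, (Nat.card ↥(W ⊓ S.U p.1 p.2) : ℝ) = h := by
    intro p hp
    have h1 : (S.Q : ℝ) * (Nat.card ↥(W ⊓ S.U p.1 p.2) : ℝ) ^ 2 = Nat.card W := by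
      exact_mod_cast S.core_card_inf hlow hp
    rw [← hhW] at h1
    have h2 := mul_left_cancel₀ hQ.ne' h1
    exact (pow_left_inj₀ (Nat.cast_nonneg _) hh0.le two_ne_zero).1 h2
  set thick : Ω × ι → Finset V := fun p =>
    R.filter (fun x => ¬ ((cosetPart R (S.H p.1) x).card : ℝ) ≤ 1 / 400 * h ^ 2) with hthick
  set thin : Ω × ι → Finset V := fun p => (heavy R (S.U p.1 p.2) h).filter
    (fun x => ((cosetPart R (S.H p.1) x).card : ℝ) ≤ 1 / 400 * h ^ 2) with hthin
  have hsplit : ∀ p ∈ S.core T W,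
      ((heavy R (S.U p.1 p.2) (Nat.card ↥(W ⊓ S.U p.1 p.2))).card : ℝ) ≤
        (thin p).card + (thick p).card := by
    intro p hp
    rw [hcard p hp]
    norm_cast
    refine (Finset.card_le_card ?_).trans (Finset.card_union_le _ _)
    intro x hx
    have hxR := (mem_heavy.1 hx).1
    by_cases h1 : ((cosetPart R (S.H p.1) x).card : ℝ) ≤ 1 / 400 * h ^ 2
    · exact Finset.mem_union_left _ (Finset.mem_filter.2 ⟨hx, h1⟩)
    · exact Finset.mem_union_right _ (Finset.mem_filter.2 ⟨hxR, h1⟩)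
  have hthinsum : ∑ p ∈ S.core T W, ((thin p).card : ℝ) ≤
      1 / 10 * ((S.core T W).card * R.card) := by
    have e1 : ((S.core T W).card : ℝ) = ∑ p ∈ S.core T W, (1 : ℝ) := by simp
    rw [e1, S.sum_core, S.sum_core, Finset.sum_mul, Finset.mul_sum]
    refine Finset.sum_le_sum fun φ hφ => ?_
    have h1 := (Finset.mem_filter.1 hφ).2.2
    rw [Finset.sum_const, nsmul_eq_mul, mul_one]
    exact sum_card_heavy_thin_le _ R (S.U φ) (S.H φ) (S.inf_eq φ) (S.U_le_H φ) hh0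
      (by exact_mod_cast h1)
  have hthick1 : ∀ p ∈ S.core T W, 1 / 400 * h ^ 2 * ((thick p).card : ℝ) ≤
      (cosetPairs R (S.H p.1)).card := by
    intro p _
    rw [card_cosetPairs, mul_comm, ← nsmul_eq_mul, ← Finset.sum_const]
    push_cast
    calc _ ≤ ∑ x ∈ thick p, ((cosetPart R (S.H p.1) x).card : ℝ) :=
          Finset.sum_le_sum fun x hx => (not_le.1 (Finset.mem_filter.1 hx).2).le
      _ ≤ _ := Finset.sum_le_sum_of_subset_of_nonneg (Finset.filter_subset _ _)
          (fun _ _ _ => Nat.cast_nonneg _)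
  have hthick2 := Finset.sum_le_sum hthick1
  rw [← Finset.mul_sum] at hthick2
  have hthick3 : ∑ p ∈ S.core T W, ((cosetPairs R (S.H p.1)).card : ℝ) ≤
      ∑ p ∈ S.inc T, ((cosetPairs R (S.H p.1)).card : ℝ) :=
    Finset.sum_le_sum_of_subset_of_nonneg (Finset.filter_subset _ _)
      (fun _ _ _ => Nat.cast_nonneg _)
  have hthick4 := (mul_le_mul_of_nonneg_left (hthick2.trans hthick3) hQ.le).trans
    (S.sum_card_cosetPairs_le hT hTC R)
  have hcore := S.card_inc_le_two_mul_core hT hTC W hWQ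
  have hR0 : (0 : ℝ) ≤ R.card := Nat.cast_nonneg _
  have hsm : (R.card : ℝ) * (S.Q + 2 * R.card) ≤ R.card * (1 / 10 ^ 4 * Nat.card W) :=
    mul_le_mul_of_nonneg_left (by linarith) hR0
  have hthick5 : ∑ p ∈ S.core T W, ((thick p).card : ℝ) ≤
      1 / 10 * ((S.core T W).card * R.card) := by
    have h1 : ((S.inc T).card : ℝ) * (R.card * (S.Q + 2 * R.card)) ≤
        2 * (S.core T W).card * (R.card * (1 / 10 ^ 4 * Nat.card W)) :=
      mul_le_mul hcore hsm (mul_nonneg hR0 (by linarith))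
        (mul_nonneg (by norm_num) (Nat.cast_nonneg _))
    have h2 := hthick4.trans h1
    have h3 : (S.Q : ℝ) * (1 / 400 * h ^ 2 * ∑ p ∈ S.core T W, ((thick p).card : ℝ)) =
        1 / 400 * Nat.card W * ∑ p ∈ S.core T W, ((thick p).card : ℝ) := by
      rw [← hhW]; ring
    rw [h3] at h2
    have h4 : (0 : ℝ) ≤ (S.core T W).card * R.card := mul_nonneg (Nat.cast_nonneg _) hR0
    have h5 := mul_nonneg h4 hw.le
    refine le_of_mul_le_mul_left ?_ (by positivity : (0 : ℝ) < 1 / 400 * Nat.card W)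
    linarith
  have h6 := Finset.sum_le_sum hsplit
  rw [Finset.sum_add_distrib] at h6
  linarith

end SpreadSystem

section Exchange

open scoped Classical

variable {V : Type*} [AddCommGroup V] [Fintype V]

/-- The points of `X` lying in `W + U`. -/
noncomputable def sumPart (X : Finset V) (W U : AddSubgroup V) : Finset V :=
  X.filter (fun x => ∃ w ∈ W, x - w ∈ U)

theorem card_sdiff_add_card_sdiff_lt {E : Finset V} {W U : AddSubgroup V} {Q : ℝ}
    (hWU : Q * (Nat.card ↥(W ⊓ U) : ℝ) ^ 2 = Nat.card W)
    (hsm : ((thicken E U).card : ℝ) ^ 2 < Q * (Nat.card U : ℝ) ^ 2 * E.card) :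
    ((W.elems \ E).card : ℝ) + (E \ W.elems).card <
      2 * ((sumPart (E \ W.elems) W U).card +
        (heavy (W.elems \ E) U (Nat.card ↥(W ⊓ U))).card +
        (heavy (E \ W.elems) U (Nat.card ↥(W ⊓ U))).card) := by
  set h : ℝ := (Nat.card ↥(W ⊓ U) : ℝ) with hh
  have hh0 : 0 < h := by rw [hh]; exact_mod_cast Nat.card_pos
  set R₁ := W.elems \ E with hR₁
  set R₂ := E \ W.elems with hR₂
  set Y₁ := W.elems.filter (fun x => x ∈ thicken E U) with hY₁
  set Y₂ := R₂.filter (fun x => x ∉ sumPart R₂ W U ∧ x ∉ heavy R₂ U h) with hY₂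
  have hnot : ∀ y ∈ Y₂, ∀ w ∈ W, y - w ∉ U := by
    intro y hy w hw hyw
    obtain ⟨hy1, hy2, -⟩ := Finset.mem_filter.1 hy
    exact hy2 (Finset.mem_filter.2 ⟨hy1, w, hw, hyw⟩)
  have hY₁W : ∀ y ∈ Y₁, y ∈ W := fun y hy => AddSubgroup.mem_elems.1 (Finset.mem_filter.1 hy).1
  have hdisj : Disjoint Y₁ Y₂ := by
    rw [Finset.disjoint_left]
    intro y h1 h2
    exact hnot y h2 y (hY₁W y h1) (by rw [sub_self]; exact U.zero_mem)
  have hsub : Y₁ ∪ Y₂ ⊆ thicken E U := by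
    intro y hy
    rcases Finset.mem_union.1 hy with hy | hy
    · exact (Finset.mem_filter.1 hy).2
    · exact subset_thicken E U (Finset.mem_sdiff.1 (Finset.mem_filter.1 hy).1).1
  have hfib : ∀ y ∈ Y₁ ∪ Y₂, ((cosetPart (Y₁ ∪ Y₂) U y).card : ℝ) ≤ h := by
    intro y hy
    rcases Finset.mem_union.1 hy with hy | hy
    · rw [hh, ← cosetPart_elems (U := U) (hY₁W y hy)]
      norm_cast
      refine Finset.card_le_card fun z hz => ?_
      obtain ⟨hz1, hz2⟩ := mem_cosetPart.1 hz
      refine mem_cosetPart.2 ⟨?_, hz2⟩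
      rcases Finset.mem_union.1 hz1 with hz1 | hz1
      · exact AddSubgroup.mem_elems.2 (hY₁W z hz1)
      · exact absurd hz2 (hnot z hz1 y (hY₁W y hy))
    · obtain ⟨hy1, -, hy3⟩ := Finset.mem_filter.1 hy
      have h1 : ((cosetPart R₂ U y).card : ℝ) < h := by
        by_contra! hcon
        exact hy3 (mem_heavy.2 ⟨hy1, hcon⟩)
      refine le_trans ?_ h1.le
      norm_cast
      refine Finset.card_le_card fun z hz => ?_
      obtain ⟨hz1, hz2⟩ := mem_cosetPart.1 hz
      refine mem_cosetPart.2 ⟨?_, hz2⟩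
      rcases Finset.mem_union.1 hz1 with hz1 | hz1
      · refine absurd ?_ (hnot y hy z (hY₁W z hz1))
        rw [← neg_sub]
        exact U.neg_mem hz2
      · exact (Finset.mem_filter.1 hz1).1
  have hmain := card_mul_card_le_of_fiber hsub hh0.le hfib
  have hcardY : ((Y₁ ∪ Y₂).card : ℝ) = Y₁.card + Y₂.card := by
    exact_mod_cast Finset.card_union_of_disjoint hdisj
  have hw1 : (Nat.card W : ℝ) ≤ Y₁.card + (heavy R₁ U h).card := by
    rw [← AddSubgroup.card_elems]
    norm_cast
    refine (Finset.card_le_card ?_).trans (Finset.card_union_le _ _)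
    intro x hx
    by_cases hxE : x ∈ thicken E U
    · exact Finset.mem_union_left _ (Finset.mem_filter.2 ⟨hx, hxE⟩)
    · refine Finset.mem_union_right _ (mem_heavy.2 ⟨Finset.mem_sdiff.2
        ⟨hx, fun hx' => hxE (subset_thicken E U hx')⟩, ?_⟩)
      rw [hh, ← cosetPart_elems (U := U) (AddSubgroup.mem_elems.1 hx)]
      norm_cast
      refine Finset.card_le_card fun z hz => ?_
      obtain ⟨hz1, hz2⟩ := mem_cosetPart.1 hz
      refine mem_cosetPart.2 ⟨Finset.mem_sdiff.2 ⟨hz1, fun hzE => hxE ?_⟩, hz2⟩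
      refine mem_thicken.2 ⟨z, hzE, ?_⟩
      rw [← neg_sub]
      exact U.neg_mem hz2
  have hr2 : (R₂.card : ℝ) ≤ Y₂.card + ((sumPart R₂ W U).card + (heavy R₂ U h).card) := by
    norm_cast
    have : R₂ ⊆ Y₂ ∪ (sumPart R₂ W U ∪ heavy R₂ U h) := by
      intro x hx
      by_cases h1 : x ∈ sumPart R₂ W U
      · exact Finset.mem_union_right _ (Finset.mem_union_left _ h1)
      · by_cases h2 : x ∈ heavy R₂ U h
        · exact Finset.mem_union_right _ (Finset.mem_union_right _ h2)
        · exact Finset.mem_union_left _ (Finset.mem_filter.2 ⟨hx, h1, h2⟩)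
    refine (Finset.card_le_card this).trans ((Finset.card_union_le _ _).trans ?_)
    exact Nat.add_le_add_left (Finset.card_union_le _ _) _
  have hbal : (E.card : ℝ) + R₁.card = Nat.card W + R₂.card := by
    rw [← AddSubgroup.card_elems]
    norm_cast
    have h1 : R₂.card + (E ∩ W.elems).card = E.card :=
      Finset.card_sdiff_add_card_inter E W.elems
    have h2 : R₁.card + (E ∩ W.elems).card = W.elems.card := by
      rw [Finset.inter_comm]
      exact Finset.card_sdiff_add_card_inter W.elems E
    omega
  have hU0 : (0 : ℝ) < Nat.card U := by exact_mod_cast Nat.card_pos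
  have hsq : ((Y₁ ∪ Y₂).card : ℝ) ^ 2 < Nat.card W * E.card := by
    have h0 : (0 : ℝ) ≤ Nat.card U * (Y₁ ∪ Y₂).card := mul_nonneg hU0.le (Nat.cast_nonneg _)
    have h1 := pow_le_pow_left₀ h0 hmain 2
    have h2 := mul_lt_mul_of_pos_left hsm (pow_pos hh0 2)
    refine lt_of_mul_lt_mul_left ?_ (pow_pos hU0 2).le
    rw [← hWU]
    calc _ = (Nat.card U * ((Y₁ ∪ Y₂).card : ℝ)) ^ 2 := by ring
      _ ≤ _ := h1
      _ = h ^ 2 * ((thicken E U).card : ℝ) ^ 2 := by ring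
      _ < _ := h2
      _ = _ := by ring
  have hlin : ∀ y w e : ℝ, 0 ≤ w → 0 ≤ e → y ^ 2 < w * e → 2 * y < e + w := by
    intro y w e hw he hy
    by_contra! hcon
    have := pow_le_pow_left₀ (add_nonneg he hw) hcon 2
    nlinarith [sq_nonneg (e - w)]
  have h9 := hlin _ _ _ (Nat.cast_nonneg _) (Nat.cast_nonneg _) hsq
  linarith

end Exchange

namespace SpreadSystem

open scoped Classical

variable {V Ω ι : Type*} [AddCommGroup V] [Fintype V] [Fintype Ω] [Fintype ι]
variable (S : SpreadSystem V Ω ι)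

theorem sum_core_sumPart_le {T : Finset (AddSubgroup V)} {W : AddSubgroup V}
    (hlow : ∀ A ∈ T, (Nat.card W : ℝ) < 2 * (S.Q * (Nat.card ↥(W ⊓ A) : ℝ) ^ 2))
    (R : Finset V) (hR : ∀ x ∈ R, x ∉ W) :
    ∑ p ∈ S.core T W, ((sumPart R W (S.U p.1 p.2)).card : ℝ) ≤
      1 / 400 * ((S.core T W).card * R.card) := by
  have e1 : ((S.core T W).card : ℝ) = ∑ p ∈ S.core T W, (1 : ℝ) := by simp
  rw [e1, S.sum_core, S.sum_core, Finset.sum_mul, Finset.mul_sum]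
  refine Finset.sum_le_sum fun φ hφ => ?_
  obtain ⟨ho, hN⟩ := (Finset.mem_filter.1 hφ).2
  rw [Finset.sum_const, nsmul_eq_mul, mul_one]
  have h1 : ∑ l with S.U φ l ∈ T, (sumPart R W (S.U φ l)).card ≤ R.card := by
    rw [← Finset.card_biUnion]
    · refine Finset.card_le_card fun x hx => ?_
      obtain ⟨l, -, hl⟩ := Finset.mem_biUnion.1 hx
      exact (Finset.mem_filter.1 hl).1
    · intro l hl l' hl' hll'
      change Disjoint _ _
      rw [Finset.disjoint_left]
      intro x hx hx'
      obtain ⟨hxR, w, hw, hxw⟩ := Finset.mem_filter.1 hx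
      obtain ⟨-, w', hw', hxw'⟩ := Finset.mem_filter.1 hx'
      have hT1 := (Finset.mem_filter.1 hl).2
      have hT2 := (Finset.mem_filter.1 hl').2
      have h2 := (inf_sup_of_card (S.inf_eq φ l l' hll') (S.U_le_H φ l) (S.U_le_H φ l')
        S.Q_pos ho (hlow _ hT1) (hlow _ hT2)).1
      have h3 : w' - w ∈ W ⊓ S.H φ := by
        refine ⟨W.sub_mem hw' hw, ?_⟩
        rw [show w' - w = (x - w) - (x - w') by abel]
        exact (S.H φ).sub_mem (S.U_le_H φ l hxw) (S.U_le_H φ l' hxw')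
      rw [← h2] at h3
      obtain ⟨u, hu, u', hu', huu⟩ := AddSubgroup.mem_sup.1 h3
      have h4 : (x - w) - u ∈ S.U φ l ⊓ S.U φ l' := by
        refine ⟨(S.U φ l).sub_mem hxw hu.2, ?_⟩
        rw [show x - w - u = (x - w') + u' by
          rw [show x - w - u = (x - w') + (w' - w) - u by abel, ← huu]; abel]
        exact (S.U φ l').add_mem hxw' hu'.2
      rw [S.inf_eq φ l l' hll', AddSubgroup.mem_bot, sub_eq_zero] at h4
      refine hR x hxR ?_
      rw [show x = w + (x - w) by abel, h4]
      exact W.add_mem hw hu.1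
  have h1' : ∑ l with S.U φ l ∈ T, ((sumPart R W (S.U φ l)).card : ℝ) ≤ R.card := by
    exact_mod_cast h1
  have h2 : (400 : ℝ) ≤ (Finset.univ.filter (fun l => S.U φ l ∈ T)).card := by exact_mod_cast hN
  have h3 := mul_le_mul_of_nonneg_right h2 (Nat.cast_nonneg (α := ℝ) R.card)
  refine h1'.trans ?_
  linarith

/-- Not too many members of a spread system can have a small quotient image of a given set. -/
theorem card_mul_card_lt (E : Finset V) (hE : 0 < E.card) {T : Finset (AddSubgroup V)}
    (hT : T ⊆ S.G) (hne : T.Nonempty) {n : ℝ} (hn : 10 ^ 70 ≤ n)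
    (hsm : ∀ A ∈ T, ((thicken E A).card : ℝ) ^ 2 < S.Q * S.M ^ 2 * E.card)
    (hnE : ∀ A ∈ T, n * (thicken E A).card ≤ S.M * E.card) :
    S.M * (T.card : ℝ) < 10 ^ 20 * (S.G.card : ℝ) := by
  by_contra! hTC
  obtain ⟨W, a, hEW, hW1, hW2, hEQ⟩ := S.exists_subgroup E hE hT hne hTC hn
    (fun A hA => (hsm A hA).le) hnE
  set X := E.image (fun x => x - a) with hX
  have hXE : X.card = E.card := Finset.card_image_of_injective _ (sub_left_injective)
  have hthick : ∀ A, (thicken X A).card = (thicken E A).card :=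
    fun A => card_thicken_image_sub E A a
  have he : (0 : ℝ) < E.card := by exact_mod_cast hE
  have hQ : (0 : ℝ) < S.Q := by exact_mod_cast S.Q_pos
  have hM : (0 : ℝ) < S.M := by exact_mod_cast S.M_pos
  have hlow : ∀ A ∈ T, (Nat.card W : ℝ) < 2 * (S.Q * (Nat.card ↥(W ⊓ A) : ℝ) ^ 2) := by
    intro A hA
    have hfib : ∀ y ∈ X.filter (fun v => v ∈ W),
        ((cosetPart (X.filter (fun v => v ∈ W)) A y).card : ℝ) ≤ Nat.card ↥(W ⊓ A) := by
      intro y hy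
      rw [← cosetPart_elems (U := A) (Finset.mem_filter.1 hy).2]
      norm_cast
      refine Finset.card_le_card fun z hz => ?_
      obtain ⟨hz1, hz2⟩ := mem_cosetPart.1 hz
      exact mem_cosetPart.2 ⟨AddSubgroup.mem_elems.2 (Finset.mem_filter.1 hz1).2, hz2⟩
    have h1 := card_mul_card_le_of_fiber
      ((Finset.filter_subset _ _).trans (subset_thicken X A)) (Nat.cast_nonneg _) hfib
    rw [hthick, S.card_mem A (hT hA)] at h1
    have h2 := hsm A hA
    have h3 := (mul_le_mul_of_nonneg_left hEW hM.le).trans h1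
    have h4 := pow_le_pow_left₀ (mul_nonneg hM.le (mul_nonneg (by norm_num) he.le)) h3 2
    have hh : (0 : ℝ) < Nat.card ↥(W ⊓ A) := by exact_mod_cast Nat.card_pos
    have h5 := mul_lt_mul_of_pos_left h2 (pow_pos hh 2)
    have h6 : (S.M : ℝ) ^ 2 * E.card * ((1 - 5 / 10 ^ 6) ^ 2 * E.card) <
        (S.M : ℝ) ^ 2 * E.card * (S.Q * (Nat.card ↥(W ⊓ A) : ℝ) ^ 2) := by
      calc _ = (S.M * ((1 - 5 / 10 ^ 6) * (E.card : ℝ))) ^ 2 := by ring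
        _ ≤ _ := h4
        _ = (Nat.card ↥(W ⊓ A) : ℝ) ^ 2 * ((thicken E A).card : ℝ) ^ 2 := by ring
        _ < _ := h5
        _ = _ := by ring
    have h7 := lt_of_mul_lt_mul_left h6 (mul_nonneg (pow_nonneg hM.le 2) he.le)
    linarith
  have hWQ : 10 ^ 5 * (S.Q : ℝ) ≤ Nat.card W := by linarith
  set R₁ := W.elems \ X with hR₁
  set R₂ := X \ W.elems with hR₂
  have hinter : X.filter (fun v => v ∈ W) = X ∩ W.elems := by
    ext v
    rw [Finset.mem_filter, Finset.mem_inter, AddSubgroup.mem_elems]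
  rw [hinter] at hEW
  have hc2 : (R₂.card : ℝ) + (X ∩ W.elems).card = E.card := by
    rw [← hXE]; exact_mod_cast Finset.card_sdiff_add_card_inter X W.elems
  have hc1 : (R₁.card : ℝ) + (X ∩ W.elems).card = Nat.card W := by
    rw [← AddSubgroup.card_elems, Finset.inter_comm]
    exact_mod_cast Finset.card_sdiff_add_card_inter W.elems X
  have hb1 := S.sum_core_heavy_le hT hTC hWQ hlow R₁ (by linarith)
  have hb2 := S.sum_core_heavy_le hT hTC hWQ hlow R₂ (by linarith)
  have hb3 := S.sum_core_sumPart_le hlow R₂ (fun x hx hxW =>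
    (Finset.mem_sdiff.1 hx).2 (AddSubgroup.mem_elems.2 hxW))
  have hcore0 : (0 : ℝ) < (S.core T W).card := by
    have h1 := S.card_inc_le_two_mul_core hT hTC W hWQ
    have h2 : (0 : ℝ) < (S.inc T).card := by
      rw [S.card_inc hT]
      have := S.c_pos
      have := Finset.card_pos.2 hne
      have h3 : (0 : ℝ) < S.c := by exact_mod_cast S.c_pos
      have h4 : (0 : ℝ) < T.card := by exact_mod_cast Finset.card_pos.2 hne
      exact mul_pos (mul_pos hM h3) h4
    linarith
  have hpt : ∀ p ∈ S.core T W, (R₁.card : ℝ) + R₂.card <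
      2 * ((sumPart R₂ W (S.U p.1 p.2)).card +
        (heavy R₁ (S.U p.1 p.2) (Nat.card ↥(W ⊓ S.U p.1 p.2))).card +
        (heavy R₂ (S.U p.1 p.2) (Nat.card ↥(W ⊓ S.U p.1 p.2))).card) := by
    intro p hp
    refine card_sdiff_add_card_sdiff_lt (Q := S.Q) ?_ ?_
    · exact_mod_cast S.core_card_inf hlow hp
    · rw [S.card_U, hthick, hXE]
      exact hsm _ (S.mem_inc.1 (Finset.mem_filter.1 hp).1)
  have hcne : (S.core T W).Nonempty := Finset.card_pos.1 (by exact_mod_cast hcore0)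
  have hfin := Finset.sum_lt_sum_of_nonempty hcne hpt
  rw [Finset.sum_const, nsmul_eq_mul, ← Finset.mul_sum, Finset.sum_add_distrib,
    Finset.sum_add_distrib] at hfin
  have hr1 := mul_nonneg hcore0.le (Nat.cast_nonneg (α := ℝ) R₁.card)
  have hr2 := mul_nonneg hcore0.le (Nat.cast_nonneg (α := ℝ) R₂.card)
  linarith

end SpreadSystem

section Transitivity

open scoped Classical

variable {F X : Type*} [Field F] [AddCommGroup X] [Module F X] [FiniteDimensional F X]

theorem LinearIndependent.exists_linearEquiv {κ : Type*} {u u' : κ → X}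
    (hu : LinearIndependent F u) (hu' : LinearIndependent F u') :
    ∃ g : X ≃ₗ[F] X, ∀ i, g (u i) = u' i := by
  obtain ⟨g, hg⟩ := Submodule.exists_linearEquiv_restrict_eq
    (hu.linearCombinationEquiv.symm.trans hu'.linearCombinationEquiv)
  refine ⟨g, fun i => ?_⟩
  have h := hg ⟨u i, Submodule.subset_span ⟨i, rfl⟩⟩
  rw [← h, LinearEquiv.trans_apply]
  have h2 : hu.linearCombinationEquiv.symm ⟨u i, Submodule.subset_span ⟨i, rfl⟩⟩ =
      Finsupp.single i 1 := by
    rw [LinearEquiv.symm_apply_eq]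
    ext
    simp
  rw [h2]
  simp

theorem Submodule.exists_linearEquiv_map_eq {A A' : Submodule F X}
    (h : Module.finrank F A = Module.finrank F A') :
    ∃ g : X ≃ₗ[F] X, A.map (g : X →ₗ[F] X) = A' := by
  obtain ⟨g, hg⟩ := Submodule.exists_linearEquiv_restrict_eq (LinearEquiv.ofFinrankEq A A' h)
  refine ⟨g, ?_⟩
  refine Submodule.eq_of_le_of_finrank_eq ?_ ?_
  · rintro _ ⟨x, hx, rfl⟩
    have := hg ⟨x, hx⟩
    change g x ∈ A'
    rw [← this]
    exact Submodule.coe_mem _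
  · rw [← h]
    exact LinearEquiv.finrank_map_eq g A

theorem Submodule.exists_linearEquiv_map_eq_self {A : Submodule F X} {v v' : X} (hv : v ∉ A)
    (hv' : v' ∉ A) : ∃ g : X ≃ₗ[F] X, A.map (g : X →ₗ[F] X) = A ∧ g v = v' := by
  set b := Module.finBasis F A
  have hli : LinearIndependent F (fun i => (b i : X)) :=
    b.linearIndependent.map' A.subtype (Submodule.ker_subtype A)
  have hspan : Submodule.span F (Set.range (fun i => (b i : X))) = A := by
    have := congrArg (Submodule.map A.subtype) b.span_eq
    rw [Submodule.map_span, Submodule.map_top, Submodule.range_subtype, ← Set.range_comp] at this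
    exact this
  obtain ⟨g, hg⟩ := (linearIndependent_option' (v := fun i => (b i : X)) (x := v) |>.2
    ⟨hli, by rwa [hspan]⟩).exists_linearEquiv (linearIndependent_option'
    (v := fun i => (b i : X)) (x := v') |>.2 ⟨hli, by rwa [hspan]⟩)
  refine ⟨g, ?_, hg none⟩
  conv_lhs => rw [← hspan]
  rw [Submodule.map_span, ← Set.range_comp]
  conv_rhs => rw [← hspan]
  congr 2
  ext i
  exact hg (some i)

end Transitivity

section Embeddings

open scoped Classical

variable {F P X : Type*} [Field F] [AddCommGroup P] [Module F P] [AddCommGroup X] [Module F X]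

/-- The injective linear maps from `P` to `X`. -/
abbrev LinearEmb (F P X : Type*) [Field F] [AddCommGroup P] [Module F P] [AddCommGroup X]
    [Module F X] := {f : P →ₗ[F] X // Function.Injective f}

/-- The action of linear automorphisms on injective linear maps. -/
def LinearEmb.congr (h : P ≃ₗ[F] P) (g : X ≃ₗ[F] X) : LinearEmb F P X ≃ LinearEmb F P X where
  toFun f := ⟨(g : X →ₗ[F] X) ∘ₗ f.1 ∘ₗ (h.symm : P →ₗ[F] P),
    g.injective.comp (f.2.comp h.symm.injective)⟩
  invFun f := ⟨(g.symm : X →ₗ[F] X) ∘ₗ f.1 ∘ₗ (h : P →ₗ[F] P),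
    g.symm.injective.comp (f.2.comp h.injective)⟩
  left_inv f := by
    refine Subtype.ext (LinearMap.ext fun x => ?_)
    simp
  right_inv f := by
    refine Subtype.ext (LinearMap.ext fun x => ?_)
    simp

theorem LinearEmb.map_congr (h : P ≃ₗ[F] P) (g : X ≃ₗ[F] X) (f : LinearEmb F P X)
    (D : Submodule F P) : (D.map (h : P →ₗ[F] P)).map (LinearEmb.congr h g f).1 =
      (D.map f.1).map (g : X →ₗ[F] X) := by
  rw [← Submodule.map_comp, ← Submodule.map_comp]
  congr 1
  ext x
  simp [LinearEmb.congr]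

variable [Fintype F] [Fintype P] [Fintype X]

noncomputable instance : Fintype (LinearEmb F P X) :=
  @Fintype.ofFinite _ (@Subtype.finite _ (Finite.of_injective
    (fun f : P →ₗ[F] X => (f : P → X)) DFunLike.coe_injective) _)

theorem card_linearEmb_map_eq {D D' : Submodule F P} {A A' : Submodule F X}
    (hD : Module.finrank F D = Module.finrank F D')
    (hA : Module.finrank F A = Module.finrank F A') :
    (Finset.univ.filter (fun f : LinearEmb F P X => D.map f.1 = A)).card =
      (Finset.univ.filter (fun f : LinearEmb F P X => D'.map f.1 = A')).card := by
  obtain ⟨h, hh⟩ := Submodule.exists_linearEquiv_map_eq hD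
  obtain ⟨g, hg⟩ := Submodule.exists_linearEquiv_map_eq hA
  refine Finset.card_equiv (LinearEmb.congr h g) fun f => ?_
  simp only [Finset.mem_filter, Finset.mem_univ, true_and]
  rw [← hh, LinearEmb.map_congr, ← hg]
  exact ((Submodule.map_injective_of_injective g.injective).eq_iff).symm

theorem card_linearEmb_map_eq_mem {D : Submodule F P} {A : Submodule F X} {v v' : X}
    (hv : v ∉ A) (hv' : v' ∉ A) :
    (Finset.univ.filter
      (fun f : LinearEmb F P X => D.map f.1 = A ∧ v ∈ LinearMap.range f.1)).card =
      (Finset.univ.filter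
        (fun f : LinearEmb F P X => D.map f.1 = A ∧ v' ∈ LinearMap.range f.1)).card := by
  obtain ⟨g, hg, hgv⟩ := Submodule.exists_linearEquiv_map_eq_self hv hv'
  refine Finset.card_equiv (LinearEmb.congr (LinearEquiv.refl F P) g) fun f => ?_
  simp only [Finset.mem_filter, Finset.mem_univ, true_and]
  have h1 := LinearEmb.map_congr (LinearEquiv.refl F P) g f D
  have h2 := LinearEmb.map_congr (LinearEquiv.refl F P) g f ⊤
  simp only [LinearEquiv.refl_toLinearMap, Submodule.map_id, Submodule.map_top,
    LinearMap.range_id] at h1 h2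
  rw [h1, h2]
  conv_rhs => rw [← hg, ← hgv]
  rw [(Submodule.map_injective_of_injective g.injective).eq_iff]
  refine and_congr_right fun _ => ?_
  exact (Function.Injective.mem_set_image g.injective (s := (LinearMap.range f.1 : Set X))).symm

theorem card_linearEmb_hit_mul {D : Submodule F P} {A : Submodule F X} {v : X} (hv : v ∉ A) :
    (Finset.univ.filter
      (fun f : LinearEmb F P X => D.map f.1 = A ∧ v ∈ LinearMap.range f.1)).card *
        (Nat.card X - Nat.card A) =
      (Finset.univ.filter (fun f : LinearEmb F P X => D.map f.1 = A)).card *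
        (Nat.card P - Nat.card A) := by
  have hcompl : (Finset.univ.filter (fun x : X => x ∉ A)).card = Nat.card X - Nat.card A := by
    have h1 := Finset.card_filter_add_card_filter_not (s := (Finset.univ : Finset X))
      (fun x => x ∈ A)
    have h2 : (Finset.univ.filter (fun x : X => x ∈ A)).card = Nat.card A := by
      rw [Nat.card_eq_fintype_card, Fintype.card_subtype]
    rw [Finset.card_univ, ← Nat.card_eq_fintype_card] at h1
    omega
  have h1 : ∑ x : X with x ∉ A, (Finset.univ.filter
      (fun f : LinearEmb F P X => D.map f.1 = A ∧ x ∈ LinearMap.range f.1)).card =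
      (Finset.univ.filter
        (fun f : LinearEmb F P X => D.map f.1 = A ∧ v ∈ LinearMap.range f.1)).card *
        (Nat.card X - Nat.card A) := by
    rw [Finset.sum_congr rfl fun x hx =>
      card_linearEmb_map_eq_mem (Finset.mem_filter.1 hx).2 hv, Finset.sum_const, hcompl,
      smul_eq_mul, mul_comm]
  rw [← h1]
  simp_rw [Finset.card_filter, Finset.sum_filter]
  have h2 : ∀ x : X, (if x ∉ A then ∑ f : LinearEmb F P X,
      (if D.map f.1 = A ∧ x ∈ LinearMap.range f.1 then 1 else 0) else 0) =
      ∑ f : LinearEmb F P X, if D.map f.1 = A then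
        (if x ∈ LinearMap.range f.1 ∧ x ∉ A then 1 else 0) else 0 := by
    intro x
    split_ifs with h
    · simp [h]
    · refine Finset.sum_congr rfl fun f _ => ?_
      split_ifs <;> simp_all
  rw [Finset.sum_congr rfl fun x _ => h2 x, Finset.sum_comm, Finset.sum_mul]
  refine Finset.sum_congr rfl fun f _ => ?_
  split_ifs with h
  · rw [one_mul, ← Finset.card_filter]
    have h3 : A ≤ LinearMap.range f.1 := by rw [← h]; exact LinearMap.map_le_range
    have h4 : Nat.card (LinearMap.range f.1) = Nat.card P :=
      (Nat.card_congr (LinearEquiv.ofInjective f.1 f.2).toEquiv).symm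
    have h5 := Finset.card_filter_add_card_filter_not
      (s := (Finset.univ.filter (fun x : X => x ∈ LinearMap.range f.1))) (fun x => x ∈ A)
    rw [Finset.filter_filter, Finset.filter_filter] at h5
    have h6 : (Finset.univ.filter (fun x : X => x ∈ LinearMap.range f.1 ∧ x ∈ A)).card =
        Nat.card A := by
      rw [Nat.card_eq_fintype_card, Fintype.card_subtype]
      congr 1
      ext x
      simp only [Finset.mem_filter, Finset.mem_univ, true_and]
      exact ⟨fun hx => hx.2, fun hx => ⟨h3 hx, hx⟩⟩
    have h7 : (Finset.univ.filter (fun x : X => x ∈ LinearMap.range f.1)).card =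
        Nat.card P := by
      rw [← h4, Nat.card_eq_fintype_card, Fintype.card_subtype]
    omega
  · simp

theorem card_point_mul {m : ℕ} {v : X} (hv : v ≠ 0) :
    (Finset.univ.filter (fun A : Submodule F X => Module.finrank F A = m ∧ v ∈ A)).card *
        (Nat.card X - 1) =
      (Finset.univ.filter (fun A : Submodule F X => Module.finrank F A = m)).card *
        (Fintype.card F ^ m - 1) := by
  have htr : ∀ x : X, x ≠ 0 →
      (Finset.univ.filter (fun A : Submodule F X => Module.finrank F A = m ∧ x ∈ A)).card =
      (Finset.univ.filter (fun A : Submodule F X => Module.finrank F A = m ∧ v ∈ A)).card := by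
    intro x hx
    obtain ⟨g, -, hg⟩ := Submodule.exists_linearEquiv_map_eq_self (F := F) (A := ⊥)
      (by simpa using hx) (v' := v) (by simpa using hv)
    refine Finset.card_equiv (Submodule.orderIsoMapComap g).toEquiv fun A => ?_
    simp only [Finset.mem_filter, Finset.mem_univ, true_and]
    have h1 : (Submodule.orderIsoMapComap g).toEquiv A = A.map (g : X →ₗ[F] X) := rfl
    rw [h1, ← hg, LinearEquiv.finrank_map_eq]
    refine and_congr_right fun _ => ?_
    exact (Function.Injective.mem_set_image g.injective (s := (A : Set X))).symm
  have hcompl : (Finset.univ.filter (fun x : X => x ≠ 0)).card = Nat.card X - 1 := by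
    rw [Finset.filter_ne', Finset.card_erase_of_mem (Finset.mem_univ _), Finset.card_univ,
      Nat.card_eq_fintype_card]
  have h1 : ∑ x : X with x ≠ 0, (Finset.univ.filter
      (fun A : Submodule F X => Module.finrank F A = m ∧ x ∈ A)).card =
      (Finset.univ.filter (fun A : Submodule F X => Module.finrank F A = m ∧ v ∈ A)).card *
        (Nat.card X - 1) := by
    rw [Finset.sum_congr rfl fun x hx => htr x (Finset.mem_filter.1 hx).2, Finset.sum_const,
      hcompl, smul_eq_mul, mul_comm]
  rw [← h1]
  simp_rw [Finset.card_filter, Finset.sum_filter]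
  have h2 : ∀ x : X, (if x ≠ 0 then ∑ A : Submodule F X,
      (if Module.finrank F A = m ∧ x ∈ A then 1 else 0) else 0) =
      ∑ A : Submodule F X, if Module.finrank F A = m then
        (if x ∈ A ∧ x ≠ 0 then 1 else 0) else 0 := by
    intro x
    by_cases h : x = 0
    · simp [h]
    · rw [if_pos h]
      refine Finset.sum_congr rfl fun A _ => ?_
      simp only [h, ne_eq, not_false_eq_true, and_true, ite_and]
  rw [Finset.sum_congr rfl fun x _ => h2 x, Finset.sum_comm, Finset.sum_mul]
  refine Finset.sum_congr rfl fun A _ => ?_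
  split_ifs with h
  · rw [one_mul, ← Finset.card_filter]
    have h3 : (Finset.univ.filter (fun x : X => x ∈ A ∧ x ≠ 0)) =
        (Finset.univ.filter (fun x : X => x ∈ A)).erase 0 := by
      ext x
      simp [and_comm]
    rw [h3, Finset.card_erase_of_mem (by simp), ← Fintype.card_subtype,
      ← Nat.card_eq_fintype_card, Module.natCard_eq_pow_finrank (K := F), h,
      Nat.card_eq_fintype_card]
  · simp

end Embeddings

section System

open scoped Classical

variable {F L X : Type*} [Field F] [Fintype F] [Field L] [Fintype L] [Algebra F L]
  [AddCommGroup X] [Module F X] [Fintype X]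

/-- The subspaces of dimension `m`. -/
noncomputable def grassmannian (F X : Type*) [Field F] [Fintype F] [AddCommGroup X] [Module F X]
    [Fintype X] (m : ℕ) : Finset (Submodule F X) :=
  Finset.univ.filter (fun A => Module.finrank F A = m)

theorem mem_grassmannian {m : ℕ} {A : Submodule F X} :
    A ∈ grassmannian F X m ↔ Module.finrank F A = m := by
  simp [grassmannian]

/-- The line `y = l x` of the plane `L × L`. -/
def spreadLine (F : Type*) {L : Type*} [Field F] [Field L] [Algebra F L] (l : L) :
    Submodule F (L × L) :=
  (LinearMap.mulLeft F l).graph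

theorem mem_spreadLine {l : L} {p : L × L} : p ∈ spreadLine F l ↔ p.2 = l * p.1 := by
  simp [spreadLine, LinearMap.mem_graph_iff]

theorem finrank_spreadLine (l : L) :
    Module.finrank F (spreadLine F l) = Module.finrank F L := by
  rw [spreadLine, LinearMap.graph_eq_range_prod]
  exact LinearMap.finrank_range_of_inj (fun x y h => congrArg Prod.fst h)

theorem spreadLine_inf {l l' : L} (h : l ≠ l') :
    spreadLine F l ⊓ spreadLine F l' = ⊥ := by
  rw [eq_bot_iff]
  rintro ⟨x, y⟩ ⟨h1, h2⟩
  rw [SetLike.mem_coe, mem_spreadLine] at h1 h2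
  simp only at h1 h2
  have h3 : (l - l') * x = 0 := by rw [sub_mul, ← h1, ← h2, sub_self]
  have h4 : x = 0 := (mul_eq_zero.1 h3).resolve_left (sub_ne_zero.2 h)
  rw [Submodule.mem_bot, h1, h4, mul_zero]
  rfl

theorem spreadLine_sup {l l' : L} (h : l ≠ l') :
    spreadLine F l ⊔ spreadLine F l' = ⊤ := by
  refine Submodule.eq_top_of_finrank_eq ?_
  have h1 := Submodule.finrank_sup_add_finrank_inf_eq (spreadLine F l) (spreadLine F l')
  rw [spreadLine_inf h, finrank_bot, add_zero, finrank_spreadLine, finrank_spreadLine] at h1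
  rw [h1, Module.finrank_prod]

theorem exists_linearEmb {P : Type*} [AddCommGroup P] [Module F P] [Fintype P]
    (h : Module.finrank F P ≤ Module.finrank F X) : Nonempty (LinearEmb F P X) := by
  obtain ⟨f, hf⟩ := finrank_le_iff_exists_linearMap.1 h
  exact ⟨⟨f, hf⟩⟩

theorem finrank_map_linearEmb {P : Type*} [AddCommGroup P] [Module F P] (f : LinearEmb F P X)
    (D : Submodule F P) : Module.finrank F (D.map f.1) = Module.finrank F D :=
  (LinearEquiv.finrank_eq (Submodule.equivMapOfInjective f.1 f.2 D)).symm

theorem mul_le_of_hit {b c x Q : ℕ} (hx : 2 ≤ x) (hQ : 0 < Q)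
    (h : b * (Q * x ^ 2 - x) = c * (x ^ 2 - x)) : Q * b ≤ c := by
  have h1 : x ≤ x ^ 2 := Nat.le_self_pow two_ne_zero x
  have h2 : x ≤ Q * x ^ 2 := h1.trans (Nat.le_mul_of_pos_left _ hQ)
  zify [h1, h2] at h hx hQ ⊢
  have hpos : (0 : ℤ) < Q * x ^ 2 - x := by nlinarith
  refine le_of_mul_le_mul_right ?_ hpos
  have h3 : (Q : ℤ) * b * (Q * x ^ 2 - x) = c * (Q * (x ^ 2 - x)) := by
    linear_combination (Q : ℤ) * h
  rw [h3]
  refine mul_le_mul_of_nonneg_left ?_ (by positivity)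
  nlinarith

theorem mul_le_of_point {p g x Q : ℕ} (hx : 2 ≤ x) (hQ : 0 < Q)
    (h : p * (Q * x ^ 2 - 1) = g * (x - 1)) : Q * x * p ≤ g := by
  have h0 : 1 ≤ x := by omega
  have h2 : 1 ≤ Q * x ^ 2 := Nat.mul_pos hQ (by positivity)
  zify [h0, h2] at h hx hQ ⊢
  have hpos : (0 : ℤ) < Q * x ^ 2 - 1 := by nlinarith
  refine le_of_mul_le_mul_right ?_ hpos
  have h3 : (Q : ℤ) * x * p * (Q * x ^ 2 - 1) = g * (Q * x * (x - 1)) := by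
    linear_combination (Q : ℤ) * x * h
  rw [h3]
  refine mul_le_mul_of_nonneg_left ?_ (by positivity)
  nlinarith

theorem card_eq_mul_sq {m d : ℕ} (hX : Module.finrank F X = d) (hmd : 2 * m ≤ d) :
    Nat.card X = Fintype.card F ^ (d - 2 * m) * (Fintype.card F ^ m) ^ 2 := by
  rw [Module.natCard_eq_pow_finrank (K := F), Nat.card_eq_fintype_card, hX, ← pow_mul, ← pow_add]
  congr 1
  omega

/-- The random Desarguesian partial spreads. -/
noncomputable def desarguesSystem {m d : ℕ} (hm : 0 < m) (hL : Module.finrank F L = m)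
    (hX : Module.finrank F X = d) (hmd : 2 * m ≤ d) :
    SpreadSystem X (LinearEmb F (L × L) X) L where
  U f l := ((spreadLine F l).map f.1).toAddSubgroup
  H f := (LinearMap.range f.1).toAddSubgroup
  G := (grassmannian F X m).image Submodule.toAddSubgroup
  M := Fintype.card F ^ m
  Q := Fintype.card F ^ (d - 2 * m)
  c := (Finset.univ.filter (fun f : LinearEmb F (L × L) X => (spreadLine F (0 : L)).map f.1 =
    (spreadLine F (0 : L)).map (exists_linearEmb (F := F) (P := L × L) (X := X)
      (by rw [Module.finrank_prod, hL, hX]; omega)).some.1)).card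
  two_le_M := by
    have h1 : 2 ≤ Fintype.card F := Fintype.one_lt_card
    exact h1.trans (Nat.le_self_pow hm.ne' _)
  Q_pos := pow_pos Fintype.card_pos _
  c_pos := Finset.card_pos.2 ⟨_, Finset.mem_filter.2 ⟨Finset.mem_univ _, rfl⟩⟩
  card_index := by rw [Module.card_eq_pow_finrank (K := F), hL]
  mem_G f l := by
    refine Finset.mem_image_of_mem _ (mem_grassmannian.2 ?_)
    rw [finrank_map_linearEmb, finrank_spreadLine, hL]
  card_mem A hA := by
    obtain ⟨S, hS, rfl⟩ := Finset.mem_image.1 hA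
    have := Module.natCard_eq_pow_finrank (K := F) (V := S)
    rw [mem_grassmannian.1 hS, Nat.card_eq_fintype_card (α := F)] at this
    exact this
  card_V := by
    rw [Module.card_eq_pow_finrank (K := F), hX, ← pow_mul, ← pow_add]
    congr 1
    omega
  inf_eq f l l' h := by
    have := Submodule.map_inf f.1 (p := spreadLine F l) (q := spreadLine F l') f.2
    rw [spreadLine_inf h, Submodule.map_bot] at this
    have h2 := congrArg Submodule.toAddSubgroup this
    exact h2.symm
  sup_eq f l l' h := by
    rw [← Submodule.sup_toAddSubgroup, ← Submodule.map_sup, spreadLine_sup h, Submodule.map_top]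
  unif l A hA := by
    obtain ⟨S, hS, rfl⟩ := Finset.mem_image.1 hA
    have h1 : ∀ f : LinearEmb F (L × L) X, ((spreadLine F l).map f.1).toAddSubgroup =
        S.toAddSubgroup ↔ (spreadLine F l).map f.1 = S :=
      fun f => Submodule.toAddSubgroup_injective.eq_iff
    simp_rw [h1]
    refine card_linearEmb_map_eq ?_ ?_
    · rw [finrank_spreadLine, finrank_spreadLine]
    · rw [mem_grassmannian.1 hS, finrank_map_linearEmb,
        finrank_spreadLine, hL]
  hit l A hA v hv := by
    obtain ⟨S, hS, rfl⟩ := Finset.mem_image.1 hA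
    have h1 : ∀ f : LinearEmb F (L × L) X, ((spreadLine F l).map f.1).toAddSubgroup =
        S.toAddSubgroup ↔ (spreadLine F l).map f.1 = S :=
      fun f => Submodule.toAddSubgroup_injective.eq_iff
    simp_rw [h1]
    refine mul_le_of_hit (x := Fintype.card F ^ m) (Fintype.one_lt_card.trans_le
      (Nat.le_self_pow hm.ne' _)) (pow_pos Fintype.card_pos _) ?_
    have h2 := card_linearEmb_hit_mul (P := L × L) (D := spreadLine F l) (A := S) hv
    have hS' := mem_grassmannian.1 hS
    have hcS : Nat.card S = Fintype.card F ^ m := by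
      rw [Module.natCard_eq_pow_finrank (K := F), hS', Nat.card_eq_fintype_card]
    have hcL : Nat.card (L × L) = (Fintype.card F ^ m) ^ 2 := by
      rw [Nat.card_prod, Module.natCard_eq_pow_finrank (K := F), hL, Nat.card_eq_fintype_card,
        sq]
    rw [hcS, hcL, card_eq_mul_sq hX hmd] at h2
    refine h2.trans ?_
    congr 1
    refine card_linearEmb_map_eq ?_ ?_
    · rw [finrank_spreadLine, finrank_spreadLine]
    · rw [hS', finrank_map_linearEmb, finrank_spreadLine, hL]
  point v hv := by
    refine mul_le_of_point (Fintype.one_lt_card.trans_le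
      (Nat.le_self_pow hm.ne' _)) (pow_pos Fintype.card_pos _) ?_
    rw [Finset.filter_image, Finset.card_image_of_injective _ Submodule.toAddSubgroup_injective,
      Finset.card_image_of_injective _ Submodule.toAddSubgroup_injective]
    have h2 := card_point_mul (F := F) (m := m) hv
    rw [card_eq_mul_sq hX hmd] at h2
    rw [grassmannian, Finset.filter_filter]
    exact h2

end System

section Grassmannian

open scoped Classical

variable {F X : Type*} [Field F] [Fintype F] [AddCommGroup X] [Module F X] [Fintype X]

theorem prod_pow_sub_pow_succ (q : ℝ) (m : ℕ) :
    ∏ i ∈ Finset.range (m + 1), (q ^ (m + 1) - q ^ i) =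
      (q ^ (m + 1) - 1) * (q ^ m * ∏ i ∈ Finset.range m, (q ^ m - q ^ i)) := by
  rw [Finset.prod_range_succ', pow_zero, mul_comm]
  congr 1
  have h : ∀ i ∈ Finset.range m, q ^ (m + 1) - q ^ (i + 1) = q * (q ^ m - q ^ i) := by
    intro i _
    ring
  rw [Finset.prod_congr rfl h, Finset.prod_mul_distrib, Finset.prod_const, Finset.card_range]

theorem pow_sq_mul_le_prod {q : ℝ} (hq : 2 ≤ q) {m : ℕ} (hm : 1 ≤ m) :
    q ^ (m ^ 2) * (2 ^ m + 2) ≤ 4 * 2 ^ m * ∏ i ∈ Finset.range m, (q ^ m - q ^ i) := by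
  induction m, hm using Nat.le_induction with
  | base =>
    simp only [one_pow, pow_one, Finset.prod_range_one, pow_zero]
    linarith
  | succ m hm ih =>
    rw [prod_pow_sub_pow_succ]
    set p := ∏ i ∈ Finset.range m, (q ^ m - q ^ i)
    have hx : (2 : ℝ) ≤ 2 ^ m := le_self_pow₀ one_le_two (by omega)
    have hy : 2 * 2 ^ m ≤ q ^ (m + 1) := by
      rw [← pow_succ']
      exact pow_le_pow_left₀ zero_le_two hq _
    have hqm : 0 < q ^ m := by positivity
    have hqq : 0 < q ^ (m ^ 2) := by positivity
    have h1 : q ^ ((m + 1) ^ 2) = q ^ (m ^ 2) * q ^ m * q ^ (m + 1) := by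
      rw [← pow_add, ← pow_add]
      ring_nf
    rw [h1, pow_succ 2 m]
    generalize (2 : ℝ) ^ m = x at *
    generalize q ^ (m + 1) = y at *
    generalize q ^ m = z at *
    generalize q ^ (m ^ 2) = w at *
    calc w * z * y * (x * 2 + 2) ≤ w * z * (2 * (y - 1) * (x + 2)) := by
          rw [mul_assoc (w * z)]
          refine mul_le_mul_of_nonneg_left ?_ (by positivity)
          linarith
      _ = 2 * (y - 1) * z * (w * (x + 2)) := by ring
      _ ≤ 2 * (y - 1) * z * (4 * x * p) := by
          refine mul_le_mul_of_nonneg_left ih (mul_nonneg ?_ hqm.le)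
          linarith
      _ = _ := by ring

theorem pow_sq_le_prod {q : ℝ} (hq : 2 ≤ q) (m : ℕ) :
    q ^ (m ^ 2) ≤ 4 * ∏ i ∈ Finset.range m, (q ^ m - q ^ i) := by
  rcases Nat.eq_zero_or_pos m with rfl | hm
  · norm_num
  have h := pow_sq_mul_le_prod hq hm
  have h2 : (0 : ℝ) < 2 ^ m := by positivity
  have h3 : (0 : ℝ) < q ^ (m ^ 2) := by positivity
  refine le_of_mul_le_mul_left ?_ h2
  nlinarith

theorem card_grassmannian_mul_le (m : ℕ) :
    (grassmannian F X m).card * ∏ i : Fin m, (Fintype.card F ^ m - Fintype.card F ^ (i : ℕ)) ≤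
      Fintype.card X ^ m := by
  have h1 : ∀ S ∈ grassmannian F X m, Fintype.card {s : Fin m → S // LinearIndependent F s} =
      ∏ i : Fin m, (Fintype.card F ^ m - Fintype.card F ^ (i : ℕ)) := by
    intro S hS
    have h := card_linearIndependent (K := F) (V := S) (k := m) (mem_grassmannian.1 hS).ge
    rw [mem_grassmannian.1 hS, Nat.card_eq_fintype_card] at h
    exact h
  have h2 : Fintype.card ((S : grassmannian F X m) ×
      {s : Fin m → S.1 // LinearIndependent F s}) =
      (grassmannian F X m).card * ∏ i : Fin m, (Fintype.card F ^ m - Fintype.card F ^ (i : ℕ)) := by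
    rw [Fintype.card_sigma, Finset.sum_congr rfl (fun S _ => h1 S.1 S.2), Finset.sum_const,
      Finset.card_univ, Fintype.card_coe, smul_eq_mul]
  rw [← h2]
  have h3 : Fintype.card (Fin m → X) = Fintype.card X ^ m := by simp
  rw [← h3]
  have key : ∀ p : (S : grassmannian F X m) × {s : Fin m → S.1 // LinearIndependent F s},
      p.1.1 = Submodule.span F (Set.range (fun i => (p.2.1 i : X))) := by
    rintro ⟨⟨S, hS⟩, s, hs⟩
    symm
    refine Submodule.eq_of_le_of_finrank_eq ?_ ?_
    · rw [Submodule.span_le]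
      rintro _ ⟨i, rfl⟩
      exact (s i).2
    · have hli : LinearIndependent F (fun i => (s i : X)) :=
        hs.map' S.subtype (Submodule.ker_subtype S)
      rw [finrank_span_eq_card hli, Fintype.card_fin, mem_grassmannian.1 hS]
  refine Fintype.card_le_of_injective (fun p i => (p.2.1 i : X)) ?_
  intro p p' h
  have h4 : p.1 = p'.1 := by
    apply Subtype.ext
    rw [key p, key p']
    simp only at h
    rw [h]
  obtain ⟨S, s⟩ := p
  obtain ⟨S', s'⟩ := p'
  simp only at h4
  subst h4
  congr 1
  apply Subtype.ext
  funext i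
  exact Subtype.ext (congrFun h i)

theorem card_grassmannian_le {m d : ℕ} (hX : Module.finrank F X = d) (hm : m ≤ d) :
    ((grassmannian F X m).card : ℝ) ≤ 4 * (Fintype.card F : ℝ) ^ (m * (d - m)) := by
  have h1 := card_grassmannian_mul_le (F := F) (X := X) m
  have hq : 2 ≤ Fintype.card F := Fintype.one_lt_card
  have h2 : ((∏ i : Fin m, (Fintype.card F ^ m - Fintype.card F ^ (i : ℕ)) : ℕ) : ℝ) =
      ∏ i ∈ Finset.range m, ((Fintype.card F : ℝ) ^ m - (Fintype.card F : ℝ) ^ i) := by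
    rw [Finset.prod_range, Nat.cast_prod]
    refine Finset.prod_congr rfl fun i _ => ?_
    rw [Nat.cast_sub (Nat.pow_le_pow_right (by omega) i.2.le), Nat.cast_pow, Nat.cast_pow]
  have hq' : (2 : ℝ) ≤ Fintype.card F := by exact_mod_cast hq
  have h3 := pow_sq_le_prod hq' m
  have h4 := (Nat.cast_le (α := ℝ)).2 h1
  rw [Nat.cast_mul, h2, Module.card_eq_pow_finrank (K := F) (V := X), hX, Nat.cast_pow,
    Nat.cast_pow] at h4
  have h5 : ((Fintype.card F : ℝ) ^ d) ^ m =
      (Fintype.card F : ℝ) ^ (m * (d - m)) * (Fintype.card F : ℝ) ^ (m ^ 2) := by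
    rw [← pow_mul, ← pow_add]
    congr 1
    obtain ⟨e, rfl⟩ := Nat.exists_eq_add_of_le hm
    rw [Nat.add_sub_cancel_left]
    ring
  have h6 : (0 : ℝ) < (Fintype.card F : ℝ) ^ (m ^ 2) := by positivity
  refine le_of_mul_le_mul_right ?_ h6
  rw [h5] at h4
  have h7 := mul_le_mul_of_nonneg_left h3 (Nat.cast_nonneg (α := ℝ) (grassmannian F X m).card)
  linarith

end Grassmannian

section Perp

open scoped Classical

variable {F : Type*} [Field F] {d : ℕ}

theorem mem_perp {V : Submodule F (Fin d → F)} {y : Fin d → F} :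
    y ∈ perp V ↔ ∀ x ∈ V, ∑ i, x i * y i = 0 :=
  Iff.rfl

theorem perp_eq_orthogonal (V : Submodule F (Fin d → F)) :
    perp V = LinearMap.BilinForm.orthogonal (dotProductBilin F F) V := by
  ext y
  rw [mem_perp, LinearMap.BilinForm.mem_orthogonal_iff]
  rfl

theorem dotProductBilin_isRefl :
    LinearMap.BilinForm.IsRefl (dotProductBilin F F (m := Fin d) (A := F)) := by
  intro x y h
  simp only [dotProductBilin_apply_apply] at h ⊢
  rw [dotProduct_comm, h]

theorem dotProductBilin_nondegenerate :
    LinearMap.BilinForm.Nondegenerate (dotProductBilin F F (m := Fin d) (A := F)) := by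
  refine ⟨fun x h => ?_, fun x h => ?_⟩
  · funext i
    have := h (Pi.single i 1)
    simpa using this
  · funext i
    have := h (Pi.single i 1)
    simpa using this

theorem finrank_perp (V : Submodule F (Fin d → F)) :
    Module.finrank F (perp V) = d - Module.finrank F V := by
  rw [perp_eq_orthogonal, LinearMap.BilinForm.finrank_orthogonal dotProductBilin_nondegenerate,
    Module.finrank_fin_fun]

theorem perp_perp (V : Submodule F (Fin d → F)) : perp (perp V) = V := by
  rw [perp_eq_orthogonal, perp_eq_orthogonal, LinearMap.BilinForm.orthogonal_orthogonal
    dotProductBilin_nondegenerate dotProductBilin_isRefl]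

theorem perp_injective : Function.Injective (perp : Submodule F (Fin d → F) → _) :=
  Function.LeftInverse.injective perp_perp

theorem perp_sup (V V' : Submodule F (Fin d → F)) : perp (V ⊔ V') = perp V ⊓ perp V' := by
  ext y
  rw [Submodule.mem_inf]
  refine ⟨fun h => ⟨fun x hx => h x (Submodule.mem_sup_left hx),
    fun x hx => h x (Submodule.mem_sup_right hx)⟩, fun h x hx => ?_⟩
  obtain ⟨x₁, h₁, x₂, h₂, rfl⟩ := Submodule.mem_sup.1 hx
  have e1 := h.1 x₁ h₁
  have e2 := h.2 x₂ h₂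
  simp only [Pi.add_apply, add_mul, Finset.sum_add_distrib, e1, e2, add_zero]

variable [Fintype F]

theorem natCard_perp (V : Submodule F (Fin d → F)) :
    Nat.card (perp V).toAddSubgroup = Fintype.card F ^ (d - Module.finrank F V) := by
  have h := Module.natCard_eq_pow_finrank (K := F) (V := perp V)
  rw [finrank_perp, Nat.card_eq_fintype_card (α := F)] at h
  exact h

theorem projCount_eq (V : Submodule F (Fin d → F)) (E : Set (Fin d → F)) :
    projCount V E = (E.toFinset.image (perp V).mkQ).card := by
  rw [projCount, ← Set.ncard_coe_finset, Finset.coe_image, Set.coe_toFinset]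

theorem card_thicken_perp (V : Submodule F (Fin d → F)) (E : Set (Fin d → F)) :
    (thicken E.toFinset (perp V).toAddSubgroup).card =
      projCount V E * Fintype.card F ^ (d - Module.finrank F V) := by
  rw [projCount_eq, ← natCard_perp]
  have h1 : ∀ z ∈ thicken E.toFinset (perp V).toAddSubgroup,
      (perp V).mkQ z ∈ E.toFinset.image (perp V).mkQ := by
    intro z hz
    obtain ⟨x, hx, hzx⟩ := mem_thicken.1 hz
    exact Finset.mem_image.2 ⟨x, hx, ((Submodule.Quotient.eq _).2 hzx).symm⟩
  rw [Finset.card_eq_sum_card_fiberwise h1, ← smul_eq_mul, ← Finset.sum_const]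
  refine Finset.sum_congr rfl fun b hb => ?_
  obtain ⟨x, hx, rfl⟩ := Finset.mem_image.1 hb
  rw [← card_cosetPart_univ _ x]
  congr 1
  ext y
  rw [Finset.mem_filter, mem_cosetPart, mem_thicken]
  constructor
  · intro h
    exact ⟨Finset.mem_univ _, (Submodule.Quotient.eq _).1 h.2⟩
  · intro h
    exact ⟨⟨x, hx, h.2⟩, (Submodule.Quotient.eq _).2 h.2⟩

theorem ncard_le_projCount_mul {V V' : Submodule F (Fin d → F)} (h : V ⊓ V' = ⊥)
    (E : Set (Fin d → F)) : E.ncard ≤ projCount V E * projCount V' E *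
      Fintype.card F ^ (d - (Module.finrank F V + Module.finrank F V')) := by
  have h1 : Module.finrank F ↥(V ⊔ V') = Module.finrank F V + Module.finrank F V' := by
    have := Submodule.finrank_sup_add_finrank_inf_eq V V'
    rwa [h, finrank_bot, add_zero] at this
  rw [Set.ncard_eq_toFinset_card', projCount_eq, projCount_eq, ← h1, ← natCard_perp,
    mul_comm, ← Finset.card_product]
  have h2 := Finset.card_le_mul_card_image
    (f := fun x => ((perp V).mkQ x, (perp V').mkQ x)) E.toFinset
    (Nat.card (perp (V ⊔ V')).toAddSubgroup) ?_
  · refine h2.trans (Nat.mul_le_mul_left _ (Finset.card_le_card ?_))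
    intro p hp
    obtain ⟨x, hx, rfl⟩ := Finset.mem_image.1 hp
    exact Finset.mem_product.2 ⟨Finset.mem_image_of_mem _ hx, Finset.mem_image_of_mem _ hx⟩
  · intro p hp
    obtain ⟨x, hx, rfl⟩ := Finset.mem_image.1 hp
    rw [← card_cosetPart_univ _ x]
    refine Finset.card_le_card fun y hy => ?_
    have h3 := (Finset.mem_filter.1 hy).2
    rw [Prod.mk.injEq] at h3
    refine mem_cosetPart.2 ⟨Finset.mem_univ _, ?_⟩
    rw [Submodule.mem_toAddSubgroup, perp_sup]
    exact ⟨(Submodule.Quotient.eq _).1 h3.1, (Submodule.Quotient.eq _).1 h3.2⟩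

end Perp

section Intersecting

open scoped Classical

variable {F L X : Type*} [Field F] [Fintype F] [Field L] [Fintype L] [Algebra F L]
  [AddCommGroup X] [Module F X] [Fintype X]

theorem card_mul_le_of_partialSpread {P ι : Type*} [AddCommGroup P] [Module F P] [Fintype P]
    [Fintype ι] {k : ℕ} {D : ι → Submodule F P}
    (hD : ∀ l, Module.finrank F (D l) = k) (hDD : ∀ l l', l ≠ l' → D l ⊓ D l' = ⊥)
    (hP : Module.finrank F P ≤ Module.finrank F X) {T : Finset (Submodule F X)}
    (hT : T ⊆ grassmannian F X k) (hTT : ∀ V ∈ T, ∀ V' ∈ T, V ⊓ V' ≠ ⊥) :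
    Fintype.card ι * T.card ≤ (grassmannian F X k).card := by
  rcases isEmpty_or_nonempty ι with hι | ⟨⟨l₀⟩⟩
  · simp
  obtain ⟨f₀⟩ := exists_linearEmb (F := F) (P := P) (X := X) hP
  set c := (Finset.univ.filter (fun f : LinearEmb F P X => (D l₀).map f.1 =
    (D l₀).map f₀.1)).card with hc
  have hc0 : 0 < c := Finset.card_pos.2 ⟨f₀, by simp⟩
  have huni : ∀ l, ∀ S ∈ grassmannian F X k,
      (Finset.univ.filter (fun f : LinearEmb F P X => (D l).map f.1 = S)).card = c := by
    intro l S hS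
    refine card_linearEmb_map_eq ?_ ?_
    · rw [hD, hD]
    · rw [mem_grassmannian.1 hS, finrank_map_linearEmb, hD]
  have hcount : ∀ l, ∀ T' ⊆ grassmannian F X k,
      (Finset.univ.filter (fun f : LinearEmb F P X => (D l).map f.1 ∈ T')).card =
        T'.card * c := by
    intro l T' hT'
    have hmem : ∀ f ∈ Finset.univ.filter (fun f : LinearEmb F P X => (D l).map f.1 ∈ T'),
        (D l).map f.1 ∈ T' := fun f hf => (Finset.mem_filter.1 hf).2
    rw [Finset.card_eq_sum_card_fiberwise hmem, ← smul_eq_mul, ← Finset.sum_const]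
    refine Finset.sum_congr rfl fun S hS => ?_
    rw [← huni l S (hT' hS), Finset.filter_filter]
    congr 1
    ext f
    simp only [Finset.mem_filter, Finset.mem_univ, true_and, and_iff_right_iff_imp]
    rintro rfl
    exact hS
  have hone : ∀ f : LinearEmb F P X,
      (Finset.univ.filter (fun l => (D l).map f.1 ∈ T)).card ≤ 1 := by
    intro f
    refine Finset.card_le_one.2 fun l hl l' hl' => ?_
    by_contra hne
    refine hTT _ (Finset.mem_filter.1 hl).2 _ (Finset.mem_filter.1 hl').2 ?_
    rw [← Submodule.map_inf f.1 f.2, hDD l l' hne, Submodule.map_bot]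
  have hall : (grassmannian F X k).card * c = Fintype.card (LinearEmb F P X) := by
    rw [← hcount l₀ _ subset_rfl, Finset.filter_true_of_mem, Finset.card_univ]
    intro f _
    rw [mem_grassmannian, finrank_map_linearEmb, hD]
  have hdouble : ∑ l : ι, (Finset.univ.filter
      (fun f : LinearEmb F P X => (D l).map f.1 ∈ T)).card =
      ∑ f : LinearEmb F P X, (Finset.univ.filter (fun l => (D l).map f.1 ∈ T)).card := by
    simp only [Finset.card_filter]
    exact Finset.sum_comm
  have hle : Fintype.card ι * (T.card * c) ≤ (grassmannian F X k).card * c := by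
    rw [hall, ← Finset.card_univ, ← smul_eq_mul, ← Finset.sum_const,
      ← Finset.sum_congr rfl (fun l _ => hcount l T hT), hdouble, ← Finset.card_univ,
      Finset.card_eq_sum_ones]
    exact Finset.sum_le_sum fun f _ => hone f
  rw [← mul_assoc] at hle
  exact Nat.le_of_mul_le_mul_right hle hc0

theorem card_mul_le_of_intersecting {k : ℕ} (hk : k ≤ Module.finrank F L)
    (hX : k + Module.finrank F L = Module.finrank F X) {T : Finset (Submodule F X)}
    (hT : T ⊆ grassmannian F X k) (hTT : ∀ V ∈ T, ∀ V' ∈ T, V ⊓ V' ≠ ⊥) :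
    Fintype.card L * T.card ≤ (grassmannian F X k).card := by
  obtain ⟨j, hj⟩ := finrank_le_iff_exists_linearMap (R := F) (M := Fin k → F) (M' := L) |>.1
    (by rwa [Module.finrank_fin_fun])
  refine card_mul_le_of_partialSpread (P := (Fin k → F) × L)
    (D := fun l : L => ((LinearMap.mulLeft F l).comp j).graph) ?_ ?_ ?_ hT hTT
  · intro l
    rw [LinearMap.graph_eq_range_prod, LinearMap.finrank_range_of_inj
      (fun x y h => congrArg Prod.fst h), Module.finrank_fin_fun]
  · intro l l' h
    rw [eq_bot_iff]
    rintro ⟨x, y⟩ ⟨h1, h2⟩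
    rw [SetLike.mem_coe, LinearMap.mem_graph_iff] at h1 h2
    simp only [LinearMap.comp_apply, LinearMap.mulLeft_apply] at h1 h2
    have h3 : (l - l') * j x = 0 := by rw [sub_mul, ← h1, ← h2, sub_self]
    have h4 : j x = 0 := (mul_eq_zero.1 h3).resolve_left (sub_ne_zero.2 h)
    have h5 : x = 0 := hj (by rw [h4, map_zero])
    rw [Submodule.mem_bot, h1, h4, mul_zero, h5]
    rfl
  · rw [Module.finrank_prod, Module.finrank_fin_fun, hX]

end Intersecting

section Exceptional

open scoped Classical

variable {F : Type*} [Field F] [Fintype F]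

theorem exists_field_extension_finrank_eq (F : Type*) [Field F] [Fintype F] {m : ℕ} (hm : 0 < m) :
    ∃ (L : Type) (_ : Field L) (_ : Fintype L) (_ : Algebra F L), Module.finrank F L = m := by
  obtain ⟨p, hp⟩ := CharP.exists F
  have : Fact p.Prime := ⟨CharP.char_is_prime F p⟩
  have : NeZero m := ⟨hm.ne'⟩
  have : Finite (FiniteField.Extension F p m) := Module.finite_of_finite F
  exact ⟨FiniteField.Extension F p m, inferInstance, Fintype.ofFinite _, inferInstance,
    FiniteField.finrank_extension F p m⟩

theorem card_Tset_mul_lt_of_le {m k d : ℕ} (hd : d = k + m) (hm : 0 < m) (hmk : m ≤ k)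
    {E : Set (Fin d → F)} {T : Finset (Submodule F (Fin d → F))} {a s : ℝ}
    (hT : ∀ V ∈ T, Module.finrank F V = k ∧ (projCount V E : ℝ) < (Fintype.card F : ℝ) ^ s)
    (hne : T.Nonempty) (hE : (E.ncard : ℝ) = (Fintype.card F : ℝ) ^ a)
    (hs : 2 * s < a + k - m)
    (hn : 10 ^ 70 * (Fintype.card F : ℝ) ^ s ≤ (Fintype.card F : ℝ) ^ a) :
    (Fintype.card F : ℝ) ^ m * T.card < 10 ^ 20 * (4 * (Fintype.card F : ℝ) ^ (m * k)) := by
  obtain ⟨L, _, _, _, hL⟩ := exists_field_extension_finrank_eq F hm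
  have hX : Module.finrank F (Fin d → F) = d := Module.finrank_fin_fun F
  have hmd : 2 * m ≤ d := by omega
  set S := desarguesSystem (F := F) (L := L) hm hL hX hmd with hS
  have hM : S.M = Fintype.card F ^ m := rfl
  have hQ : S.Q = Fintype.card F ^ (d - 2 * m) := rfl
  have hG : S.G = (grassmannian F (Fin d → F) m).image Submodule.toAddSubgroup := rfl
  have hq1 : (1 : ℝ) < Fintype.card F := by exact_mod_cast Fintype.one_lt_card
  have hinj : Function.Injective (fun V : Submodule F (Fin d → F) => (perp V).toAddSubgroup) :=
    Submodule.toAddSubgroup_injective.comp perp_injective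
  have hth : ∀ V ∈ T, ((thicken E.toFinset (perp V).toAddSubgroup).card : ℝ) =
      projCount V E * (Fintype.card F : ℝ) ^ m := by
    intro V hV
    rw [card_thicken_perp, (hT V hV).1, show d - k = m by omega, Nat.cast_mul, Nat.cast_pow]
  have hcE : (E.toFinset.card : ℝ) = (Fintype.card F : ℝ) ^ a := by
    rw [← hE, Set.ncard_eq_toFinset_card']
  have hqm : 0 < (Fintype.card F : ℝ) ^ m := by positivity
  have hqa : 0 < (Fintype.card F : ℝ) ^ a := by positivity
  have hpos : 0 < E.toFinset.card := by
    rw [← Nat.cast_pos (α := ℝ), hcE]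
    exact hqa
  have hmain := S.card_mul_card_lt E.toFinset hpos
    (T := T.image (fun V : Submodule F (Fin d → F) => (perp V).toAddSubgroup)) ?_
    (hne.image _) (n := 10 ^ 70) le_rfl ?_ ?_
  · rw [Finset.card_image_of_injective _ hinj, hG,
      Finset.card_image_of_injective _ Submodule.toAddSubgroup_injective, hM, Nat.cast_pow] at hmain
    refine hmain.trans_le (mul_le_mul_of_nonneg_left ?_ (by positivity))
    have := card_grassmannian_le (F := F) (X := Fin d → F) (m := m) hX (by omega)
    rwa [show d - m = k by omega] at this
  · intro A hA
    obtain ⟨V, hV, rfl⟩ := Finset.mem_image.1 hA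
    rw [hG]
    refine Finset.mem_image_of_mem _ (mem_grassmannian.2 ?_)
    rw [finrank_perp, (hT V hV).1, hd, Nat.add_sub_cancel_left]
  · intro A hA
    obtain ⟨V, hV, rfl⟩ := Finset.mem_image.1 hA
    rw [hth V hV, hcE, hM, hQ, Nat.cast_pow, Nat.cast_pow]
    have h1 : (projCount V E : ℝ) ^ 2 < (Fintype.card F : ℝ) ^ (d - 2 * m) *
        (Fintype.card F : ℝ) ^ a := by
      refine (pow_lt_pow_left₀ (hT V hV).2 (Nat.cast_nonneg _) two_ne_zero).trans ?_
      rw [← Real.rpow_natCast, ← Real.rpow_mul (by positivity), ← Real.rpow_natCast _ (d - 2 * m),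
        ← Real.rpow_add (by positivity)]
      refine Real.rpow_lt_rpow_of_exponent_lt hq1 ?_
      rw [Nat.cast_sub hmd, hd]
      push_cast
      linarith
    calc ((projCount V E : ℝ) * (Fintype.card F : ℝ) ^ m) ^ 2 =
        (projCount V E : ℝ) ^ 2 * ((Fintype.card F : ℝ) ^ m) ^ 2 := by ring
      _ < (Fintype.card F : ℝ) ^ (d - 2 * m) * (Fintype.card F : ℝ) ^ a *
          ((Fintype.card F : ℝ) ^ m) ^ 2 := mul_lt_mul_of_pos_right h1 (by positivity)
      _ = _ := by ring
  · intro A hA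
    obtain ⟨V, hV, rfl⟩ := Finset.mem_image.1 hA
    rw [hth V hV, hcE, hM, Nat.cast_pow, ← mul_assoc, mul_comm]
    refine mul_le_mul_of_nonneg_left (le_trans ?_ hn) hqm.le
    exact mul_le_mul_of_nonneg_left (hT V hV).2.le (by positivity)

theorem card_Tset_mul_le_of_le {m k d : ℕ} (hd : d = k + m) (hm : 0 < m) (hkm : k ≤ m)
    {E : Set (Fin d → F)} {T : Finset (Submodule F (Fin d → F))} {a s : ℝ}
    (hT : ∀ V ∈ T, Module.finrank F V = k ∧ (projCount V E : ℝ) < (Fintype.card F : ℝ) ^ s)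
    (hE : (E.ncard : ℝ) = (Fintype.card F : ℝ) ^ a) (hs : 2 * s < a + k - m) :
    (Fintype.card F : ℝ) ^ m * T.card ≤ 4 * (Fintype.card F : ℝ) ^ (k * m) := by
  obtain ⟨L, _, _, _, hL⟩ := exists_field_extension_finrank_eq F hm
  have hX : Module.finrank F (Fin d → F) = d := Module.finrank_fin_fun F
  have hq1 : (1 : ℝ) < Fintype.card F := by exact_mod_cast Fintype.one_lt_card
  have h := card_mul_le_of_intersecting (F := F) (L := L) (X := Fin d → F) (k := k) (T := T)
    (by rwa [hL]) (by rw [hL, hX, hd]) (fun V hV => mem_grassmannian.2 (hT V hV).1) ?_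
  · rw [Module.card_eq_pow_finrank (K := F) (V := L), hL] at h
    have h2 := (Nat.cast_le (α := ℝ)).2 h
    rw [Nat.cast_mul, Nat.cast_pow] at h2
    refine h2.trans ?_
    have := card_grassmannian_le (F := F) (X := Fin d → F) (m := k) hX (by omega)
    rwa [show d - k = m by omega] at this
  · intro V hV V' hV' hVV
    have h1 := (Nat.cast_le (α := ℝ)).2 (ncard_le_projCount_mul hVV E)
    rw [(hT V hV).1, (hT V' hV').1, hE, Nat.cast_mul, Nat.cast_mul, Nat.cast_pow] at h1
    refine absurd h1 (not_le.2 ?_)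
    calc (projCount V E : ℝ) * projCount V' E * (Fintype.card F : ℝ) ^ (d - (k + k)) ≤
        (Fintype.card F : ℝ) ^ s * (Fintype.card F : ℝ) ^ s *
          (Fintype.card F : ℝ) ^ (d - (k + k)) := by
          gcongr
          · exact (hT V hV).2.le
          · exact (hT V' hV').2.le
      _ < (Fintype.card F : ℝ) ^ a := by
          rw [← Real.rpow_natCast, ← Real.rpow_add (by positivity),
            ← Real.rpow_add (by positivity)]
          refine Real.rpow_lt_rpow_of_exponent_lt hq1 ?_
          rw [Nat.cast_sub (by omega), hd]
          push_cast
          linarith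

theorem ncard_Tset_le {k d : ℕ} (hkd : k < d) {a s : ℝ} {E : Set (Fin d → F)}
    (hs : s < (a + 2 * (k : ℝ) - (d : ℝ)) / 2)
    (hE : (E.ncard : ℝ) = (Fintype.card F : ℝ) ^ a) :
    ((Tset F k d s E).ncard : ℝ) ≤ 4 * 10 ^ 140 *
      (Fintype.card F : ℝ) ^ max ((k : ℝ) * ((d : ℝ) - (k : ℝ)) + 2 * (s - a))
        (((k : ℝ) - 1) * ((d : ℝ) - (k : ℝ))) := by
  obtain ⟨m, hd⟩ := Nat.exists_eq_add_of_lt hkd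
  replace hd : d = k + (m + 1) := hd
  generalize hm' : m + 1 = m' at hd
  have hm : 0 < m' := by omega
  have hX : Module.finrank F (Fin d → F) = d := Module.finrank_fin_fun F
  have hdm : (d : ℝ) - k = m' := by rw [hd]; push_cast; ring
  have hq1 : (1 : ℝ) < Fintype.card F := by exact_mod_cast Fintype.one_lt_card
  have hq0 : (0 : ℝ) < Fintype.card F := by linarith
  have hs' : 2 * s < a + k - m' := by linarith
  have hT : ∀ V ∈ (Tset F k d s E).toFinset,
      Module.finrank F V = k ∧ (projCount V E : ℝ) < (Fintype.card F : ℝ) ^ s :=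
    fun V hV => (Set.mem_toFinset (s := Tset F k d s E)).1 hV
  rw [Set.ncard_eq_toFinset_card']
  generalize (Tset F k d s E).toFinset = T at hT
  rw [hdm]
  by_cases hn : 10 ^ 70 * (Fintype.card F : ℝ) ^ s ≤ (Fintype.card F : ℝ) ^ a
  · have key : (Fintype.card F : ℝ) ^ m' * T.card ≤
        4 * 10 ^ 140 * (Fintype.card F : ℝ) ^ (m' * k) := by
      have hpos : 0 < (Fintype.card F : ℝ) ^ (m' * k) := by positivity
      rcases le_total k m' with h | h
      · have h1 := card_Tset_mul_le_of_le hd hm h hT hE hs'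
        rw [mul_comm k m'] at h1
        refine h1.trans (mul_le_mul_of_nonneg_right (by norm_num) hpos.le)
      · rcases T.eq_empty_or_nonempty with rfl | hne
        · rw [Finset.card_empty, Nat.cast_zero, mul_zero]
          positivity
        · have h1 := card_Tset_mul_lt_of_le hd hm h hT hne hE hs' hn
          rw [← mul_assoc] at h1
          refine h1.le.trans (mul_le_mul_of_nonneg_right (by norm_num) hpos.le)
    have h2 : (Fintype.card F : ℝ) ^ (m' * k) =
        (Fintype.card F : ℝ) ^ m' * (Fintype.card F : ℝ) ^ (((k : ℝ) - 1) * m') := by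
      rw [← Real.rpow_natCast, ← Real.rpow_natCast, ← Real.rpow_add hq0]
      congr 1
      push_cast
      ring
    have hqm : 0 < (Fintype.card F : ℝ) ^ m' := by positivity
    have h3 : (T.card : ℝ) ≤ 4 * 10 ^ 140 * (Fintype.card F : ℝ) ^ (((k : ℝ) - 1) * m') := by
      refine le_of_mul_le_mul_left (key.trans_eq ?_) hqm
      rw [h2]
      ring
    refine h3.trans (mul_le_mul_of_nonneg_left ?_ (by positivity))
    exact Real.rpow_le_rpow_of_exponent_le hq1.le (le_max_right _ _)
  · have h1 : (T.card : ℝ) ≤ 4 * (Fintype.card F : ℝ) ^ (k * m') := by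
      have h := card_grassmannian_le (F := F) (X := Fin d → F) (m := k) hX (by omega)
      rw [show d - k = m' by omega] at h
      refine le_trans (Nat.cast_le.2 (Finset.card_le_card fun V hV => ?_)) h
      exact mem_grassmannian.2 (hT V hV).1
    have h2 : (Fintype.card F : ℝ) ^ (k * m') =
        (Fintype.card F : ℝ) ^ ((k : ℝ) * m' + 2 * (s - a)) *
          ((Fintype.card F : ℝ) ^ (a - s)) ^ 2 := by
      rw [← Real.rpow_natCast, ← Real.rpow_natCast _ 2, ← Real.rpow_mul hq0.le,
        ← Real.rpow_add hq0]
      congr 1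
      push_cast
      ring
    have h3 : (Fintype.card F : ℝ) ^ (a - s) ≤ 10 ^ 70 := by
      rw [Real.rpow_sub hq0, div_le_iff₀ (by positivity)]
      exact (not_le.1 hn).le
    have h4 : ((Fintype.card F : ℝ) ^ (a - s)) ^ 2 ≤ 10 ^ 140 := by
      refine (pow_le_pow_left₀ (by positivity) h3 2).trans_eq ?_
      norm_num
    have h5 : (Fintype.card F : ℝ) ^ ((k : ℝ) * m' + 2 * (s - a)) ≤
        (Fintype.card F : ℝ) ^ max ((k : ℝ) * m' + 2 * (s - a)) (((k : ℝ) - 1) * m') :=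
      Real.rpow_le_rpow_of_exponent_le hq1.le (le_max_left _ _)
    calc (T.card : ℝ) ≤ 4 * (Fintype.card F : ℝ) ^ (k * m') := h1
      _ ≤ 4 * ((Fintype.card F : ℝ) ^ max ((k : ℝ) * m' + 2 * (s - a)) (((k : ℝ) - 1) * m') *
          10 ^ 140) := by
          rw [h2]
          gcongr
      _ = _ := by ring

end Exceptional

/-- the Bright–Gan bound: if $s < (a+2k-d)/2$ then
$|T_s^{k,d}(E)| \lesssim q^{\max(k(d-k)+2(s-a), (k-1)(d-k))}$. -/
theorem statement3 :
    ∀ ε : ℝ, 0 < ε →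
      ∃ Cε : ℝ, 0 < Cε ∧
        ∀ (F : Type) [Field F] [Fintype F] (k d : ℕ) (a s : ℝ)
          (E : Set (Fin d → F)),
          0 < k → k < d → 0 < s → s < (a + 2 * (k : ℝ) - (d : ℝ)) / 2 →
          (E.ncard : ℝ) = (Fintype.card F : ℝ) ^ a →
          ((Tset F k d s E).ncard : ℝ) ≤
            Cε * (Fintype.card F : ℝ) ^ ε *
              (Fintype.card F : ℝ) ^
                max ((k : ℝ) * ((d : ℝ) - (k : ℝ)) + 2 * (s - a))
                    (((k : ℝ) - 1) * ((d : ℝ) - (k : ℝ))) := by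
  intro ε hε
  refine ⟨4 * 10 ^ 140, by positivity, ?_⟩
  intro F _ _ k d a s E _ hkd _ hs hE
  refine (ncard_Tset_le hkd hs hE).trans (mul_le_mul_of_nonneg_right ?_ (by positivity))
  have hq : (1 : ℝ) ≤ Fintype.card F := by exact_mod_cast Fintype.card_pos
  exact le_mul_of_one_le_right (by positivity) (Real.one_le_rpow hq hε.le)
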